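/- Let X ⊂ ℙ^n be a smooth Fano complete intersection whose multidegree (d_1,…,d_s) is one of (2,2,2,2), (2,2,4), (2,3,3), (2,2,2,3), or (2,2,2,2,2), and let d := Σ d_i (so 8 ≤ d ≤ 10 and n ≥ d). Then the Fano variety of lines F(X) has dimension exactly 2n − d − s − 2. -/

import Mathlib

/-! Formalization of: if X ⊆ ℙ^n is a smooth Fano complete intersection whose multidegree
(d_1,…,d_s) is one of (2,2,2,2), (2,2,4), (2,3,3), (2,2,2,3), (2,2,2,2,2), then F(X) has
dimension exactly 2n − d − s − 2 where d = Σ d_i. -/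

noncomputable section

/-- The Zariski topology on complex projective `n`-space `ℙ(ℂ^{n+1})`: it is generated by the
complements of the zero loci of homogeneous polynomials. -/
instance projZariski (n : ℕ) : TopologicalSpace (Projectivization ℂ (Fin (n + 1) → ℂ)) :=
  TopologicalSpace.generateFrom
    {U | ∃ (k : ℕ) (f : MvPolynomial (Fin (n + 1)) ℂ), f.IsHomogeneous k ∧
      U = {x | MvPolynomial.eval x.rep f ≠ 0}}

/-- The Grassmannian `G(1,n)` of projective lines in `ℙ^n`, i.e. the set of 2-dimensional
linear subspaces of `ℂ^{n+1}`. -/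
def ProjLine (n : ℕ) : Type :=
  {W : Submodule ℂ (Fin (n + 1) → ℂ) // Module.finrank ℂ W = 2}

/-- The Zariski topology on the Grassmannian of lines: it is generated by the complements of
the loci of lines `ℙ(W)` on which a fixed polynomial in two vector arguments vanishes
identically on `W × W` (e.g. polynomials in the Plücker coordinates). -/
instance grassZariski (n : ℕ) : TopologicalSpace (ProjLine n) :=
  TopologicalSpace.generateFrom
    {U | ∃ F : MvPolynomial (Fin (n + 1) ⊕ Fin (n + 1)) ℂ,
      U = {W : ProjLine n | ¬ ∀ u ∈ W.1, ∀ v ∈ W.1, MvPolynomial.eval (Sum.elim u v) F = 0}}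

/-- The projective line `ℙ(W) ⊆ ℙ^n` associated to a linear subspace `W ⊆ ℂ^{n+1}`,
as a set of points of `ℙ^n`. -/
def lineSet {n : ℕ} (W : Submodule ℂ (Fin (n + 1) → ℂ)) :
    Set (Projectivization ℂ (Fin (n + 1) → ℂ)) :=
  {x | x.rep ∈ W}

/-- The Fano variety of lines of `X ⊆ ℙ^n`: the subset of the Grassmannian of lines
consisting of the lines contained in `X`. -/
def fanoLines {n : ℕ} (X : Set (Projectivization ℂ (Fin (n + 1) → ℂ))) : Set (ProjLine n) :=
  {W | lineSet W.1 ⊆ X}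

/-- `X ⊆ ℙ^n` is a smooth complete intersection of the `s` hypersurfaces of degrees
`d 0, …, d (s-1)` cut out by the homogeneous polynomials `f 0, …, f (s-1)`:  each `f i` is
homogeneous of degree `d i ≥ 2`, `X` is the common zero locus of the `f i`, `X` has
codimension `s` (i.e. dimension `n - s`), and the Jacobian matrix `(∂f_i/∂x_j)` has rank `s`
at every point of (the affine cone over) `X`. -/
structure IsSmoothCI (n s : ℕ) (d : Fin s → ℕ) (f : Fin s → MvPolynomial (Fin (n + 1)) ℂ)
    (X : Set (Projectivization ℂ (Fin (n + 1) → ℂ))) : Prop where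
  two_le_deg : ∀ i, 2 ≤ d i
  homog : ∀ i, (f i).IsHomogeneous (d i)
  locus : X = {x | ∀ i, MvPolynomial.eval x.rep (f i) = 0}
  codim : topologicalKrullDim ↥X = ((n - s : ℕ) : WithBot ℕ∞)
  smooth : ∀ v : Fin (n + 1) → ℂ, v ≠ 0 → (∀ i, MvPolynomial.eval v (f i) = 0) →
    (Matrix.of fun i j => MvPolynomial.eval v (MvPolynomial.pderiv j (f i))).rank = s

namespace FanoAux
open MvPolynomial

/-- Polynomial ring in `n+1` variables. -/
abbrev PR (n : ℕ) := MvPolynomial (Fin (n + 1)) ℂ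

/-- The algebraic part of the smoothness hypothesis. -/
structure SmoothData (n s : ℕ) (d : Fin s → ℕ) (f : Fin s → PR n) : Prop where
  two_le : ∀ i, 2 ≤ d i
  homog : ∀ i, (f i).IsHomogeneous (d i)
  smooth : ∀ v : Fin (n + 1) → ℂ, v ≠ 0 → (∀ i, eval v (f i) = 0) →
    (Matrix.of fun i j => eval v (pderiv j (f i))).rank = s

/-- Induction principle for homogeneous polynomials. -/
theorem homog_induct {n : ℕ} (p : ℕ → PR n → Prop) (h1 : p 0 1)
    (hX : ∀ e c h, h.IsHomogeneous e → p e h → p (e + 1) (X c * h))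
    (h0 : ∀ e, p e 0)
    (hadd : ∀ e g h, p e g → p e h → p e (g + h))
    (hC : ∀ e (r : ℂ) h, p e h → p e (C r * h)) :
    ∀ e h, h.IsHomogeneous e → p e h := by
  have hmon : ∀ e (m : Fin (n + 1) →₀ ℕ), m.degree = e → p e (monomial m 1) := by
    intro e
    induction e with
    | zero =>
      intro m hm
      rw [Finsupp.degree_eq_zero_iff] at hm
      subst hm
      exact h1
    | succ e ih =>
      intro m hm
      have : ∃ c, m c ≠ 0 := by
        by_contra hcon
        push Not at hcon
        have : m = 0 := Finsupp.ext hcon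
        subst this
        simp at hm
      obtain ⟨c, hc⟩ := this
      have hle : Finsupp.single c 1 ≤ m := by
        rw [Finsupp.single_le_iff]; omega
      have hms : m = Finsupp.single c 1 + (m - Finsupp.single c 1) := by
        rw [add_tsub_cancel_of_le hle]
      have hdeg : (m - Finsupp.single c 1).degree = e := by
        have := congrArg Finsupp.degree hms
        rw [map_add, Finsupp.degree_single] at this
        omega
      have hX' : (X c : PR n) * monomial (m - Finsupp.single c 1) 1 = monomial m 1 := by
        rw [X, monomial_mul, ← hms, one_mul]
      rw [← hX']
      exact hX e c _ (isHomogeneous_monomial _ hdeg) (ih _ hdeg)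
  intro e h hh
  rw [h.as_sum]
  have : ∀ T : Finset (Fin (n + 1) →₀ ℕ), T ⊆ h.support → p e (∑ v ∈ T, monomial v (coeff v h)) := by
    classical
    intro T
    induction T using Finset.induction_on with
    | empty => intro _; simpa using h0 e
    | insert a T ha ih =>
      intro hT
      rw [Finset.sum_insert ha]
      refine hadd _ _ _ ?_ (ih fun x hx => hT (Finset.mem_insert_of_mem hx))
      have hd : a.degree = e := by
        by_contra hne
        have := hh.coeff_eq_zero hne
        have h2 := hT (Finset.mem_insert_self a T)
        rw [mem_support_iff] at h2
        exact h2 this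
      have := hC e (coeff a h) _ (hmon e a hd)
      rwa [C_mul_monomial, mul_one] at this
  exact this _ subset_rfl

variable {n s : ℕ} {d : Fin s → ℕ} {f : Fin s → PR n}

/-- The module of relations. -/
def relMod (f : Fin s → PR n) : Submodule (PR n) (Fin s → PR n) :=
  Submodule.span (PR n) (Set.range (fun j i => pderiv j (f i)) ∪
    Set.range (fun p : Fin s × Fin s => f p.1 • (Pi.single p.2 1 : Fin s → PR n)))

theorem exists_relMod (H : SmoothData n s d f) :
    ∃ N : ℕ, ∀ c i, (X c : PR n) ^ N • (Pi.single i 1 : Fin s → PR n) ∈ relMod f := by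
  have key : ∀ c i, ∃ N : ℕ, (X c : PR n) ^ N • (Pi.single i 1 : Fin s → PR n) ∈ relMod f := by
    intro c i
    let I : Ideal (PR n) := (relMod f).comap
      (LinearMap.toSpanSingleton (PR n) (Fin s → PR n) (Pi.single i 1))
    have hI : ∀ g, g ∈ I ↔ g • (Pi.single i 1 : Fin s → PR n) ∈ relMod f := by
      intro g; simp only [I, Submodule.mem_comap, LinearMap.toSpanSingleton_apply]
    have hrad : (X c : PR n) ∈ I.radical := by
      rw [← vanishingIdeal_zeroLocus_eq_radical (K := ℂ), mem_vanishingIdeal_iff]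
      intro v hv
      rw [mem_zeroLocus_iff] at hv
      by_contra hne
      have hv0 : v ≠ 0 := by
        rintro rfl
        simp at hne
      have hf : ∀ k, eval v (f k) = 0 := by
        intro k
        have : f k ∈ I := by
          rw [hI]
          exact Submodule.subset_span (Or.inr ⟨(k, i), rfl⟩)
        have := hv _ this
        simpa [aeval_def, coe_aeval_eq_eval] using this
      have hr := H.smooth v hv0 hf
      set J := (Matrix.of fun i j => eval v (pderiv j (f i))) with hJ
      obtain ⟨R, hR⟩ : ∃ R : Matrix (Fin (n+1)) (Fin s) ℂ, J * R = 1 := by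
        have hsurj : Function.Surjective J.mulVecLin := by
          rw [← LinearMap.range_eq_top]
          apply Submodule.eq_top_of_finrank_eq
          rw [← Matrix.rank, hr]; simp
        choose g hg using hsurj
        refine ⟨Matrix.of fun a b => g (Pi.single b 1) a, ?_⟩
        ext a b
        have := congrFun (hg (Pi.single b 1)) a
        rw [Matrix.mulVecLin_apply] at this
        simp only [Matrix.mul_apply, Matrix.of_apply]
        rw [Matrix.mulVec, dotProduct] at this
        rw [this, Matrix.one_apply]
        simp [Pi.single_apply]
      let A : Matrix (Fin s) (Fin (n+1)) (PR n) := Matrix.of fun i j => pderiv j (f i)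
      let B : Matrix (Fin s) (Fin s) (PR n) := A * R.map C
      have hdet : B.det ∈ I := by
        rw [hI]
        have hB : B.det • (Pi.single i 1 : Fin s → PR n)
            = A.mulVec ((R.map C).mulVec (B.adjugate.mulVec (Pi.single i 1))) := by
          rw [Matrix.mulVec_mulVec, Matrix.mulVec_mulVec]
          change _ = (B * B.adjugate).mulVec _
          rw [Matrix.mul_adjugate, Matrix.smul_mulVec, Matrix.one_mulVec]
        rw [hB]
        generalize (R.map C).mulVec (B.adjugate.mulVec (Pi.single i 1)) = w
        rw [Matrix.mulVec_eq_sum]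
        refine Submodule.sum_mem _ fun j _ => ?_
        rw [op_smul_eq_smul]
        refine Submodule.smul_mem _ _ (Submodule.subset_span (Or.inl ⟨j, ?_⟩))
        ext; rfl
      have := hv _ hdet
      have h2 : (eval v) B.det = 0 := by simpa [aeval_def, coe_aeval_eq_eval] using this
      rw [RingHom.map_det] at h2
      have h3 : (eval v).mapMatrix B = J * R := by
        ext a b
        have : B a b = ∑ j, A a j * (R.map C) j b := Matrix.mul_apply
        rw [RingHom.mapMatrix_apply, Matrix.map_apply, this, Matrix.mul_apply]
        simp [A, J, Matrix.map_apply]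
      rw [h3, hR, Matrix.det_one] at h2
      exact one_ne_zero h2
    obtain ⟨N, hN⟩ := hrad
    exact ⟨N, (hI _).1 hN⟩
  choose N hN using key
  refine ⟨∑ c, ∑ i, N c i, fun c i => ?_⟩
  have hle : N c i ≤ ∑ c, ∑ i, N c i :=
    (Finset.single_le_sum (f := fun i => N c i) (fun _ _ => Nat.zero_le _) (Finset.mem_univ i)).trans
      (Finset.single_le_sum (f := fun c => ∑ i, N c i) (fun _ _ => Nat.zero_le _) (Finset.mem_univ c))
  obtain ⟨t, ht⟩ := Nat.exists_eq_add_of_le hle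
  rw [ht, pow_add, mul_comm, mul_smul]
  exact Submodule.smul_mem _ _ (hN c i)

variable {K : Type} [Field K] [Algebra ℂ K]

/-- A ℂ-linear functional vanishing on generators vanishes on `relMod`. -/
theorem relMod_kill (η : Fin s → PR n →ₗ[ℂ] K)
    (h1 : ∀ j g, ∑ i, η i (g * pderiv j (f i)) = 0) (h2 : ∀ i k g, η i (f k * g) = 0) :
    ∀ w ∈ relMod f, ∀ g, ∑ i, η i (g * w i) = 0 := by
  intro w hw
  induction hw using Submodule.span_induction with
  | mem x hx =>
    rcases hx with ⟨j, rfl⟩ | ⟨⟨k, i⟩, rfl⟩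
    · exact h1 j
    · intro g
      apply Finset.sum_eq_zero
      intro i' _
      change η i' (g * (f k * _)) = 0
      rw [mul_left_comm]
      exact h2 _ _ _
  | zero => intro g; simp
  | add x y _ _ hx hy =>
    intro g
    simp only [Pi.add_apply, mul_add, map_add, Finset.sum_add_distrib, hx g, hy g, add_zero]
  | smul a x _ hx =>
    intro g
    simp only [Pi.smul_apply, smul_eq_mul, ← mul_assoc]
    exact hx _

/-- B1: nondegeneracy of the Jacobian at points over any extension field. -/
theorem jac_indep (H : SmoothData n s d f) (u : Fin (n + 1) → K) (hu : u ≠ 0)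
    (hf : ∀ i, aeval u (f i) = 0) (l : Fin s → K)
    (hl : ∀ j, ∑ i, l i * aeval u (pderiv j (f i)) = 0) : l = 0 := by
  obtain ⟨N, hN⟩ := exists_relMod H
  obtain ⟨c, hc⟩ : ∃ c, u c ≠ 0 := by
    by_contra hcon; push Not at hcon; exact hu (funext hcon)
  let η : Fin s → PR n →ₗ[ℂ] K := fun i => (l i) • (aeval u : PR n →ₐ[ℂ] K).toLinearMap
  have hη : ∀ i g, η i g = l i * aeval u g := fun i g => rfl
  have := relMod_kill (f := f) η ?_ ?_
  · ext i
    have h := this _ (hN c i) 1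
    rw [Finset.sum_eq_single i] at h
    · simp only [hη, one_mul, Pi.smul_apply, Pi.single_eq_same, smul_eq_mul, mul_one, map_pow,
        aeval_X] at h
      rcases mul_eq_zero.1 h with h | h
      · exact h
      · exact absurd (eq_zero_of_pow_eq_zero h) hc
    · intro b _ hb
      simp [hb]
    · simp
  · intro j g
    simp only [hη, map_mul]
    have := congrArg (fun t => aeval u g * t) (hl j)
    simp only [mul_zero, Finset.mul_sum] at this
    rw [← this]
    exact Finset.sum_congr rfl fun i _ => by ring
  · intro i k g
    simp [hη, hf k]

/-- The main functionals. -/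
structure Star (d : Fin s → ℕ) (f : Fin s → PR n) (P : Fin (n + 1) → Fin (n + 1) → K) (Q : ℕ)
    (u θ : Fin (n + 1) → K) (η : Fin s → PR n →ₗ[ℂ] K) : Prop where
  deg : ∀ i e h, h.IsHomogeneous e → e + 1 ≠ d i + Q → η i h = 0
  supp : ∀ i a b c h, P a b * η i (X c * h) - P a c * η i (X b * h) + P b c * η i (X a * h) = 0
  van : ∀ i k h, η i (f k * h) = 0
  kill : ∀ j h, h.IsHomogeneous Q → ∑ i, η i (h * pderiv j (f i)) = aeval u h * θ j

/-- Case `θ = 0`. -/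
def Adm (d : Fin s → ℕ) (f : Fin s → PR n) (P : Fin (n + 1) → Fin (n + 1) → K) (Q : ℕ)
    (η : Fin s → PR n →ₗ[ℂ] K) : Prop := Star d f P Q 0 0 η

theorem Adm.star {P : Fin (n + 1) → Fin (n + 1) → K} {Q : ℕ} {η : Fin s → PR n →ₗ[ℂ] K}
    (h : Adm d f P Q η) (u : Fin (n + 1) → K) : Star d f P Q u 0 η :=
  ⟨h.deg, h.supp, h.van, fun j g hg => by rw [h.kill j g hg]; simp⟩

theorem Star.adm {P : Fin (n + 1) → Fin (n + 1) → K} {Q : ℕ} {η : Fin s → PR n →ₗ[ℂ] K}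
    {u : Fin (n + 1) → K} (h : Star d f P Q u 0 η) : Adm d f P Q η :=
  ⟨h.deg, h.supp, h.van, fun j g hg => by rw [h.kill j g hg]; simp⟩

/-- Functionals satisfying `deg` are determined by the homogeneous component. -/
theorem apply_comp (D : ℕ) (η : PR n →ₗ[ℂ] K)
    (h : ∀ e h, h.IsHomogeneous e → e ≠ D → η h = 0) (g : PR n) :
    η g = η (homogeneousComponent D g) := by
  conv_lhs => rw [← sum_homogeneousComponent g]
  rw [map_sum]
  by_cases hD : D ∈ Finset.range (g.totalDegree + 1)
  · rw [Finset.sum_eq_single_of_mem D hD]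
    intro b _ hb
    exact h b _ (homogeneousComponent_isHomogeneous _ _) hb
  · rw [homogeneousComponent_eq_zero D g (by simpa using hD), map_zero]
    refine Finset.sum_eq_zero fun b hb => h b _ (homogeneousComponent_isHomogeneous _ _) ?_
    rintro rfl; exact hD hb

theorem Adm.kill_all {P : Fin (n + 1) → Fin (n + 1) → K} {Q : ℕ} {η : Fin s → PR n →ₗ[ℂ] K}
    (H : SmoothData n s d f) (h : Adm d f P Q η) (j) (g : PR n) :
    ∑ i, η i (g * pderiv j (f i)) = 0 := by
  rw [← sum_homogeneousComponent g]
  simp only [Finset.sum_mul, map_sum]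
  rw [Finset.sum_comm]
  refine Finset.sum_eq_zero fun e _ => ?_
  by_cases he : e = Q
  · subst he
    rw [h.kill j _ (homogeneousComponent_isHomogeneous _ _)]; simp
  · refine Finset.sum_eq_zero fun i _ => ?_
    refine h.deg i _ _ ((homogeneousComponent_isHomogeneous e g).mul (H.homog i).pderiv) ?_
    have := H.two_le i
    omega

/-- B2 -/
theorem adm_bound (H : SmoothData n s d f) : ∃ B : ℕ, ∀ (K : Type) [Field K] [Algebra ℂ K]
    (P : Fin (n + 1) → Fin (n + 1) → K) (Q : ℕ) (η : Fin s → PR n →ₗ[ℂ] K),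
    Adm d f P Q η → B ≤ Q → η = 0 := by
  obtain ⟨N, hN⟩ := exists_relMod H
  refine ⟨(n + 1) * N, ?_⟩
  intro K _ _ P Q η h hQ
  have h1 := relMod_kill (f := f) η (fun j g => h.kill_all H j g) h.van
  have h2 : ∀ i c g, η i (g * X c ^ N) = 0 := by
    intro i c g
    have h := h1 _ (hN c i) g
    rw [Finset.sum_eq_single i] at h
    · simpa using h
    · intro b _ hb
      simp [hb]
    · simp
  funext i
  ext m
  change η i (monomial m 1) = 0
  by_cases hm : m.degree + 1 = d i + Q
  · obtain ⟨c, hc⟩ : ∃ c, N ≤ m c := by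
      by_contra hcon
      push Not at hcon
      have : m.degree ≤ (n + 1) * (N - 1) := by
        rw [Finsupp.degree_eq_sum]
        calc ∑ i, m i ≤ ∑ i : Fin (n+1), (N - 1) := Finset.sum_le_sum fun i _ => by
              have := hcon i; omega
          _ = _ := by simp
      have hN' : N - 1 + 1 = N := by have := hcon 0; omega
      have := H.two_le i
      rw [← hN'] at hQ
      nlinarith
    have hle : Finsupp.single c N ≤ m := by rwa [Finsupp.single_le_iff]
    have : (monomial m (1:ℂ)) = monomial (m - Finsupp.single c N) 1 * X c ^ N := by
      rw [X_pow_eq_monomial, monomial_mul, tsub_add_cancel_of_le hle, one_mul]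
    rw [this]; exact h2 _ _ _
  · exact h.deg i _ _ (isHomogeneous_monomial _ rfl) hm

/-- EV lemma -/
theorem ev_lemma (u : Fin (n + 1) → K) (i0 : Fin (n + 1)) (ζ : PR n →ₗ[ℂ] K)
    (hζ : ∀ c h, ζ (X c * h) = u c * ζ (X i0 * h)) (D : ℕ) :
    ∀ h, h.IsHomogeneous D → ζ h = aeval u h * ζ (X i0 ^ D) := by
  have := homog_induct (n := n) (fun e h => ∀ t, ζ (h * X i0 ^ t) = aeval u h * ζ (X i0 ^ (e + t)))
    (by intro t; simp)
    (by
      intro e c h _ ih t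
      rw [mul_assoc, hζ, ← mul_assoc, mul_comm (X i0) h, mul_assoc, ← pow_succ', ih]
      rw [map_mul, aeval_X, show e + (t + 1) = e + 1 + t by ring]; ring)
    (by intro e t; simp)
    (by intro e g h hg hh t; rw [add_mul, map_add, hg, hh, map_add]; ring)
    (by
      intro e r h hh t
      rw [mul_assoc, ← smul_eq_C_mul, map_smul, hh, ← smul_eq_C_mul, map_smul]
      simp [Algebra.smul_def, mul_assoc])
  intro h hh
  simpa using this D h hh 0

theorem hshift (e : ℕ) (c) (g : PR n) : homogeneousComponent (e + 1) (X c * g)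
      = X c * homogeneousComponent e g := by
    conv_lhs => rw [← sum_homogeneousComponent g, Finset.mul_sum, map_sum]
    have hh : ∀ i ∈ Finset.range (g.totalDegree + 1),
        homogeneousComponent (e + 1) (X c * homogeneousComponent i g)
        = if i = e then X c * homogeneousComponent e g else 0 := by
      intro i _
      have hi : (X c * homogeneousComponent i g).IsHomogeneous (i + 1) := by
        have := (isHomogeneous_X ℂ c).mul (homogeneousComponent_isHomogeneous i g)
        rwa [Nat.add_comm 1 i] at this
      rw [homogeneousComponent_of_mem hi]
      by_cases hie : i = e
      · subst hie; simp
      · rw [if_neg (by omega), if_neg hie]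
    rw [Finset.sum_congr rfl hh, Finset.sum_ite_eq']
    split_ifs with hmem
    · rfl
    · rw [homogeneousComponent_eq_zero e g (by simpa using hmem), mul_zero]

theorem hc_mul_exists {e : ℕ} {g : PR n} (hg : g.IsHomogeneous e) (D : ℕ) (h : PR n) :
    ∃ h', homogeneousComponent D (g * h) = g * h' := by
  have : ∀ i, ∃ h', homogeneousComponent D (g * homogeneousComponent i h) = g * h' := by
    intro i
    rw [homogeneousComponent_of_mem (hg.mul (homogeneousComponent_isHomogeneous i h))]
    split_ifs
    · exact ⟨_, rfl⟩
    · exact ⟨0, by simp⟩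
  choose h' hh' using this
  refine ⟨∑ i ∈ Finset.range (h.totalDegree + 1), h' i, ?_⟩
  conv_lhs => rw [← sum_homogeneousComponent h, Finset.mul_sum, map_sum]
  rw [Finset.mul_sum]
  exact Finset.sum_congr rfl fun i _ => hh' i

/-- subtracting evaluations -/
theorem Star.sub_ev (H : SmoothData n s d f) {P : Fin (n + 1) → Fin (n + 1) → K} {Q : ℕ}
    {u θ : Fin (n + 1) → K} {η : Fin s → PR n →ₗ[ℂ] K}
    (h : Star d f P Q u θ η) (huP : ∀ a b c, P a b * u c - P a c * u b + P b c * u a = 0)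
    (huf : ∀ i, aeval u (f i) = 0) (l : Fin s → K)
    (hl : ∀ j, θ j = ∑ i, l i * aeval u (pderiv j (f i))) :
    Adm d f P Q (fun i => η i - l i • (aeval u : PR n →ₐ[ℂ] K).toLinearMap ∘ₗ
      homogeneousComponent (d i + Q - 1)) := by
  constructor
  · intro i e g hg he
    have h2 := H.two_le i
    simp only [LinearMap.sub_apply, LinearMap.smul_apply, LinearMap.comp_apply]
    rw [h.deg i e g hg he, homogeneousComponent_of_mem hg, if_neg (by omega)]
    simp
  · intro i a b c g
    have h2 := H.two_le i
    obtain ⟨e, he⟩ : ∃ e, d i + Q - 1 = e + 1 := ⟨d i + Q - 2, by omega⟩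
    simp only [LinearMap.sub_apply, LinearMap.smul_apply, LinearMap.comp_apply, he, hshift,
      AlgHom.toLinearMap_apply, map_mul, aeval_X, smul_eq_mul]
    linear_combination h.supp i a b c g - l i * (aeval u (homogeneousComponent e g)) * huP a b c
  · intro i k g
    simp only [LinearMap.sub_apply, LinearMap.smul_apply, LinearMap.comp_apply, h.van,
      AlgHom.toLinearMap_apply]
    have : aeval u (homogeneousComponent (d i + Q - 1) (f k * g)) = 0 := by
      conv_lhs => rw [← sum_homogeneousComponent g, Finset.mul_sum, map_sum, map_sum]
      refine Finset.sum_eq_zero fun e _ => ?_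
      rw [homogeneousComponent_of_mem ((H.homog k).mul (homogeneousComponent_isHomogeneous e g))]
      split_ifs
      · rw [map_mul, huf, zero_mul]
      · simp
    rw [this]; simp
  · intro j g hg
    have h3 : ∀ i, homogeneousComponent (d i + Q - 1) (g * pderiv j (f i)) = g * pderiv j (f i) := by
      intro i
      have h2 := H.two_le i
      rw [homogeneousComponent_of_mem (hg.mul (H.homog i).pderiv), if_pos (by omega)]
    simp only [LinearMap.sub_apply, LinearMap.smul_apply, LinearMap.comp_apply, h3,
      Finset.sum_sub_distrib, h.kill j g hg, hl, AlgHom.toLinearMap_apply, map_mul, smul_eq_mul,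
      Pi.zero_apply, mul_zero, Finset.mul_sum]
    rw [← Finset.sum_sub_distrib]
    exact Finset.sum_eq_zero fun i _ => by ring

end FanoAux

namespace FanoAux
set_option linter.unusedSectionVars false
open MvPolynomial

variable {n s : ℕ} {d : Fin s → ℕ} {f : Fin s → PR n}
variable {K : Type} [Field K] [Algebra ℂ K]

/-- Reduced frame. -/
structure Frame (U V : Fin (n + 1) → K) (j0 j1 : Fin (n + 1)) : Prop where
  U0 : U j0 = 1
  U1 : U j1 = 0
  V0 : V j0 = 0
  V1 : V j1 = 1

/-- Plücker coordinates. -/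
def plu (U V : Fin (n + 1) → K) (a b : Fin (n + 1)) : K := U a * V b - U b * V a

/-- Restriction to the line. -/
def phi (U V : Fin (n + 1) → K) : PR n →ₐ[ℂ] Polynomial K :=
  aeval (fun c => Polynomial.C (U c) + Polynomial.C (V c) * Polynomial.X)

/-- The division relation. -/
def RRel (P : Fin (n + 1) → Fin (n + 1) → K) (c : K) (u : Fin (n + 1) → K)
    (η ξ : Fin s → PR n →ₗ[ℂ] K) : Prop :=
  ∀ i a b h, u a * ξ i (X b * h) - u b * ξ i (X a * h) = c * P a b * η i h

/-- A functional on polynomials given by values on powers. -/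
def Lw (w : ℕ → K) : Polynomial K →ₗ[K] K := Polynomial.lsum fun a => w a • LinearMap.id

theorem Lw_monomial (w : ℕ → K) (a : ℕ) (c : K) : Lw w (Polynomial.monomial a c) = w a * c := by
  simp [Lw, Polynomial.lsum_apply]

theorem Lw_X_pow (w : ℕ → K) (a : ℕ) : Lw w (Polynomial.X ^ a) = w a := by
  rw [Polynomial.X_pow_eq_monomial, Lw_monomial, mul_one]

theorem Lw_C_mul (w : ℕ → K) (c : K) (p : Polynomial K) : Lw w (Polynomial.C c * p) = c * Lw w p := by
  rw [← Polynomial.smul_eq_C_mul, map_smul, smul_eq_mul]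

/-- recursion for division -/
def wrec {R : Type} [CommRing R] (ρ : R) (w : ℕ → R) : ℕ → R
  | 0 => 0
  | m + 1 => ρ * wrec ρ w m + w m

theorem Lw_wrec_mul (ρ : K) (w : ℕ → K) (p : Polynomial K) :
    Lw (wrec ρ w) ((Polynomial.X - Polynomial.C ρ) * p) = Lw w p := by
  induction p using Polynomial.induction_on' with
  | add p q hp hq => rw [mul_add, map_add, map_add, hp, hq]
  | monomial m c =>
    rw [sub_mul, map_sub, Lw_C_mul, Polynomial.X_mul_monomial, Lw_monomial, Lw_monomial,
      Lw_monomial, wrec]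
    ring

theorem Lw_wrec_C (ρ : K) (w : ℕ → K) (c : K) : Lw (wrec ρ w) (Polynomial.C c) = 0 := by
  rw [← Polynomial.monomial_zero_left, Lw_monomial, wrec, zero_mul]

theorem phi_X (U V : Fin (n + 1) → K) (c) :
    phi U V (X c) = Polynomial.C (U c) + Polynomial.C (V c) * Polynomial.X := by
  simp [phi]

theorem phi_eval (U V : Fin (n + 1) → K) (ρ : K) (h : PR n) :
    (phi U V h).eval ρ = aeval (fun c => U c + ρ * V c) h := by
  have : ((Polynomial.aeval ρ : Polynomial K →ₐ[K] K).restrictScalars ℂ).comp (phi U V)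
      = aeval (fun c => U c + ρ * V c) := by
    apply MvPolynomial.algHom_ext
    intro c
    simp only [AlgHom.comp_apply, phi_X, AlgHom.restrictScalars_apply, map_add, map_mul,
      Polynomial.aeval_C, Polynomial.aeval_X, aeval_X, Algebra.algebraMap_self, RingHom.id_apply]
    ring
  rw [← this]
  simp

theorem phi_natDegree (U V : Fin (n + 1) → K) : ∀ e h, h.IsHomogeneous e →
    (phi U V h).natDegree ≤ e := by
  refine homog_induct (fun e h => (phi U V h).natDegree ≤ e) (by simp) ?_ (by simp) ?_ ?_
  · intro e c h _ ih
    rw [map_mul]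
    refine (Polynomial.natDegree_mul_le).trans ?_
    rw [add_comm]
    refine add_le_add ih ?_
    rw [phi_X, add_comm]
    exact Polynomial.natDegree_linear_le
  · intro e g h hg hh
    rw [map_add]
    exact (Polynomial.natDegree_add_le _ _).trans (max_le hg hh)
  · intro e r h hh
    rw [← smul_eq_C_mul, map_smul]
    exact (Polynomial.natDegree_smul_le _ _).trans hh

/-- Values of `η` on standard monomials -/
def wv (j0 j1 : Fin (n + 1)) (η : PR n →ₗ[ℂ] K) (D : ℕ) (a : ℕ) : K :=
  η (X j0 ^ (D - a) * X j1 ^ a)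

theorem frame_formula {U V : Fin (n + 1) → K} {j0 j1 : Fin (n + 1)} (η : PR n →ₗ[ℂ] K)
    (hη : ∀ c h, η (X c * h) = U c * η (X j0 * h) + V c * η (X j1 * h)) (D : ℕ) (h : PR n)
    (hh : h.IsHomogeneous D) : η h = Lw (wv j0 j1 η D) (phi U V h) := by
  have := homog_induct (n := n) (fun e h => ∀ t0 t1,
    η (h * (X j0 ^ t0 * X j1 ^ t1)) =
      Lw (wv j0 j1 η (e + t0 + t1)) (phi U V h * Polynomial.X ^ t1)) ?_ ?_ ?_ ?_ ?_ D h hh 0 0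
  · simpa using this
  · intro t0 t1
    rw [map_one, one_mul, one_mul, Lw_X_pow, wv]
    simp
  · intro e c h _ ih t0 t1
    have h1 : η (X c * h * (X j0 ^ t0 * X j1 ^ t1)) = U c * η (h * (X j0 ^ (t0 + 1) * X j1 ^ t1))
        + V c * η (h * (X j0 ^ t0 * X j1 ^ (t1 + 1))) := by
      rw [mul_assoc, hη]
      congr 3
      · ring
      · ring
    rw [h1, ih, ih, show e + (t0 + 1) + t1 = e + 1 + t0 + t1 by ring,
      show e + t0 + (t1 + 1) = e + 1 + t0 + t1 by ring, ← Lw_C_mul, ← Lw_C_mul, ← map_add]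
    congr 1
    rw [map_mul, phi_X]
    ring
  · intro e t0 t1; simp
  · intro e g h hg hh t0 t1
    rw [add_mul, map_add, hg, hh, map_add, add_mul, map_add]
  · intro e r h hh t0 t1
    have h2 : phi U V (C r * h) = Polynomial.C (algebraMap ℂ K r) * phi U V h := by
      rw [map_mul]
      congr 1
      simp [phi]
    rw [h2, mul_assoc, mul_assoc, Lw_C_mul, ← hh, ← smul_eq_C_mul, map_smul, Algebra.smul_def]

theorem Star.frame_supp {U V : Fin (n + 1) → K} {j0 j1 : Fin (n + 1)} (fr : Frame U V j0 j1)
    {q : ℕ} {u θ : Fin (n + 1) → K} {η : Fin s → PR n →ₗ[ℂ] K}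
    (h : Star d f (plu U V) q u θ η) (i c g) :
    η i (X c * g) = U c * η i (X j0 * g) + V c * η i (X j1 * g) := by
  have := h.supp i j0 j1 c g
  simp only [plu, fr.U0, fr.U1, fr.V0, fr.V1] at this
  linear_combination this

theorem adm_W_kill (H : SmoothData n s d f) {U V : Fin (n + 1) → K} {j0 j1 : Fin (n + 1)}
    (fr : Frame U V j0 j1)
    {q : ℕ} {η : Fin s → PR n →ₗ[ℂ] K} (h : Adm d f (plu U V) q η) (j) (g : Polynomial K)
    (hg : g.natDegree ≤ q) :
    ∑ i, Lw (wv j0 j1 (η i) (d i + q - 1)) (g * phi U V (pderiv j (f i))) = 0 := by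
  have hb : ∀ b ≤ q, ∑ i, Lw (wv j0 j1 (η i) (d i + q - 1))
      (Polynomial.X ^ b * phi U V (pderiv j (f i))) = 0 := by
    intro b hb
    have h1 : ((X j0 : PR n) ^ (q - b) * X j1 ^ b).IsHomogeneous q := by
      have := (isHomogeneous_X_pow (R := ℂ) j0 (q - b)).mul (isHomogeneous_X_pow (R := ℂ) j1 b)
      rwa [Nat.sub_add_cancel hb] at this
    have h2 := h.kill j _ h1
    simp only [Pi.zero_apply, mul_zero] at h2
    rw [← h2]
    refine Finset.sum_congr rfl fun i _ => ?_
    have hd := H.two_le i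
    have h3 : ((X j0 : PR n) ^ (q - b) * X j1 ^ b * pderiv j (f i)).IsHomogeneous (d i + q - 1) := by
      have := h1.mul ((H.homog i).pderiv (i := j))
      rwa [show q + (d i - 1) = d i + q - 1 by omega] at this
    rw [frame_formula (η i) (fun c g => Star.frame_supp fr h i c g) _ _ h3]
    congr 1
    rw [map_mul, map_mul, map_pow, map_pow, phi_X, phi_X, fr.U0, fr.U1, fr.V0, fr.V1]
    simp
  have hg' := g.as_sum_range' (q + 1) (by omega)
  conv_lhs => rw [hg']
  simp only [Finset.sum_mul, map_sum]
  rw [Finset.sum_comm]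
  refine Finset.sum_eq_zero fun b hb' => ?_
  have := hb b (by simpa [Nat.lt_succ_iff] using hb')
  simp only [← Polynomial.C_mul_X_pow_eq_monomial, mul_assoc, Lw_C_mul]
  rw [← Finset.mul_sum, this, mul_zero]

/-- The vector `θ` of the divided functional. -/
def thetaDiv (d : Fin s → ℕ) (f : Fin s → PR n) (U V : Fin (n + 1) → K) (j0 j1 : Fin (n + 1))
    (q : ℕ) (η : Fin s → PR n →ₗ[ℂ] K) (ρ : K) (j : Fin (n + 1)) : K :=
  ∑ i, Lw (wrec ρ (wv j0 j1 (η i) (d i + q - 1))) (phi U V (pderiv j (f i)))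

/-- B3 -/
theorem divide (H : SmoothData n s d f) {U V : Fin (n + 1) → K} {j0 j1 : Fin (n + 1)}
    (fr : Frame U V j0 j1) (on : ∀ i, phi U V (f i) = 0)
    {q : ℕ} {η : Fin s → PR n →ₗ[ℂ] K} (h : Adm d f (plu U V) q η) (ρ : K) :
    ∃ ξ, Star d f (plu U V) (q + 1) (fun c => U c + ρ * V c)
      (thetaDiv d f U V j0 j1 q η ρ) ξ ∧ RRel (plu U V) 1 (fun c => U c + ρ * V c) η ξ := by
  let ξ : Fin s → PR n →ₗ[ℂ] K := fun i =>
    (Lw (wrec ρ (wv j0 j1 (η i) (d i + q - 1)))).restrictScalars ℂ ∘ₗ (phi U V).toLinearMap ∘ₗ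
      homogeneousComponent (d i + q)
  have hξ : ∀ i g, ξ i g = Lw (wrec ρ (wv j0 j1 (η i) (d i + q - 1)))
    (phi U V (homogeneousComponent (d i + q) g)) := fun i g => rfl
  have hC : ∀ (w : ℕ → K) (c : K) (p : Polynomial K), c * Lw w p = Lw w (Polynomial.C c * p) :=
    fun w c p => (Lw_C_mul w c p).symm
  refine ⟨ξ, ⟨?_, ?_, ?_, ?_⟩, ?_⟩
  · intro i e g hg he
    rw [hξ, homogeneousComponent_of_mem hg, if_neg (by omega)]; simp
  · intro i a b c g
    have hd := H.two_le i
    obtain ⟨e, he⟩ : ∃ e, d i + q = e + 1 := ⟨d i + q - 1, by omega⟩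
    simp only [hξ, he, hshift, hC, ← map_add, ← map_sub]
    convert map_zero (Lw (wrec ρ (wv j0 j1 (η i) (e + 1 - 1)))) using 2
    rw [map_mul, map_mul, map_mul, phi_X, phi_X, phi_X, plu, plu, plu]
    simp only [map_sub, map_mul]
    ring
  · intro i k g
    obtain ⟨h', hh'⟩ := hc_mul_exists (H.homog k) (d i + q) g
    rw [hξ, hh', map_mul, on, zero_mul, map_zero]
  · intro j g hg
    have h3 : ∀ i, homogeneousComponent (d i + q) (g * pderiv j (f i)) = g * pderiv j (f i) := by
      intro i
      have h2 := H.two_le i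
      rw [homogeneousComponent_of_mem (hg.mul (H.homog i).pderiv), if_pos (by omega)]
    simp only [hξ, h3, map_mul]
    set p := phi U V g with hp
    have hdiv : p = Polynomial.C (p.eval ρ) + (Polynomial.X - Polynomial.C ρ) *
        (p /ₘ (Polynomial.X - Polynomial.C ρ)) := by
      conv_lhs => rw [← Polynomial.modByMonic_add_div p (Polynomial.X - Polynomial.C ρ),
        Polynomial.modByMonic_X_sub_C_eq_C_eval]
    have hdeg : (p /ₘ (Polynomial.X - Polynomial.C ρ)).natDegree ≤ q := by
      rw [Polynomial.natDegree_divByMonic _ (Polynomial.monic_X_sub_C ρ),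
        Polynomial.natDegree_X_sub_C]
      have := phi_natDegree U V _ g hg
      rw [← hp] at this
      omega
    have hk := adm_W_kill H fr h j _ hdeg
    generalize p /ₘ (Polynomial.X - Polynomial.C ρ) = g' at *
    rw [← phi_eval U V ρ g, ← hp]
    generalize p.eval ρ = c at *
    rw [hdiv]
    simp only [add_mul, map_add, mul_assoc, Lw_wrec_mul, Lw_C_mul, Finset.sum_add_distrib, hk,
      add_zero]
    rw [← Finset.mul_sum]
    rfl
  · intro i a b g
    have hd := H.two_le i
    obtain ⟨e, he⟩ : ∃ e, d i + q = e + 1 := ⟨d i + q - 1, by omega⟩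
    have h4 : η i g = η i (homogeneousComponent e g) := by
      refine apply_comp e (η i) ?_ g
      intro e' g' hg' hne
      exact h.deg i e' g' hg' (by omega)
    rw [h4, frame_formula (η i) (fun c g => Star.frame_supp fr h i c g) _ _
      (homogeneousComponent_isHomogeneous e g)]
    simp only [hξ, he, hshift, Nat.add_sub_cancel]
    rw [← Lw_wrec_mul ρ (wv j0 j1 (η i) e), hC, hC, hC, ← map_sub]
    congr 1
    rw [map_mul, map_mul, phi_X, phi_X, plu]
    simp only [map_sub, map_mul, map_add, map_one]
    ring

theorem on_eval {U V : Fin (n + 1) → K} (on : ∀ i, phi U V (f i) = 0) (ρ : K) (i) :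
    aeval (fun c => U c + ρ * V c) (f i) = 0 := by
  rw [← phi_eval, on]; simp

theorem plu_u (U V : Fin (n + 1) → K) (ρ : K) (a b c) :
    plu U V a b * (U c + ρ * V c) - plu U V a c * (U b + ρ * V b)
      + plu U V b c * (U a + ρ * V a) = 0 := by
  simp only [plu]; ring

/-- If `θ` is in the span of the differentials we can correct. -/
theorem correct (H : SmoothData n s d f) {P : Fin (n + 1) → Fin (n + 1) → K}
    {Q : ℕ} {u θ : Fin (n + 1) → K} {η ξ : Fin s → PR n →ₗ[ℂ] K} {c : K}
    (h : Star d f P Q u θ ξ)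
    (huP : ∀ a b c, P a b * u c - P a c * u b + P b c * u a = 0)
    (huf : ∀ i, aeval u (f i) = 0) (hR : RRel P c u η ξ)
    (l : Fin s → K) (hl : ∀ j, θ j = ∑ i, l i * aeval u (pderiv j (f i))) :
    ∃ ξ', Adm d f P Q ξ' ∧ RRel P c u η ξ' := by
  refine ⟨_, h.sub_ev H huP huf l hl, ?_⟩
  intro i a b g
  have h2 := H.two_le i
  obtain ⟨e, he⟩ : ∃ e, d i + Q - 1 = e + 1 := ⟨d i + Q - 2, by omega⟩
  have := hR i a b g
  simp only [LinearMap.sub_apply, LinearMap.smul_apply, LinearMap.comp_apply, he, hshift,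
      AlgHom.toLinearMap_apply, map_mul, aeval_X, smul_eq_mul]
  linear_combination this

/-- Two solutions of the division relation differ by an evaluation. -/
theorem RRel.diff {P : Fin (n + 1) → Fin (n + 1) → K} {c : K}
    {u : Fin (n + 1) → K} {η ξ ξ' : Fin s → PR n →ₗ[ℂ] K} (h : RRel P c u η ξ)
    (h' : RRel P c u η ξ') {j0 : Fin (n + 1)} (h0 : u j0 = 1) (i) (D : ℕ) (g)
    (hg : g.IsHomogeneous D) :
    ξ i g - ξ' i g = aeval u g * (ξ i (X j0 ^ D) - ξ' i (X j0 ^ D)) := by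
  have := ev_lemma u j0 (ξ i - ξ' i) ?_ D g hg
  · simpa using this
  · intro c g
    have h1 := h i j0 c g
    have h2 := h' i j0 c g
    simp only [h0] at h1 h2
    simp only [LinearMap.sub_apply]
    linear_combination h1 - h2

theorem theta_of_adm (H : SmoothData n s d f) {P : Fin (n + 1) → Fin (n + 1) → K} {c : K}
    {Q : ℕ} {u θ : Fin (n + 1) → K} {η ξ ξ' : Fin s → PR n →ₗ[ℂ] K}
    (h : Star d f P Q u θ ξ) (hR : RRel P c u η ξ) (h' : Adm d f P Q ξ') (hR' : RRel P c u η ξ')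
    {j0 : Fin (n + 1)} (h0 : u j0 = 1) :
    ∃ l : Fin s → K, ∀ j, θ j = ∑ i, l i * aeval u (pderiv j (f i)) := by
  refine ⟨fun i => ξ i (X j0 ^ (Q + (d i - 1))) - ξ' i (X j0 ^ (Q + (d i - 1))), fun j => ?_⟩
  have hq : ((X j0 : PR n) ^ Q).IsHomogeneous Q := isHomogeneous_X_pow j0 Q
  have h1 := h.kill j _ hq
  have h2 := h'.kill j _ hq
  simp only [map_pow, aeval_X, h0, one_pow, one_mul, Pi.zero_apply, mul_zero] at h1 h2
  rw [← h1, ← sub_zero (∑ i, _), ← h2, ← Finset.sum_sub_distrib]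
  refine Finset.sum_congr rfl fun i _ => ?_
  rw [hR.diff hR' h0 i _ _ (hq.mul (H.homog i).pderiv), map_mul, map_pow, aeval_X, h0]
  ring

/-- B4 -/
theorem two_points (H : SmoothData n s d f) {U V : Fin (n + 1) → K} {j0 j1 : Fin (n + 1)}
    (fr : Frame U V j0 j1) (on : ∀ i, phi U V (f i) = 0)
    {q : ℕ} {η ξ1 ξ2 : Fin s → PR n →ₗ[ℂ] K} {ρ1 ρ2 : K} (hne : ρ1 ≠ ρ2)
    (h1 : Adm d f (plu U V) (q + 1) ξ1) (hR1 : RRel (plu U V) 1 (fun c => U c + ρ1 * V c) η ξ1)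
    (h2 : Adm d f (plu U V) (q + 1) ξ2) (hR2 : RRel (plu U V) 1 (fun c => U c + ρ2 * V c) η ξ2) :
    ∃ ξ, Adm d f (plu U V) (q + 2) ξ ∧ RRel (plu U V) 1 (fun c => U c + ρ2 * V c) ξ1 ξ := by
  obtain ⟨ζ, hζ, hRζ⟩ := divide H fr on h1 ρ2
  set u2 := (fun c => U c + ρ2 * V c) with hu2
  have h20 : u2 j0 = 1 := by simp [hu2, fr.U0, fr.V0]
  have h21 : u2 j1 = ρ2 := by simp [hu2, fr.U1, fr.V1]
  refine correct H hζ (plu_u U V ρ2) (on_eval on ρ2) hRζ ?_ ?_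
  · exact fun i => (ρ2 - ρ1)⁻¹ * ((ζ i (X j1 * X j0 ^ (q + 1 + (d i - 1))) - ρ1 * ζ i (X j0 * X j0 ^ (q + 1 + (d i - 1))))
      - ξ2 i (X j0 ^ (q + 1 + (d i - 1))))
  intro j
  let ζ' : Fin s → PR n →ₗ[ℂ] K := fun i =>
    ζ i ∘ₗ LinearMap.mulLeft ℂ (X j1) - ρ1 • (ζ i ∘ₗ LinearMap.mulLeft ℂ (X j0))
  have hζ' : ∀ i g, ζ' i g = ζ i (X j1 * g) - ρ1 * ζ i (X j0 * g) := fun i g => rfl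
  have hR' : RRel (plu U V) 1 u2 η ζ' := by
    intro i a b g
    have e1 := hRζ i a b (X j1 * g)
    have e2 := hRζ i a b (X j0 * g)
    have e3 := hR1 i j0 j1 g
    simp only [fr.U0, fr.V0, fr.U1, fr.V1, plu] at e3
    simp only [hζ']
    rw [mul_left_comm (X j1) (X b), mul_left_comm (X j0) (X b), mul_left_comm (X j1) (X a),
      mul_left_comm (X j0) (X a)]
    linear_combination e1 - ρ1 * e2 + plu U V a b * e3
  have hq : ((X j0 : PR n) ^ (q + 1)).IsHomogeneous (q + 1) := isHomogeneous_X_pow j0 (q + 1)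
  have hq1 : (X j1 * (X j0 : PR n) ^ (q + 1)).IsHomogeneous (q + 1 + 1) := by
    have := (isHomogeneous_X ℂ j1).mul hq
    rwa [Nat.add_comm 1 (q + 1)] at this
  have hq0 : (X j0 * (X j0 : PR n) ^ (q + 1)).IsHomogeneous (q + 1 + 1) := by
    have := (isHomogeneous_X ℂ j0).mul hq
    rwa [Nat.add_comm 1 (q + 1)] at this
  have k1 := hζ.kill j _ hq1
  have k0 := hζ.kill j _ hq0
  have k2 := h2.kill j _ hq
  simp only [map_mul, map_pow, aeval_X, h20, h21, one_pow, one_mul, mul_one, Pi.zero_apply,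
    mul_zero] at k1 k0 k2
  have key : (ρ2 - ρ1) * thetaDiv d f U V j0 j1 (q + 1) ξ1 ρ2 j =
    ∑ i, (ζ' i (X j0 ^ (q + 1) * pderiv j (f i)) - ξ2 i (X j0 ^ (q + 1) * pderiv j (f i))) := by
    rw [Finset.sum_sub_distrib, k2, sub_zero]
    simp only [hζ', Finset.sum_sub_distrib, ← Finset.mul_sum, ← mul_assoc]
    rw [k1, k0]; ring
  have h3 : (ρ2 - ρ1) ≠ 0 := sub_ne_zero.2 hne.symm
  rw [← mul_right_inj' h3, key, Finset.mul_sum]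
  refine Finset.sum_congr rfl fun i _ => ?_
  rw [hR'.diff hR2 h20 i _ _ (hq.mul (H.homog i).pderiv), map_mul, map_pow, aeval_X, h20, hζ']
  field_simp
  ring

theorem RRel.ne_zero {U V : Fin (n + 1) → K} {j0 j1 : Fin (n + 1)}
    (fr : Frame U V j0 j1) {u : Fin (n + 1) → K} {η ξ : Fin s → PR n →ₗ[ℂ] K}
    (h : RRel (plu U V) 1 u η ξ) (hη : η ≠ 0) : ξ ≠ 0 := by
  rintro rfl
  apply hη
  funext i
  refine LinearMap.ext fun g => ?_
  have := h i j0 j1 g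
  simp [plu, fr.U0, fr.V0, fr.U1, fr.V1] at this
  simpa using this.symm

theorem infinite_points (H : SmoothData n s d f) {U V : Fin (n + 1) → K} {j0 j1 : Fin (n + 1)}
    (fr : Frame U V j0 j1) (on : ∀ i, phi U V (f i) = 0) (N : ℕ) :
    ∀ {q : ℕ} {η : Fin s → PR n →ₗ[ℂ] K} (_ : η ≠ 0) (T : Set K) (_ : T.Infinite)
      (_ : ∀ ρ ∈ T, ∃ ξ, Adm d f (plu U V) (q + 1) ξ ∧
        RRel (plu U V) 1 (fun c => U c + ρ * V c) η ξ),
      ∃ ξ, ξ ≠ 0 ∧ Adm d f (plu U V) (q + 1 + N) ξ := by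
  induction N with
  | zero =>
    intro q η hη T hT h
    obtain ⟨ρ, hρ⟩ := hT.nonempty
    obtain ⟨ξ, hξ, hR⟩ := h ρ hρ
    exact ⟨ξ, hR.ne_zero fr hη, hξ⟩
  | succ N ih =>
    intro q η hη T hT h
    obtain ⟨ρ1, hρ1⟩ := hT.nonempty
    obtain ⟨ξ1, hξ1, hR1⟩ := h ρ1 hρ1
    have hT' : ∀ ρ ∈ T \ {ρ1}, ∃ ξ, Adm d f (plu U V) (q + 1 + 1) ξ ∧
        RRel (plu U V) 1 (fun c => U c + ρ * V c) ξ1 ξ := by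
      rintro ρ2 ⟨hρ2, hne⟩
      obtain ⟨ξ2, hξ2, hR2⟩ := h ρ2 hρ2
      exact two_points H fr on (fun h => hne h.symm) hξ1 hR1 hξ2 hR2
    obtain ⟨ξ, h0, h1⟩ := ih (q := q + 1) (hR1.ne_zero fr hη) (T \ {ρ1})
      (hT.sdiff (Set.finite_singleton ρ1)) hT'
    refine ⟨ξ, h0, ?_⟩
    rwa [show q + 1 + (N + 1) = q + 1 + 1 + N by ring]

theorem not_infinite (H : SmoothData n s d f) {U V : Fin (n + 1) → K} {j0 j1 : Fin (n + 1)}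
    (fr : Frame U V j0 j1) (on : ∀ i, phi U V (f i) = 0)
    {q : ℕ} {η : Fin s → PR n →ₗ[ℂ] K} (hη : η ≠ 0) (T : Set K) (hT : T.Infinite)
      (h : ∀ ρ ∈ T, ∃ ξ, Adm d f (plu U V) (q + 1) ξ ∧
        RRel (plu U V) 1 (fun c => U c + ρ * V c) η ξ) : False := by
  obtain ⟨B, hB⟩ := adm_bound H
  obtain ⟨ξ, h0, h1⟩ := infinite_points H fr on B hη T hT h
  exact h0 (hB K _ _ ξ h1 (by omega))

end FanoAux

namespace FanoAux
set_option linter.unusedSectionVars false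
open MvPolynomial

variable {n s : ℕ} {d : Fin s → ℕ} {f : Fin s → PR n}
variable {K L : Type} [Field K] [Algebra ℂ K] [Field L] [Algebra ℂ L]

theorem Star.map (σ : K →ₐ[ℂ] L) {P : Fin (n + 1) → Fin (n + 1) → K} {Q : ℕ}
    {u θ : Fin (n + 1) → K} {η : Fin s → PR n →ₗ[ℂ] K} (h : Star d f P Q u θ η) :
    Star d f (fun a b => σ (P a b)) Q (fun c => σ (u c)) (fun c => σ (θ c))
      (fun i => σ.toLinearMap ∘ₗ η i) := by
  constructor
  · intro i e g hg he
    simp [h.deg i e g hg he]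
  · intro i a b c g
    have := congrArg σ (h.supp i a b c g)
    simpa using this
  · intro i k g
    simp [h.van]
  · intro j g hg
    have := congrArg σ (h.kill j g hg)
    simp only [map_sum, map_mul] at this
    rw [comp_aeval_apply] at this
    simp only [LinearMap.comp_apply, AlgHom.toLinearMap_apply, this]

theorem Adm.map (σ : K →ₐ[ℂ] L) {P : Fin (n + 1) → Fin (n + 1) → K} {Q : ℕ}
    {η : Fin s → PR n →ₗ[ℂ] K} (h : Adm d f P Q η) :
    Adm d f (fun a b => σ (P a b)) Q (fun i => σ.toLinearMap ∘ₗ η i) := by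
  have := Star.map σ h
  simp only [Pi.zero_apply, map_zero] at this
  exact this

theorem phi_map (σ : K →ₐ[ℂ] L) (U V : Fin (n + 1) → K) (h : PR n) :
    phi (fun c => σ (U c)) (fun c => σ (V c)) h = (phi U V h).map (σ : K →+* L) := by
  have : (Polynomial.mapAlgHom σ).comp (phi U V) = phi (fun c => σ (U c)) (fun c => σ (V c)) := by
    apply MvPolynomial.algHom_ext
    intro c
    simp [phi_X]
  rw [← this]; rfl

theorem Frame.map (σ : K →ₐ[ℂ] L) {U V : Fin (n + 1) → K} {j0 j1 : Fin (n + 1)}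
    (fr : Frame U V j0 j1) : Frame (fun c => σ (U c)) (fun c => σ (V c)) j0 j1 :=
  ⟨by simp [fr.U0], by simp [fr.U1], by simp [fr.V0], by simp [fr.V1]⟩

theorem plu_map (σ : K →ₐ[ℂ] L) (U V : Fin (n + 1) → K) :
    (fun a b => σ (plu U V a b)) = plu (fun c => σ (U c)) (fun c => σ (V c)) := by
  funext a b; simp [plu]

theorem wrec_map {R S : Type} [CommRing R] [CommRing S] (σ : R →+* S) (ρ : R) (w : ℕ → R) (m) :
    σ (wrec ρ w m) = wrec (σ ρ) (fun a => σ (w a)) m := by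
  induction m with
  | zero => simp [wrec]
  | succ m ih => simp [wrec, ih]

/-- polynomial version of the divided functional -/
def Aw (w : ℕ → K) : Polynomial K →ₗ[K] Polynomial K :=
  Polynomial.lsum fun a => LinearMap.toSpanSingleton K (Polynomial K)
    (wrec Polynomial.X (fun b => Polynomial.C (w b)) a)

theorem Aw_monomial (w : ℕ → K) (m : ℕ) (c : K) : Aw w (Polynomial.monomial m c) =
    c • (wrec Polynomial.X (fun b => Polynomial.C (w b)) m) := by
  simp [Aw, Polynomial.lsum_apply]

theorem Aw_eval (σ : K →+* L) (ρ : L) (w : ℕ → K) (p : Polynomial K) :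
    (Aw w p).eval₂ σ ρ = Lw (wrec ρ (fun a => σ (w a))) (p.map σ) := by
  induction p using Polynomial.induction_on' with
  | add p q hp hq => rw [map_add, Polynomial.eval₂_add, hp, hq, Polynomial.map_add, map_add]
  | monomial m c =>
    rw [Aw_monomial, Polynomial.map_monomial, Lw_monomial, Polynomial.smul_eq_C_mul,
      Polynomial.eval₂_mul, Polynomial.eval₂_C, mul_comm]
    congr 1
    have := wrec_map (Polynomial.eval₂RingHom σ ρ) Polynomial.X (fun b => Polynomial.C (w b)) m
    simpa using this

/-- The polynomial `α_j`. -/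
def alphaPoly (d : Fin s → ℕ) (f : Fin s → PR n) (U V : Fin (n + 1) → K) (j0 j1 : Fin (n + 1))
    (q : ℕ) (η : Fin s → PR n →ₗ[ℂ] K) (j : Fin (n + 1)) : Polynomial K :=
  ∑ i, Aw (wv j0 j1 (η i) (d i + q - 1)) (phi U V (pderiv j (f i)))

theorem thetaDiv_map (σ : K →ₐ[ℂ] L) (U V : Fin (n + 1) → K) (j0 j1 : Fin (n + 1))
    (q : ℕ) (η : Fin s → PR n →ₗ[ℂ] K) (ρ : L) (j : Fin (n + 1)) :
    thetaDiv d f (fun c => σ (U c)) (fun c => σ (V c)) j0 j1 q (fun i => σ.toLinearMap ∘ₗ η i) ρ j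
      = (alphaPoly d f U V j0 j1 q η j).eval₂ (σ : K →+* L) ρ := by
  rw [alphaPoly, Polynomial.eval₂_finsetSum, thetaDiv]
  refine Finset.sum_congr rfl fun i _ => ?_
  rw [Aw_eval, phi_map]
  rfl

theorem thetaDiv_eq (U V : Fin (n + 1) → K) (j0 j1 : Fin (n + 1))
    (q : ℕ) (η : Fin s → PR n →ₗ[ℂ] K) (ρ : K) (j : Fin (n + 1)) :
    thetaDiv d f U V j0 j1 q η ρ j = (alphaPoly d f U V j0 j1 q η j).eval ρ :=
  thetaDiv_map (AlgHom.id ℂ K) U V j0 j1 q η ρ j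

theorem phi_eval_map (σ : K →ₐ[ℂ] L) (U V : Fin (n + 1) → K) (ρ : L) (h : PR n) :
    aeval (fun c => σ (U c) + ρ * σ (V c)) h = (phi U V h).eval₂ (σ : K →+* L) ρ := by
  rw [← phi_eval, phi_map, Polynomial.eval_map]

/-- Descent of solutions of linear systems with polynomial coefficients. -/
theorem descend_span (σ : K →+* L) (ρ : L)
    (hρ : ∀ p : Polynomial K, p.eval₂ σ ρ = 0 → p = 0)
    {ι κ : Type} [Fintype ι] [Fintype κ] (G : ι → κ → Polynomial K) (α : κ → Polynomial K)
    (l : ι → L) (hl : ∀ j, (α j).eval₂ σ ρ = ∑ i, l i * (G i j).eval₂ σ ρ) :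
    ∃ (b : Polynomial K) (a : ι → Polynomial K), b ≠ 0 ∧ ∀ j, b * α j = ∑ i, a i * G i j := by
  let ev : Polynomial K →+* L := Polynomial.eval₂RingHom σ ρ
  have hinj : Function.Injective ev := by
    rw [injective_iff_map_eq_zero]
    exact hρ
  let F := FractionRing (Polynomial K)
  let e : F →+* L := IsFractionRing.lift hinj
  letI : Algebra F L := e.toAlgebra
  have he : ∀ p : Polynomial K, algebraMap F L (algebraMap _ F p) = p.eval₂ σ ρ := by
    intro p
    exact IsFractionRing.lift_algebraMap hinj p
  obtain ⟨π, hπ⟩ := LinearMap.exists_leftInverse_of_injective (Algebra.linearMap F L)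
    (LinearMap.ker_eq_bot.2 (algebraMap F L).injective)
  have hπ' : ∀ x : F, π (algebraMap F L x) = x := fun x => LinearMap.congr_fun hπ x
  have h1 : ∀ j, algebraMap _ F (α j) = ∑ i, π (l i) * algebraMap _ F (G i j) := by
    intro j
    rw [← hπ' (algebraMap _ F (α j)), he, hl, map_sum]
    refine Finset.sum_congr rfl fun i _ => ?_
    rw [← he, mul_comm, ← Algebra.smul_def, map_smul, smul_eq_mul, mul_comm]
  obtain ⟨b, hb⟩ := IsLocalization.exist_integer_multiples_of_finite
    (nonZeroDivisors (Polynomial K)) (fun i => π (l i))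
  choose a ha using hb
  refine ⟨b, a, nonZeroDivisors.coe_ne_zero b, fun j => ?_⟩
  apply IsFractionRing.injective (Polynomial K) F
  rw [map_mul, h1, Finset.mul_sum, map_sum]
  refine Finset.sum_congr rfl fun i _ => ?_
  rw [map_mul, ha, Algebra.smul_def]
  simp only [mul_assoc]

instance infinite_of_complex : Infinite K :=
  Infinite.of_injective (algebraMap ℂ K) (algebraMap ℂ K).injective

/-- B5, Lemma Z -/
theorem lemmaZ (H : SmoothData n s d f) {U V : Fin (n + 1) → K} {j0 j1 : Fin (n + 1)}
    (fr : Frame U V j0 j1) (on : ∀ i, phi U V (f i) = 0)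
    {q : ℕ} {η : Fin s → PR n →ₗ[ℂ] K} (hη : η ≠ 0) (h : Adm d f (plu U V) q η)
    (σ : K →ₐ[ℂ] L) (ρ : L)
    (hρ : ∀ p : Polynomial K, p.eval₂ (σ : K →+* L) ρ = 0 → p = 0)
    {ξ : Fin s → PR n →ₗ[ℂ] L}
    (hξ : Adm d f (plu (fun c => σ (U c)) (fun c => σ (V c))) (q + 1) ξ)
    (hR : RRel (plu (fun c => σ (U c)) (fun c => σ (V c))) 1 (fun c => σ (U c) + ρ * σ (V c))
      (fun i => σ.toLinearMap ∘ₗ η i) ξ) : False := by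
  have h' := h.map σ
  rw [plu_map] at h'
  have on' : ∀ i, phi (fun c => σ (U c)) (fun c => σ (V c)) (f i) = 0 := by
    intro i; rw [phi_map, on]; simp
  have fr' := fr.map σ
  obtain ⟨ξ0, hξ0, hR0⟩ := divide H fr' on' h' ρ
  obtain ⟨l, hl⟩ := theta_of_adm H hξ0 hR0 hξ hR (j0 := j0) (by simp [fr.U0, fr.V0])
  simp only [thetaDiv_map, phi_eval_map] at hl
  obtain ⟨b, a, hb, hba⟩ := descend_span (σ : K →+* L) ρ hρ
    (fun i j => phi U V (pderiv j (f i))) _ l hl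
  refine not_infinite (q := q) H fr on hη {x | b.eval x ≠ 0} ?_ ?_
  · have hfin : {x | b.eval x = 0}.Finite := by
      classical
      refine (b.roots.toFinset.finite_toSet).subset ?_
      intro x hx
      simp only [Finset.mem_coe, Multiset.mem_toFinset]
      exact (Polynomial.mem_roots hb).2 hx
    have := hfin.infinite_compl
    exact this
  · intro x hx
    obtain ⟨ξ1, hξ1, hR1⟩ := divide H fr on h x
    refine correct H hξ1 (plu_u U V x) (on_eval on x) hR1
      (fun i => (b.eval x)⁻¹ * (a i).eval x) ?_
    intro j
    have h1 := congrArg (Polynomial.eval x) (hba j)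
    simp only [Polynomial.eval_mul, Polynomial.eval_finset_sum] at h1
    rw [thetaDiv_eq]
    have hx' : b.eval x ≠ 0 := hx
    rw [← mul_right_inj' hx', h1, Finset.mul_sum]
    refine Finset.sum_congr rfl fun i _ => ?_
    rw [← phi_eval]
    field_simp

/-- Descent -/
theorem adm_descend (σ : K →ₐ[ℂ] L) {P : Fin (n + 1) → Fin (n + 1) → K} {Q : ℕ}
    {η : Fin s → PR n →ₗ[ℂ] L} (hη : η ≠ 0) (h : Adm d f (fun a b => σ (P a b)) Q η) :
    ∃ η' : Fin s → PR n →ₗ[ℂ] K, η' ≠ 0 ∧ Adm d f P Q η' := by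
  letI : Algebra K L := (σ : K →+* L).toAlgebra
  haveI : IsScalarTower ℂ K L := IsScalarTower.of_algebraMap_eq (fun x => (σ.commutes x).symm)
  obtain ⟨i, hi⟩ : ∃ i, η i ≠ 0 := by
    by_contra hcon; push Not at hcon; exact hη (funext hcon)
  obtain ⟨g, hg⟩ : ∃ g, η i g ≠ 0 := by
    by_contra hcon; push Not at hcon; exact hi (LinearMap.ext hcon)
  obtain ⟨π, hπ⟩ := LinearMap.exists_leftInverse_of_injective (Algebra.linearMap K L)
    (LinearMap.ker_eq_bot.2 (algebraMap K L).injective)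
  have hπ1 : π 1 = 1 := by
    have := LinearMap.congr_fun hπ 1
    simpa using this
  let π' : L →ₗ[K] K := π ∘ₗ (LinearMap.mulLeft K (η i g)⁻¹)
  have hπ' : ∀ x y, π' (σ x * y) = x * π' y := by
    intro x y
    have : σ x * y = x • y := (Algebra.smul_def x y).symm
    rw [this, map_smul, smul_eq_mul]
  refine ⟨fun i => (π'.restrictScalars ℂ) ∘ₗ η i, ?_, ?_, ?_, ?_, ?_⟩
  · intro h0
    have := LinearMap.congr_fun (congrFun h0 i) g
    simp [π', hg, hπ1] at this
  · intro i e g hg he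
    simp [h.deg i e g hg he]
  · intro i a b c g
    have := congrArg π' (h.supp i a b c g)
    simp only [map_add, map_sub, hπ', map_zero] at this
    exact this
  · intro i k g
    simp [h.van]
  · intro j g hg
    have := congrArg π' (h.kill j g hg)
    simpa using this

end FanoAux

namespace FanoAux
set_option linter.unusedSectionVars false
open MvPolynomial

/-- extension of derivations along formally etale maps -/
theorem exists_derivation {F K : Type} [Field F] [Field K] [Algebra F K] [CharZero F] {ι : Type}
    (x : ι → K) (hx : IsTranscendenceBasis F x) (y : ι → K) :
    ∃ D : Derivation F K K, ∀ a, D (x a) = y a := by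
  letI alg : Algebra (MvPolynomial ι F) K := (aeval x).toAlgebra
  have hmap : ∀ p : MvPolynomial ι F, algebraMap (MvPolynomial ι F) K p = aeval x p := fun p => rfl
  haveI tow : IsScalarTower F (MvPolynomial ι F) K := by
    refine IsScalarTower.of_algebraMap_eq fun r => ?_
    rw [hmap, MvPolynomial.algebraMap_eq, aeval_C]
  haveI inj : FaithfulSMul (MvPolynomial ι F) K :=
    (faithfulSMul_iff_algebraMap_injective _ _).2 hx.1
  letI := FractionRing.liftAlgebra (MvPolynomial ι F) K
  haveI := FractionRing.isScalarTower_liftAlgebra (MvPolynomial ι F) K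
  haveI a1 : Algebra.IsAlgebraic (MvPolynomial ι F) K := by
    have h1 := hx.isAlgebraic
    refine Algebra.IsAlgebraic.ringHom_of_comp_eq (R := Algebra.adjoin F (Set.range x)) (A := K)
      (hx.1.aevalEquiv.symm : Algebra.adjoin F (Set.range x) →+* MvPolynomial ι F) (RingHom.id K)
      hx.1.aevalEquiv.symm.injective Function.surjective_id ?_
    ext a
    simp only [RingHom.comp_apply, hmap, RingHom.id_apply]
    obtain ⟨b, rfl⟩ := hx.1.aevalEquiv.surjective a
    simp
    rfl
  haveI a2 : Algebra.IsAlgebraic (FractionRing (MvPolynomial ι F)) K :=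
    (IsFractionRing.comap_isAlgebraic_iff (A := MvPolynomial ι F)).1 a1
  haveI : CharZero (FractionRing (MvPolynomial ι F)) :=
    charZero_of_injective_algebraMap (IsFractionRing.injective (MvPolynomial ι F) _)
  haveI : Algebra.FormallyEtale (FractionRing (MvPolynomial ι F)) K :=
    Algebra.FormallyEtale.of_isSeparable _ _
  haveI : Algebra.FormallyEtale (MvPolynomial ι F) (FractionRing (MvPolynomial ι F)) :=
    Algebra.FormallyEtale.of_isLocalization (nonZeroDivisors _)
  haveI : Algebra.FormallyEtale (MvPolynomial ι F) K :=
    Algebra.FormallyEtale.comp _ (FractionRing (MvPolynomial ι F)) _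
  let D0 : Derivation F (MvPolynomial ι F) K := mkDerivation F y
  let l := (KaehlerDifferential.isBaseChange_of_formallyEtale F (MvPolynomial ι F) K).lift
    D0.liftKaehlerDifferential
  refine ⟨l.compDer (KaehlerDifferential.D F K), fun a => ?_⟩
  have h2 : x a = algebraMap (MvPolynomial ι F) K (X a) := by rw [hmap, aeval_X]
  have h3 := (KaehlerDifferential.isBaseChange_of_formallyEtale F (MvPolynomial ι F) K).lift_eq
    D0.liftKaehlerDifferential (KaehlerDifferential.D F _ (X a))
  rw [KaehlerDifferential.map_D, ← h2] at h3
  change l (KaehlerDifferential.D F K (x a)) = _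
  refine h3.trans ?_
  rw [Derivation.liftKaehlerDifferential_comp_D]
  exact mkDerivation_X F y a

/-- A derivation killing a subfield kills its algebraic elements -/
theorem derivation_unique {F A N : Type} [Field F] [Field A] [Algebra F A] [CharZero F]
    [AddCommGroup N] [Module A N] [Module F N] [IsScalarTower F A N]
    (D : Derivation F A N) (S : Set A) (hS : ∀ a ∈ S, D a = 0) (a : A)
    (ha : IsAlgebraic (IntermediateField.adjoin F S) a) : D a = 0 := by
  have hE : ∀ b ∈ IntermediateField.adjoin F S, D b = 0 := by
    intro b hb
    induction hb using IntermediateField.adjoin_induction with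
    | mem x hx => exact hS x hx
    | algebraMap x => exact D.map_algebraMap x
    | add x y _ _ hx hy => rw [map_add, hx, hy, add_zero]
    | inv x _ hx => rw [D.leibniz_inv, hx, smul_zero]
    | mul x y _ _ hx hy => rw [D.leibniz, hx, hy, smul_zero, smul_zero, add_zero]
  let E := IntermediateField.adjoin F S
  let D' : Derivation E A N := Derivation.mk'
    { toFun := D
      map_add' := map_add D
      map_smul' := by
        intro e b
        simp only [Algebra.smul_def, D.leibniz, RingHom.id_apply]
        rw [show D (algebraMap E A e) = 0 from hE _ e.2, smul_zero, add_zero]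
        exact (algebraMap_smul A e (D b)) } (by intro a b; exact D.leibniz a b)
  haveI : CharZero E := charZero_of_injective_algebraMap (algebraMap F E).injective
  have haint : IsIntegral E a := ha.isIntegral
  have h1 : D' (Polynomial.aeval a (minpoly E a)) = 0 := by rw [minpoly.aeval, map_zero]
  rw [Derivation.map_aeval] at h1
  have hsep : (minpoly E a).Separable := (minpoly.irreducible haint).separable
  have h2 := hsep.aeval_derivative_ne_zero (minpoly.aeval E a)
  exact (smul_eq_zero.1 h1).resolve_left h2

theorem derivation_aeval {A N : Type} [CommRing A] [Algebra ℂ A] {σ : Type} [Fintype σ]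
    [AddCommGroup N] [Module A N] [Module ℂ N] [IsScalarTower ℂ A N]
    (D : Derivation ℂ A N) (x : σ → A) (p : MvPolynomial σ ℂ) :
    D (aeval x p) = ∑ j, aeval x (pderiv j p) • D (x j) := by
  classical
  induction p using MvPolynomial.induction_on with
  | C a => simp
  | add p q hp hq => simp [hp, hq, add_smul, Finset.sum_add_distrib]
  | mul_X p i hp =>
    rw [map_mul, aeval_X, D.leibniz, hp]
    simp only [Derivation.leibniz, map_add, smul_eq_mul, map_mul, aeval_X, add_smul,
      Finset.sum_add_distrib, mul_smul, Finset.smul_sum]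
    congr 1
    rw [Finset.sum_eq_single i]
    · simp
    · intro b _ hb
      rw [pderiv_X_of_ne hb.symm]
      simp
    · simp

end FanoAux

namespace FanoAux
set_option linter.unusedSectionVars false
open MvPolynomial

variable {n s : ℕ} {d : Fin s → ℕ} {f : Fin s → PR n}
variable {K : Type} [Field K] [Algebra ℂ K]

theorem poly_zero_of_complex (p : Polynomial K) (h : ∀ r : ℂ, p.eval (algebraMap ℂ K r) = 0) :
    p = 0 := by
  refine Polynomial.eq_zero_of_infinite_isRoot p ?_
  refine (Set.infinite_range_of_injective (algebraMap ℂ K).injective).mono ?_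
  rintro _ ⟨r, rfl⟩
  exact h r

theorem phi_der {U V : Fin (n + 1) → K} (on : ∀ i, phi U V (f i) = 0) (D : Derivation ℂ K K) (i) :
    ∑ j, phi U V (pderiv j (f i)) * (Polynomial.C (D (U j)) + Polynomial.C (D (V j)) * Polynomial.X)
      = 0 := by
  refine poly_zero_of_complex _ fun r => ?_
  have h1 : aeval (fun c => U c + algebraMap ℂ K r * V c) (f i) = 0 := by
    rw [← phi_eval, on i, Polynomial.eval_zero]
  have h2 := congrArg D h1
  rw [derivation_aeval, map_zero] at h2
  rw [Polynomial.eval_finsetSum, ← h2]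
  refine Finset.sum_congr rfl fun j _ => ?_
  rw [Polynomial.eval_mul, phi_eval]
  simp only [Polynomial.eval_add, Polynomial.eval_mul, Polynomial.eval_C, Polynomial.eval_X,
    map_add, Derivation.leibniz, Derivation.map_algebraMap, smul_eq_mul, mul_zero, add_zero]
  ring

theorem phi_V {U V : Fin (n + 1) → K} (on : ∀ i, phi U V (f i) = 0) (i) :
    ∑ j, phi U V (pderiv j (f i)) * Polynomial.C (V j) = 0 := by
  have h := derivation_aeval ((Polynomial.derivative' (R := K)).restrictScalars ℂ)
    (fun c => Polynomial.C (U c) + Polynomial.C (V c) * Polynomial.X) (f i)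
  have h2 : aeval (fun c => Polynomial.C (U c) + Polynomial.C (V c) * Polynomial.X) (f i) = 0 := on i
  rw [h2, map_zero] at h
  rw [h]
  refine Finset.sum_congr rfl fun j _ => ?_
  rw [smul_eq_mul]
  congr 1
  change _ = Polynomial.derivative _
  simp

theorem phi_U (H : SmoothData n s d f) {U V : Fin (n + 1) → K} (on : ∀ i, phi U V (f i) = 0) (i) :
    ∑ j, phi U V (pderiv j (f i)) * Polynomial.C (U j) = 0 := by
  have h := congrArg (phi U V) (H.homog i).sum_X_mul_pderiv
  rw [map_nsmul, on i, smul_zero, map_sum] at h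
  have h2 := congrArg (fun t => t * Polynomial.X) (phi_V on i)
  simp only [zero_mul, Finset.sum_mul] at h2
  have h3 := congrArg₂ (fun a b => a - b) h h2
  simp only [← Finset.sum_sub_distrib, sub_zero] at h3
  rw [← h3]
  refine Finset.sum_congr rfl fun j _ => ?_
  rw [map_mul, phi_X]
  ring

theorem Lw_eq_sum (w : ℕ → K) (p : Polynomial K) (N : ℕ) (hp : p.natDegree ≤ N) :
    Lw w p = ∑ a : Fin (N + 1), w a * p.coeff a := by
  rw [Fin.sum_univ_eq_sum_range (fun a => w a * p.coeff a)]
  conv_lhs => rw [p.as_sum_range' (N + 1) (by omega), map_sum]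
  simp only [Lw_monomial]

/-- a functional killing the image gives an admissible family of level one -/
theorem adm_of_W (H : SmoothData n s d f) {U V : Fin (n + 1) → K} {i0 i1 : Fin (n + 1)}
    (fr : Frame U V i0 i1) (on : ∀ i, phi U V (f i) = 0) (W : Fin s → ℕ → K)
    (hW : ∀ j a b, ∑ i, Lw (W i) (phi U V (pderiv j (f i)) *
      (Polynomial.C a + Polynomial.C b * Polynomial.X)) = 0)
    (hne : ∃ i, ∃ a ≤ d i, W i a ≠ 0) :
    ∃ η : Fin s → PR n →ₗ[ℂ] K, η ≠ 0 ∧ Adm d f (plu U V) 1 η := by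
  let η : Fin s → PR n →ₗ[ℂ] K := fun i =>
    ((Lw (W i)).restrictScalars ℂ) ∘ₗ (phi U V).toLinearMap ∘ₗ homogeneousComponent (d i)
  have hη : ∀ i h, η i h = Lw (W i) (phi U V (homogeneousComponent (d i) h)) := fun i h => rfl
  refine ⟨η, ?_, ?_, ?_, ?_, ?_⟩
  · obtain ⟨i, a, ha, hw⟩ := hne
    intro h0
    apply hw
    have h1 : ((X i0 : PR n) ^ (d i - a) * X i1 ^ a).IsHomogeneous (d i) := by
      have := (isHomogeneous_X_pow (R := ℂ) i0 (d i - a)).mul (isHomogeneous_X_pow (R := ℂ) i1 a)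
      rwa [Nat.sub_add_cancel ha] at this
    have h2 := hη i ((X i0 : PR n) ^ (d i - a) * X i1 ^ a)
    rw [homogeneousComponent_of_mem h1, if_pos rfl, map_mul (phi U V), map_pow, map_pow, phi_X, phi_X,
      fr.U0, fr.U1, fr.V0, fr.V1] at h2
    simp only [map_one, map_zero, zero_mul, add_zero, one_pow, one_mul, zero_add, Lw_X_pow] at h2
    rw [← h2, h0]
    rfl
  · intro i e h hh he
    rw [hη, homogeneousComponent_of_mem hh, if_neg (by omega), map_zero, map_zero]
  · intro i a b c h
    have hd := H.two_le i
    have h1 : ∀ c, η i (X c * h) = Lw (W i) ((Polynomial.C (U c) + Polynomial.C (V c) *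
        Polynomial.X) * phi U V (homogeneousComponent (d i - 1) h)) := by
      intro c
      rw [hη]
      have := hshift (d i - 1) c h
      rw [show d i - 1 + 1 = d i by omega] at this
      rw [this, map_mul, phi_X]
    simp only [h1, ← Lw_C_mul]
    rw [← map_sub, ← map_add]
    convert map_zero (Lw (W i)) using 2
    simp only [plu, map_sub, map_mul]
    ring
  · intro i k h
    obtain ⟨h', hh'⟩ := hc_mul_exists (H.homog k) (d i) h
    rw [hη, hh', map_mul, on, zero_mul, map_zero]
  · intro j h hh
    simp only [Pi.zero_apply, mul_zero]
    obtain ⟨a, b, hab⟩ := Polynomial.exists_eq_X_add_C_of_natDegree_le_one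
      (phi_natDegree U V 1 h hh)
    rw [← hW j b a]
    refine Finset.sum_congr rfl fun i _ => ?_
    have hd := H.two_le i
    have h3 : (h * pderiv j (f i)).IsHomogeneous (d i) := by
      have := hh.mul ((H.homog i).pderiv (i := j))
      rwa [show 1 + (d i - 1) = d i by omega] at this
    rw [hη, homogeneousComponent_of_mem h3, if_pos rfl, map_mul, hab]
    congr 1
    ring

/-- the tangent polynomial -/
def tpol (U V : Fin (n + 1) → K) (g : PR n) :
    ((Fin (n + 1) → K) × (Fin (n + 1) → K)) →ₗ[K] Polynomial K where
  toFun w := ∑ j, phi U V (pderiv j g) *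
      (Polynomial.C (w.1 j) + Polynomial.C (w.2 j) * Polynomial.X)
  map_add' w w' := by
    rw [← Finset.sum_add_distrib]
    refine Finset.sum_congr rfl fun j _ => ?_
    simp only [Prod.fst_add, Prod.snd_add, Pi.add_apply, map_add]
    ring
  map_smul' c w := by
    rw [RingHom.id_apply, Polynomial.smul_eq_C_mul, Finset.mul_sum]
    refine Finset.sum_congr rfl fun j _ => ?_
    simp only [Prod.smul_fst, Prod.smul_snd, Pi.smul_apply, smul_eq_mul, map_mul]
    ring

/-- the tangent map -/
def tmap (d : Fin s → ℕ) (f : Fin s → PR n) (U V : Fin (n + 1) → K) :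
    ((Fin (n + 1) → K) × (Fin (n + 1) → K)) →ₗ[K] ((Σ i, Fin (d i + 1)) → K) :=
  LinearMap.pi fun k => Polynomial.lcoeff K k.2 ∘ₗ tpol U V (f k.1)

theorem tmap_apply (U V : Fin (n + 1) → K) (w : (Fin (n + 1) → K) × (Fin (n + 1) → K))
    (k : Σ i, Fin (d i + 1)) : tmap d f U V w k = (∑ j, phi U V (pderiv j (f k.1)) *
      (Polynomial.C (w.1 j) + Polynomial.C (w.2 j) * Polynomial.X)).coeff k.2 := rfl

theorem adm_of_tmap (H : SmoothData n s d f) {U V : Fin (n + 1) → K} {i0 i1 : Fin (n + 1)}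
    (fr : Frame U V i0 i1) (on : ∀ i, phi U V (f i) = 0)
    (hT : LinearMap.range (tmap d f U V) ≠ ⊤) :
    ∃ η : Fin s → PR n →ₗ[ℂ] K, η ≠ 0 ∧ Adm d f (plu U V) 1 η := by
  classical
  obtain ⟨ψ, hψ, hk⟩ := Submodule.exists_le_ker_of_lt_top _ (lt_top_iff_ne_top.2 hT)
  have hsum : ∀ y : (Σ i, Fin (d i + 1)) → K, ψ y = ∑ k, y k * ψ (Pi.single k 1) := by
    intro y
    conv_lhs => rw [← LinearMap.sum_single_apply (fun _ : (Σ i, Fin (d i + 1)) => K) y]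
    rw [map_sum]
    refine Finset.sum_congr rfl fun k _ => ?_
    rw [← smul_eq_mul, ← map_smul]
    congr 1
    ext l
    by_cases h : k = l
    · subst h; simp
    · simp [Pi.single_apply, Ne.symm h]
  refine adm_of_W H fr on (fun i a => if h : a < d i + 1 then ψ (Pi.single ⟨i, ⟨a, h⟩⟩ 1) else 0)
    ?_ ?_
  · intro j a b
    have h1 : tmap d f U V (Pi.single j a, Pi.single j b) ∈ LinearMap.ker ψ := hk ⟨_, rfl⟩
    rw [LinearMap.mem_ker, hsum, Fintype.sum_sigma] at h1
    rw [← h1]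
    refine Finset.sum_congr rfl fun i _ => ?_
    have hd := H.two_le i
    have hdeg : (phi U V (pderiv j (f i)) * (Polynomial.C a + Polynomial.C b * Polynomial.X)).natDegree
        ≤ d i := by
      refine Polynomial.natDegree_mul_le.trans ?_
      have h2 := phi_natDegree U V _ _ ((H.homog i).pderiv (i := j))
      have h3 : (Polynomial.C a + Polynomial.C b * Polynomial.X).natDegree ≤ 1 := by
        rw [add_comm]; exact Polynomial.natDegree_linear_le
      omega
    rw [Lw_eq_sum _ _ _ hdeg]
    refine Finset.sum_congr rfl fun k _ => ?_
    rw [dif_pos k.2, mul_comm]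
    congr 1
    rw [tmap_apply, Finset.sum_eq_single j]
    · simp
    · intro j' _ hj
      simp [Pi.single_apply, hj]
    · simp
  · by_contra hcon
    push Not at hcon
    apply hψ
    ext k
    have := hcon k.1 k.2 (by omega)
    simp only [k.2.2, dif_pos] at this
    simpa using this

/-- B6 -/
theorem badness (H : SmoothData n s d f) {U V : Fin (n + 1) → K} {i0 i1 : Fin (n + 1)}
    (fr : Frame U V i0 i1) (on : ∀ i, phi U V (f i) = 0)
    (hgen : IntermediateField.adjoin ℂ (Set.range U ∪ Set.range V) = ⊤)
    {m : ℕ} (x : Fin m → K) (hx : IsTranscendenceBasis ℂ x)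
    (hm : 2 * n ≤ m + ∑ i, d i + s + 1) :
    ∃ η : Fin s → PR n →ₗ[ℂ] K, η ≠ 0 ∧ Adm d f (plu U V) 1 η := by
  classical
  refine adm_of_tmap H fr on fun hT => ?_
  choose D hD using fun a : Fin m => exists_derivation x hx (Pi.single a 1)
  let w : Fin m ⊕ Fin 4 → (Fin (n + 1) → K) × (Fin (n + 1) → K) :=
    Sum.elim (fun a => (fun c => D a (U c), fun c => D a (V c))) ![(U, 0), (V, 0), (0, U), (0, V)]
  have hker : ∀ k, w k ∈ LinearMap.ker (tmap d f U V) := by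
    have h0 : ∀ v : (Fin (n + 1) → K) × (Fin (n + 1) → K), (∀ i, ∑ j, phi U V (pderiv j (f i)) *
      (Polynomial.C (v.1 j) + Polynomial.C (v.2 j) * Polynomial.X) = 0) →
      v ∈ LinearMap.ker (tmap d f U V) := by
      intro v hv
      rw [LinearMap.mem_ker]
      ext k
      rw [tmap_apply, hv]
      simp
    rintro (a | a)
    · exact h0 _ fun i => phi_der on (D a) i
    · refine h0 _ fun i => ?_
      have hU := phi_U H on i
      have hV := phi_V on i
      have hU' := congrArg (fun t => t * Polynomial.X) hU
      have hV' := congrArg (fun t => t * Polynomial.X) hV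
      simp only [Finset.sum_mul, zero_mul, mul_assoc] at hU' hV'
      fin_cases a
      · simpa [w] using hU
      · simpa [w] using hV
      · simpa [w] using hU'
      · simpa [w] using hV'
  have hli : LinearIndependent K w := by
    rw [Fintype.linearIndependent_iff]
    intro g hg
    rw [Fintype.sum_sum_type] at hg
    simp only [w, Sum.elim_inl, Sum.elim_inr, Fin.sum_univ_four] at hg
    have hU : ∀ c, ∑ a, g (Sum.inl a) * D a (U c) + (g (Sum.inr 0) * U c + g (Sum.inr 1) * V c) = 0 := by
      intro c
      have := congrFun (congrArg Prod.fst hg) c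
      simpa [Prod.fst_sum, Finset.sum_apply] using this
    have hV : ∀ c, ∑ a, g (Sum.inl a) * D a (V c) + (g (Sum.inr 2) * U c + g (Sum.inr 3) * V c) = 0 := by
      intro c
      have := congrFun (congrArg Prod.snd hg) c
      simpa [Prod.snd_sum, Finset.sum_apply] using this
    have e0 := hU i0
    have e1 := hU i1
    have e2 := hV i0
    have e3 := hV i1
    simp only [fr.U0, fr.U1, fr.V0, fr.V1, map_zero, Derivation.map_one_eq_zero, mul_zero, mul_one,
      Finset.sum_const_zero, zero_add, add_zero] at e0 e1 e2 e3
    simp only [e0, e1, e2, e3, zero_mul, add_zero] at hU hV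
    let D' : Derivation ℂ K K := ∑ a, g (Sum.inl a) • D a
    have hD' : ∀ y, D' y = ∑ a, g (Sum.inl a) * D a y := by
      intro y
      change (Derivation.coeFnAddMonoidHom D') y = _
      simp only [D', map_sum, Finset.sum_apply]
      rfl
    have hz : ∀ y, D' y = 0 := by
      intro y
      refine derivation_unique D' (Set.range U ∪ Set.range V) ?_ y ?_
      · rintro _ (⟨c, rfl⟩ | ⟨c, rfl⟩)
        · rw [hD', hU]
        · rw [hD', hV]
      · rw [hgen]
        exact isAlgebraic_algebraMap (⟨y, trivial⟩ : (⊤ : IntermediateField ℂ K))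
    rintro (a | a)
    · have := hz (x a)
      rw [hD'] at this
      simpa [hD, Pi.single_apply] using this
    · fin_cases a
      · exact e0
      · exact e1
      · exact e2
      · exact e3
  have h1 : m + 4 ≤ Module.finrank K (LinearMap.ker (tmap d f U V)) := by
    have hli' : LinearIndependent K (fun k => (⟨w k, hker k⟩ : LinearMap.ker (tmap d f U V))) := by
      apply LinearIndependent.of_comp (LinearMap.ker (tmap d f U V)).subtype
      exact hli
    have := hli'.fintype_card_le_finrank
    simpa using this
  have h2 := LinearMap.finrank_range_add_finrank_ker (tmap d f U V)
  rw [hT, finrank_top, Module.finrank_prod, Module.finrank_fintype_fun_eq_card,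
    Module.finrank_fintype_fun_eq_card, Fintype.card_sigma] at h2
  simp only [Fintype.card_fin, Finset.sum_add_distrib, Finset.sum_const, Finset.card_univ,
    smul_eq_mul, mul_one] at h2
  omega

end FanoAux

namespace FanoAux
set_option linter.unusedSectionVars false
open MvPolynomial

section trd
variable {F K : Type} [Field F] [Field K] [Algebra F K]

open scoped IntermediateField.algebraAdjoinAdjoin in
theorem isAlg_adjoin (S : Set K) (h : Algebra.IsAlgebraic (IntermediateField.adjoin F S) K) :
    Algebra.IsAlgebraic (Algebra.adjoin F S) K :=
  (IsFractionRing.comap_isAlgebraic_iff (A := Algebra.adjoin F S)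
    (K := IntermediateField.adjoin F S)).2 h

theorem indep_card_le {ι κ : Type} [Fintype ι] [Fintype κ] (x : ι → K)
    (hx : AlgebraicIndependent F x) (g : κ → K)
    (h : Algebra.IsAlgebraic (IntermediateField.adjoin F (Set.range g)) K) :
    Fintype.card ι ≤ Fintype.card κ := by
  have h1 := hx.cardinalMk_le_trdeg
  haveI := isAlg_adjoin _ h
  have h2 := Algebra.IsAlgebraic.trdeg_le_cardinalMk F (Set.range g)
  have h3 := (h1.trans h2).trans Cardinal.mk_range_le
  simpa using h3

theorem isAlg_of_gen (T : Set K) (hT : IntermediateField.adjoin F T = ⊤)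
    (E : IntermediateField F K) (h : ∀ t ∈ T, IsAlgebraic E t) : Algebra.IsAlgebraic E K := by
  have h1 : IntermediateField.adjoin F T ≤ (algebraicClosure E K).restrictScalars F := by
    rw [IntermediateField.adjoin_le_iff]
    intro t ht
    exact mem_algebraicClosure_iff.2 (h t ht)
  rw [hT] at h1
  exact ⟨fun a => mem_algebraicClosure_iff.1 (h1 (trivial : a ∈ (⊤ : IntermediateField F K)))⟩

/-- maximal element for a valuation -/
theorem exists_max_val {ι : Type} [Fintype ι] (O : ValuationSubring K) (y : ι → K)
    (hy : y ≠ 0) : ∃ i, y i ≠ 0 ∧ ∀ j, y j / y i ∈ O := by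
  obtain ⟨i1, hi1⟩ := Function.ne_iff.1 hy
  haveI : Nonempty ι := ⟨i1⟩
  obtain ⟨i, hi⟩ := Finite.exists_max (fun i => O.valuation (y i))
  have hne : y i ≠ 0 := by
    intro h0
    have := hi i1
    rw [h0, map_zero, le_zero_iff, map_eq_zero] at this
    exact hi1 this
  refine ⟨i, hne, fun j => ?_⟩
  rw [← O.valuation_le_one_iff, map_div₀]
  exact div_le_one_of_le₀ (hi j) zero_le

theorem isIntegral_of_val (S : Set K) (y : K) (h : ∀ O : ValuationSubring K, S ⊆ O → y ∈ O) :
    IsIntegral (Subring.closure S) y := by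
  have h1 : y ∈ (integralClosure (Subring.closure S) K).toSubring := by
    rw [← iInf_valuationSubring_superset, Subring.mem_iInf]
    rintro ⟨V, hV⟩
    exact h V hV
  exact h1

theorem isAlgebraic_of_val (E : IntermediateField F K) (y : K)
    (h : ∀ O : ValuationSubring K, (E : Set K) ⊆ O → y ∈ O) : IsAlgebraic E y := by
  obtain ⟨p, hp, hy⟩ := isIntegral_of_val _ y h
  have hc : Subring.closure (E : Set K) ≤ E.toSubring := Subring.closure_le.2 (le_refl _)
  let i : Subring.closure (E : Set K) →+* E := Subring.inclusion hc
  refine IsIntegral.isAlgebraic (R := E) ⟨p.map i, hp.map i, ?_⟩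
  rw [Polynomial.eval₂_map]
  exact hy

end trd

/-- Solving: evaluation of forms after scaling. -/
theorem eval_scale {k E : Type} [Field k] [Field E] [Algebra k E] {τ : Type} {e : ℕ}
    {g : MvPolynomial τ k} (hg : g.IsHomogeneous e) (c : E) (x : τ → E) :
    aeval (fun b => c * x b) g = c ^ e * aeval x g := by
  rw [aeval_def, aeval_def, eval₂_eq, eval₂_eq, Finset.mul_sum]
  refine Finset.sum_congr rfl fun m hm => ?_
  have h1 : m.degree = e := by
    have := hg (mem_support_iff.1 hm)
    rw [← this, Finsupp.degree_eq_weight_one]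
    rfl
  simp only [mul_pow, Finset.prod_mul_distrib, Finset.prod_pow_eq_pow_sum]
  rw [← h1, Finsupp.degree_apply]
  ring

theorem exists_purelyTrans (k : Type) [Field k] (ι : Type) :
    ∃ (E : Type) (_ : Field E) (_ : Algebra k E) (z : ι → E), AlgebraicIndependent k z ∧
      IntermediateField.adjoin k (Set.range z) = ⊤ := by
  let R := MvPolynomial ι k
  let E := FractionRing R
  let z : ι → E := fun t => algebraMap R E (X t)
  refine ⟨E, inferInstance, inferInstance, z, ?_, ?_⟩
  · have h1 : AlgebraicIndependent k (X : ι → R) := MvPolynomial.algebraicIndependent_X _ _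
    exact h1.map' (f := IsScalarTower.toAlgHom k R E) (IsFractionRing.injective R E)
  · rw [eq_top_iff]
    intro y _
    obtain ⟨p, q, hq, rfl⟩ := IsFractionRing.div_surjective (A := R) y
    have : ∀ p : R, algebraMap R E p ∈ IntermediateField.adjoin k (Set.range z) := by
      intro p
      have h2 : algebraMap R E p = aeval z p := by
        have : (IsScalarTower.toAlgHom k R E) = aeval z := by
          ext t
          simp only [aeval_X, z]
          rfl
        exact congrArg (fun g => g p) this
      rw [h2]
      have h3 : aeval z p ∈ Algebra.adjoin k (Set.range z) := by
        rw [Algebra.adjoin_range_eq_range_aeval]; exact ⟨p, rfl⟩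
      exact IntermediateField.algebra_adjoin_le_adjoin k _ h3
    exact div_mem (this p) (this q)

theorem lemmaD {k : Type} [Field k] {s : ℕ} {τ γ : Type} [Fintype τ] [Fintype γ] (t0 : τ) (e : Fin s → ℕ) (he : ∀ i, 1 ≤ e i) (hs : 0 < s)
    (G : Fin s → γ → MvPolynomial τ k) (hG : ∀ i c, (G i c).IsHomogeneous (e i))
    (ha : Fintype.card γ + 2 ≤ s + Fintype.card τ) :
    ∃ (κ : Type) (_ : Field κ) (σ : k →+* κ) (x : τ → κ) (l : Fin s → κ),
      x ≠ 0 ∧ l ≠ 0 ∧ ∀ c, ∑ i, l i * eval₂ σ x (G i c) = 0 := by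
  classical
  by_contra hcon
  push Not at hcon
  obtain ⟨E, _, _, z, hzi, hgen⟩ := exists_purelyTrans k (Fin s ⊕ τ)
  let lam : Fin s → E := fun i => z (Sum.inl i)
  let Y : τ → E := fun i => z (Sum.inr i)
  have hz0 : ∀ t, z t ≠ 0 := fun t => hzi.ne_zero t
  let Hc : γ → E := fun c => ∑ i, lam i * aeval Y (G i c)
  let g : Option (γ) → E := fun t => t.elim (Y t0) Hc
  let B := IntermediateField.adjoin k (Set.range g)
  have hval : ∀ i b, IsAlgebraic B (lam i * Y b ^ e i) := by
    intro i b
    refine isAlgebraic_of_val B _ fun O hO => ?_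
    obtain ⟨b0, hb0, hb⟩ := exists_max_val O Y (fun h => hz0 (Sum.inr t0) (congrFun h t0))
    let x : τ → E := fun b => Y b / Y b0
    let l1 : Fin s → E := fun i => lam i * Y b0 ^ e i
    have hl1 : ∀ i, l1 i ≠ 0 := fun i => mul_ne_zero (hz0 _) (pow_ne_zero _ hb0)
    have hH : ∀ c, Hc c = ∑ i, l1 i * aeval x (G i c) := by
      intro c
      refine Finset.sum_congr rfl fun i _ => ?_
      have hYx : Y = fun b => Y b0 * x b := by
        ext b
        simp only [x]
        field_simp
      conv_lhs => rw [hYx]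
      rw [eval_scale (hG i c)]
      simp only [l1]
      ring
    obtain ⟨i0, hi0, hi⟩ := exists_max_val O l1 (fun h => hl1 i (congrFun h i))
    have key : lam i * Y b ^ e i = (l1 i / l1 i0) * (x b) ^ e i * l1 i0 := by
      have h5 : l1 i / l1 i0 * x b ^ e i * l1 i0 = l1 i * x b ^ e i := by field_simp
      rw [h5]
      simp only [l1, x, div_pow]
      field_simp
    have hk : ∀ t : k, algebraMap k E t ∈ O := fun t => hO (B.algebraMap_mem t)
    by_cases hv : l1 i0 ∈ O
    · rw [key]
      exact mul_mem (mul_mem (hi i) (pow_mem (hb b) _)) hv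
    · exfalso
      have hinv : (l1 i0)⁻¹ ∈ O := (O.mem_or_inv_mem _).resolve_left hv
      have hnu : (⟨_, hinv⟩ : O) ∈ IsLocalRing.maximalIdeal O := by
        rw [IsLocalRing.mem_maximalIdeal, mem_nonunits_iff]
        intro hu
        obtain ⟨w, hw⟩ := hu.exists_right_inv
        have hw' := congrArg (fun t : O => (t : E)) hw
        simp only [MulMemClass.coe_mul, OneMemClass.coe_one] at hw'
        have : l1 i0 = w := by
          rw [inv_mul_eq_one₀ hi0] at hw'
          exact hw'
        exact hv (this ▸ w.2)
      let j : k →+* O := RingHom.codRestrict (algebraMap k E) O.toSubring hk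
      let σ : k →+* IsLocalRing.ResidueField O := (IsLocalRing.residue O).comp j
      let xO : τ → O := fun b => ⟨x b, hb b⟩
      let lO : Fin s → O := fun i => ⟨l1 i / l1 i0, hi i⟩
      obtain ⟨c, hc⟩ := hcon (IsLocalRing.ResidueField O) inferInstance σ
        (fun b => IsLocalRing.residue O (xO b)) (fun i => IsLocalRing.residue O (lO i))
        (by
          intro h0
          have := congrFun h0 b0
          have h1 : xO b0 = 1 := Subtype.ext (div_self hb0)
          simp [h1] at this)
        (by
          intro h0
          have := congrFun h0 i0
          have h1 : lO i0 = 1 := Subtype.ext (div_self (hl1 i0))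
          simp [h1] at this)
      apply hc
      have h2 : ∀ i, eval₂ σ (fun b => IsLocalRing.residue O (xO b)) (G i c) =
          IsLocalRing.residue O (eval₂ j xO (G i c)) := fun i =>
        (MvPolynomial.eval₂_comp_left (IsLocalRing.residue O) j xO (G i c)).symm
      simp only [h2, ← map_mul, ← map_sum]
      rw [IsLocalRing.residue_eq_zero_iff]
      have h3 : ∑ i, lO i * eval₂ j xO (G i c) = ⟨Hc c, hO (IntermediateField.subset_adjoin k _ ⟨some c, rfl⟩)⟩ * ⟨_, hinv⟩ := by
        apply Subtype.ext
        have h4 : ∀ i, ((eval₂ j xO (G i c) : O) : E) = aeval x (G i c) := fun i =>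
          MvPolynomial.eval₂_comp_left (O.subtype) j xO (G i c)
        rw [MulMemClass.coe_mul]
        change O.subtype (∑ i, lO i * eval₂ j xO (G i c)) = _
        simp only [map_sum, map_mul, hH, Finset.sum_mul]
        refine Finset.sum_congr rfl fun i _ => ?_
        change (l1 i / l1 i0) * ((eval₂ j xO (G i c) : O) : E) = _
        rw [h4]
        ring
      rw [h3]
      exact Ideal.mul_mem_left _ _ hnu
  have hY0 : Y t0 ∈ B := IntermediateField.subset_adjoin k _ ⟨none, rfl⟩
  have hlam : ∀ i, lam i ∈ algebraicClosure B E := by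
    intro i
    have h1 : lam i * Y t0 ^ e i ∈ algebraicClosure B E := mem_algebraicClosure_iff.2 (hval i t0)
    have h2 : Y t0 ∈ algebraicClosure B E := (algebraicClosure B E).algebraMap_mem ⟨_, hY0⟩
    have h3 : lam i = (lam i * Y t0 ^ e i) / Y t0 ^ e i := by
      rw [mul_div_assoc, div_self (pow_ne_zero _ (hz0 _)), mul_one]
    rw [h3]
    exact div_mem h1 (pow_mem h2 _)
  have hYb : ∀ b, Y b ∈ algebraicClosure B E := by
    intro b
    let i : Fin s := ⟨0, hs⟩
    have h1 : lam i * Y b ^ e i ∈ algebraicClosure B E := mem_algebraicClosure_iff.2 (hval i b)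
    have h3 : Y b ^ e i = (lam i * Y b ^ e i) / lam i := by
      rw [mul_comm, mul_div_assoc, div_self (hz0 _), mul_one]
    have h4 : Y b ^ e i ∈ algebraicClosure B E := by
      rw [h3]; exact div_mem h1 (hlam i)
    rw [mem_algebraicClosure_iff] at h4 ⊢
    exact IsAlgebraic.of_pow (he i) h4
  haveI : Algebra.IsAlgebraic B E := by
    refine isAlg_of_gen (Set.range z) hgen B ?_
    rintro _ ⟨t | t, rfl⟩
    · exact mem_algebraicClosure_iff.1 (hlam t)
    · exact mem_algebraicClosure_iff.1 (hYb t)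
  have := indep_card_le z hzi g this
  simp at this
  omega

end FanoAux

namespace FanoAux
set_option linter.unusedSectionVars false
open MvPolynomial

/-- A transcendence basis chosen inside a generating family, containing a given member. -/
theorem exists_TB {F K : Type} [Field F] [Field K] [Algebra F K] {N : ℕ} (u : Fin N → K)
    (h : Algebra.IsAlgebraic (IntermediateField.adjoin F (Set.range u)) K) (i1 : Fin N)
    (hi : Transcendental F (u i1)) :
    ∃ (r : ℕ) (jj : Fin r → Fin N) (t0 : Fin r), jj t0 = i1 ∧
      IsTranscendenceBasis F (fun t => u (jj t)) := by
  classical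
  have h1 : AlgebraicIndepOn F id ({u i1} : Set K) := by
    have : AlgebraicIndependent F (fun x : ({u i1} : Set K) => (x : K)) := by
      rw [algebraicIndependent_unique_type_iff]
      exact hi
    exact this
  haveI := isAlg_adjoin _ h
  obtain ⟨t, ht1, ht2, ht⟩ := exists_isTranscendenceBasis_between (R := F)
    ({u i1} : Set K) (Set.range u) (by rintro _ rfl; exact ⟨i1, rfl⟩) h1
  have hfin : t.Finite := (Set.finite_range u).subset ht2
  haveI := hfin.fintype
  have hsec : ∀ x : t, ∃ c, u c = x ∧ (x.1 = u i1 → c = i1) := by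
    rintro ⟨x, hx⟩
    by_cases hx1 : x = u i1
    · exact ⟨i1, hx1.symm, fun _ => rfl⟩
    · obtain ⟨c, hc⟩ := ht2 hx
      exact ⟨c, hc, fun h => absurd h hx1⟩
  choose g hg hg1 using hsec
  let e := Fintype.equivFin t
  refine ⟨Fintype.card t, fun a => g (e.symm a), e ⟨u i1, ht1 rfl⟩, ?_, ?_⟩
  · simp only [Equiv.symm_apply_apply]
    exact hg1 _ rfl
  · have : (fun a => u (g (e.symm a))) = (fun x : t => (x : K)) ∘ e.symm := by
      funext a; exact hg _
    rw [this]
    exact (isTranscendenceBasis_equiv e.symm).2 ht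

variable {n s : ℕ} {d : Fin s → ℕ} {f : Fin s → PR n}

theorem alpha_pair {K : Type} [Field K] [Algebra ℂ K]
    (H : SmoothData n s d f) {U V : Fin (n+1) → K} {j0 j1 : Fin (n+1)}
    (fr : Frame U V j0 j1) {q : ℕ} {η : Fin s → PR n →ₗ[ℂ] K}
    (h : Adm d f (plu U V) q η) (ρ : K) (y z : Fin (n+1) → K)
    (hyz : ∀ i, ∑ j, phi U V (pderiv j (f i)) * Polynomial.C (y j) =
      (Polynomial.X - Polynomial.C ρ) * ∑ j, phi U V (pderiv j (f i)) * Polynomial.C (z j)) :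
    ∑ j, thetaDiv d f U V j0 j1 q η ρ j * y j = 0 := by
  have e1 : ∀ w : ℕ → K, ∀ (p : Polynomial K) (c : K), Lw w p * c = Lw w (p * Polynomial.C c) := by
    intro w p c
    rw [mul_comm p, Lw_C_mul, mul_comm]
  calc ∑ j, thetaDiv d f U V j0 j1 q η ρ j * y j
      = ∑ i, Lw (wrec ρ (wv j0 j1 (η i) (d i + q - 1)))
          (∑ j, phi U V (pderiv j (f i)) * Polynomial.C (y j)) := by
        simp only [thetaDiv, Finset.sum_mul, map_sum, e1]
        rw [Finset.sum_comm]
    _ = ∑ i, Lw (wv j0 j1 (η i) (d i + q - 1))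
          (∑ j, phi U V (pderiv j (f i)) * Polynomial.C (z j)) := by
        refine Finset.sum_congr rfl fun i _ => ?_
        rw [hyz, Lw_wrec_mul]
    _ = ∑ j, ∑ i, Lw (wv j0 j1 (η i) (d i + q - 1))
          (Polynomial.C (z j) * phi U V (pderiv j (f i))) := by
        simp only [map_sum]
        rw [Finset.sum_comm]
        simp only [mul_comm]
    _ = 0 := by
        refine Finset.sum_eq_zero fun j _ => ?_
        exact adm_W_kill H fr h j _ (by simp)

theorem alpha_der {K : Type} [Field K] [Algebra ℂ K]
    (H : SmoothData n s d f) {U V : Fin (n+1) → K} {j0 j1 : Fin (n+1)}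
    (fr : Frame U V j0 j1) (on : ∀ i, phi U V (f i) = 0) {q : ℕ} {η : Fin s → PR n →ₗ[ℂ] K}
    (h : Adm d f (plu U V) q η) (ρ : K) (D : Derivation ℂ K K) :
    ∑ j, thetaDiv d f U V j0 j1 q η ρ j * D (U j + ρ * V j) = 0 := by
  refine alpha_pair H fr h ρ _ (fun j => - D (V j)) fun i => ?_
  have h1 := phi_der on D i
  have h2 := phi_V on i
  have h3 : ∑ j, phi U V (pderiv j (f i)) * Polynomial.C (D (U j + ρ * V j)) =
    ∑ j, phi U V (pderiv j (f i)) * (Polynomial.C (D (U j)) + Polynomial.C (D (V j)) * Polynomial.X)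
    + (Polynomial.X - Polynomial.C ρ) * ∑ j, phi U V (pderiv j (f i)) * Polynomial.C (- D (V j))
    + Polynomial.C (D ρ) * ∑ j, phi U V (pderiv j (f i)) * Polynomial.C (V j) := by
    rw [Finset.mul_sum, Finset.mul_sum, ← Finset.sum_add_distrib, ← Finset.sum_add_distrib]
    refine Finset.sum_congr rfl fun j _ => ?_
    simp only [map_add, Derivation.leibniz, smul_eq_mul, map_mul, map_neg]
    ring
  rw [h3, h1, h2]
  ring

theorem alpha_u {K : Type} [Field K] [Algebra ℂ K]
    (H : SmoothData n s d f) {U V : Fin (n+1) → K} {j0 j1 : Fin (n+1)}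
    (fr : Frame U V j0 j1) (on : ∀ i, phi U V (f i) = 0) {q : ℕ} {η : Fin s → PR n →ₗ[ℂ] K}
    (h : Adm d f (plu U V) q η) (ρ : K) :
    ∑ j, thetaDiv d f U V j0 j1 q η ρ j * (U j + ρ * V j) = 0 := by
  refine alpha_pair H fr h ρ _ 0 fun i => ?_
  have h1 := phi_U H on i
  have h2 := phi_V on i
  have h3 : ∑ j, phi U V (pderiv j (f i)) * Polynomial.C (U j + ρ * V j) =
    ∑ j, phi U V (pderiv j (f i)) * Polynomial.C (U j)
    + Polynomial.C ρ * ∑ j, phi U V (pderiv j (f i)) * Polynomial.C (V j) := by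
    rw [Finset.mul_sum, ← Finset.sum_add_distrib]
    refine Finset.sum_congr rfl fun j _ => ?_
    simp only [map_add, map_mul]
    ring
  rw [h3, h1, h2]
  simp

/-- Tangent data of a point `u` with coordinates in `K`. -/
structure Tan {K : Type} [Field K] [Algebra ℂ K] (u : Fin (n+1) → K) (i0 i1 : Fin (n+1)) {r : ℕ}
    (jj : Fin r → Fin (n+1)) (t0 : Fin r)
    (u0 : Fin (n+1) → IntermediateField.adjoin ℂ (Set.range u))
    (y : Fin r → Fin (n+1) → IntermediateField.adjoin ℂ (Set.range u)) : Prop where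
  hu0 : ∀ c, (u0 c : K) = u c
  one : u0 i0 = 1
  jt0 : jj t0 = i1
  basis : IsTranscendenceBasis ℂ (fun t => u0 (jj t))
  delta : ∀ t t', y t (jj t') = if t' = t then 1 else 0
  zero : ∀ t, y t i0 = 0
  notmem : ∀ t, jj t ≠ i0
  der : ∀ t, ∃ D : Derivation ℂ K K, ∀ c, D (u c) = y t c
  comb : ∀ D : Derivation ℂ K K, ∀ c, D (u c) = ∑ t, D (u (jj t)) * y t c

theorem exists_tan {K : Type} [Field K] [Algebra ℂ K] (u : Fin (n+1) → K) (i0 i1 : Fin (n+1))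
    (h0 : u i0 = 1) (h1 : Transcendental ℂ (u i1)) :
    ∃ (r : ℕ) (jj : Fin r → Fin (n+1)) (t0 : Fin r) (u0 : _) (y : _), Tan u i0 i1 jj t0 u0 y := by
  classical
  set K0 := IntermediateField.adjoin ℂ (Set.range u) with hK0
  let u0 : Fin (n+1) → K0 := fun c => ⟨u c, IntermediateField.subset_adjoin _ _ ⟨c, rfl⟩⟩
  have hu0 : ∀ c, algebraMap K0 K (u0 c) = u c := fun c => rfl
  have hgen : IntermediateField.adjoin ℂ (Set.range u0) = ⊤ := by
    have : Function.Injective (IntermediateField.map K0.val) := IntermediateField.map_injective _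
    apply this
    rw [IntermediateField.adjoin_map, ← Set.range_comp, ← AlgHom.fieldRange_eq_map,
      IntermediateField.fieldRange_val]
    rfl
  have halg0 : Algebra.IsAlgebraic (IntermediateField.adjoin ℂ (Set.range u0)) K0 :=
    isAlg_of_gen _ hgen _ fun t ht =>
      isAlgebraic_algebraMap (⟨t, IntermediateField.subset_adjoin _ _ ht⟩ :
        IntermediateField.adjoin ℂ (Set.range u0))
  have htr0 : Transcendental ℂ (u0 i1) := by
    intro h
    exact h1 (h.algebraMap (A := K))
  obtain ⟨r, jj, t0, ht0, hb⟩ := exists_TB u0 halg0 i1 htr0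
  have hinj : Function.Injective (fun t => u0 (jj t)) := hb.1.injective
  have hD0 : ∀ t, ∃ D : Derivation ℂ K0 K0, ∀ t', D (u0 (jj t')) = if t' = t then 1 else 0 :=
    fun t => exists_derivation _ hb _
  choose D0 hD0 using hD0
  have hone : u0 i0 = 1 := Subtype.ext h0
  -- uniqueness
  have huniq : ∀ D : Derivation ℂ K0 K, (∀ t, D (u0 (jj t)) = 0) → ∀ a, D a = 0 := by
    intro D hD a
    refine derivation_unique D (Set.range fun t => u0 (jj t)) ?_ a ?_
    · rintro _ ⟨t, rfl⟩; exact hD t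
    · exact hb.isAlgebraic_field.isAlgebraic a
  have hcomb : ∀ D : Derivation ℂ K K, ∀ a : K0, D a = ∑ t, D (u (jj t)) * (D0 t a : K0) := by
    intro D a
    let E : Derivation ℂ K0 K := D.compAlgebraMap K0 -
      ∑ t, (D (u (jj t))) • ((Algebra.linearMap K0 K).compDer (D0 t))
    have hE : ∀ a : K0, E a = D a - ∑ t, D (u (jj t)) * (D0 t a : K0) := by
      intro a
      simp only [E, Derivation.coe_sub, Pi.sub_apply]
      congr 1
      rw [← Derivation.coeFnAddMonoidHom_apply, map_sum, Finset.sum_apply]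
      rfl
    have := huniq E (fun t => by
      rw [hE]
      have : ∀ t', ((D0 t' (u0 (jj t)) : K0) : K) = if t = t' then 1 else 0 := by
        intro t'; rw [hD0]; split_ifs <;> rfl
      simp only [this]
      simp [u0]) a
    rw [hE, sub_eq_zero] at this
    exact this
  refine ⟨r, jj, t0, u0, fun t c => D0 t (u0 c), ⟨fun c => rfl, hone, ht0, hb, ?_, ?_, ?_, ?_, ?_⟩⟩
  · intro t t'
    exact hD0 t t'
  · intro t
    rw [hone]; simp
  · intro t ht
    have := hb.1.transcendental t
    rw [ht, hone] at this
    exact this (isAlgebraic_one)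
  · intro t
    have hb' : AlgebraicIndependent ℂ (fun t => u (jj t)) :=
      hb.1.map' (f := K0.val) (K0.val.injective)
    have hr := hb'.coe_range
    obtain ⟨B, hBs, hB⟩ := exists_isTranscendenceBasis_superset (s := Set.range fun t => u (jj t)) hr
    obtain ⟨D, hD⟩ := exists_derivation (F := ℂ) (fun b : B => (b : K)) hB
      (fun b => if (b : K) = u (jj t) then 1 else 0)
    refine ⟨D, fun c => ?_⟩
    have := hcomb D (u0 c)
    have h2 : ∀ t', D (u (jj t')) = if t' = t then 1 else 0 := by
      intro t'
      have := hD ⟨u (jj t'), hBs ⟨t', rfl⟩⟩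
      simp only at this
      rw [this]
      by_cases h : t' = t
      · simp [h]
      · rw [if_neg, if_neg h]
        intro h3
        exact h (hb'.injective h3)
    change D ((u0 c : K0) : K) = _
    rw [this]
    simp [h2]
  · intro D c
    exact hcomb D (u0 c)

/-- Coordinates outside the pivots. -/
abbrev Rest (i0 : Fin (n+1)) {r : ℕ} (jj : Fin r → Fin (n+1)) : Type :=
  {c : Fin (n+1) // c ≠ i0 ∧ ∀ t, jj t ≠ c}

namespace Tan
variable {K : Type} [Field K] [Algebra ℂ K] {u : Fin (n+1) → K} {i0 i1 : Fin (n+1)} {r : ℕ}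
    {jj : Fin r → Fin (n+1)} {t0 : Fin r}
    {u0 : Fin (n+1) → IntermediateField.adjoin ℂ (Set.range u)}
    {y : Fin r → Fin (n+1) → IntermediateField.adjoin ℂ (Set.range u)}

theorem jj_inj (T : Tan u i0 i1 jj t0 u0 y) : Function.Injective jj := by
  intro a b hab
  have := T.basis.1.injective (a₁ := a) (a₂ := b) (by simp only [hab])
  exact this

open Classical in
theorem card_rest (T : Tan u i0 i1 jj t0 u0 y) : Fintype.card (Rest i0 jj) + r = n := by
  have h1 : Fintype.card (Rest i0 jj) = (Finset.univ \ (insert i0 (Finset.univ.image jj))).card := by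
    rw [Fintype.card_subtype]
    congr 1
    ext c
    simp only [Finset.mem_filter, Finset.mem_univ, true_and, Finset.mem_sdiff, Finset.mem_insert,
      Finset.mem_image, not_or, not_exists]
  rw [h1, Finset.card_sdiff_of_subset (Finset.subset_univ _), Finset.card_insert_of_notMem,
    Finset.card_image_of_injective _ T.jj_inj, Finset.card_univ, Finset.card_univ, Fintype.card_fin,
    Fintype.card_fin]
  · have : r + 1 ≤ n + 1 := by
      have := Finset.card_le_univ (insert i0 (Finset.univ.image jj))
      rw [Finset.card_insert_of_notMem, Finset.card_image_of_injective _ T.jj_inj] at this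
      · simpa using this
      · simp only [Finset.mem_image, Finset.mem_univ, true_and, not_exists]
        exact T.notmem
    omega
  · simp only [Finset.mem_image, Finset.mem_univ, true_and, not_exists]
    exact T.notmem

theorem ann_inj (T : Tan u i0 i1 jj t0 u0 y) {L : Type} [Field L]
    (τ : IntermediateField.adjoin ℂ (Set.range u) →+* L) (a : Fin (n+1) → L)
    (h1 : ∀ t, ∑ c, a c * τ (y t c) = 0) (h0 : ∑ c, a c * τ (u0 c) = 0)
    (hC : ∀ c : Rest i0 jj, a c = 0) : a = 0 := by
  classical
  have hj : ∀ t, a (jj t) = 0 := by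
    intro t
    rw [← h1 t, Finset.sum_eq_single (jj t)]
    · rw [T.delta]; simp
    · intro c _ hc
      by_cases hc0 : c = i0
      · rw [hc0, T.zero]; simp
      · by_cases hc1 : ∃ t', jj t' = c
        · obtain ⟨t', rfl⟩ := hc1
          rw [T.delta, if_neg, map_zero, mul_zero]
          rintro rfl; exact hc rfl
        · push Not at hc1
          rw [hC ⟨c, hc0, hc1⟩, zero_mul]
    · simp
  have h00 : a i0 = 0 := by
    rw [← h0, Finset.sum_eq_single i0]
    · rw [T.one]; simp
    · intro c _ hc
      by_cases hc1 : ∃ t', jj t' = c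
      · obtain ⟨t', rfl⟩ := hc1
        rw [hj, zero_mul]
      · push Not at hc1
        rw [hC ⟨c, hc, hc1⟩, zero_mul]
    · simp
  funext c
  by_cases hc0 : c = i0
  · rw [hc0, h00]; rfl
  · by_cases hc1 : ∃ t', jj t' = c
    · obtain ⟨t', rfl⟩ := hc1
      exact hj _
    · push Not at hc1
      exact hC ⟨c, hc0, hc1⟩

end Tan
end FanoAux

namespace FanoAux
set_option linter.unusedSectionVars false
open MvPolynomial
variable {n s : ℕ} {d : Fin s → ℕ} {f : Fin s → PR n}

namespace Tan
variable {K : Type} [Field K] [Algebra ℂ K] {u : Fin (n+1) → K} {i0 i1 : Fin (n+1)} {r : ℕ}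
    {jj : Fin r → Fin (n+1)} {t0 : Fin r}
    {u0 : Fin (n+1) → IntermediateField.adjoin ℂ (Set.range u)}
    {y : Fin r → Fin (n+1) → IntermediateField.adjoin ℂ (Set.range u)}

theorem aeval_coe (T : Tan u i0 i1 jj t0 u0 y) (p : PR n) : ((aeval u0 p : _) : K) = aeval u p := by
  have : u = fun c => (IntermediateField.adjoin ℂ (Set.range u)).val (u0 c) := by
    funext c; exact (T.hu0 c).symm
  conv_rhs => rw [this]
  have := (comp_aeval_apply u0 (IntermediateField.adjoin ℂ (Set.range u)).val p)
  exact this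

theorem df_der (huf : ∀ i, aeval u (f i) = 0) (D : Derivation ℂ K K) (i : Fin s) :
    ∑ j, aeval u (pderiv j (f i)) * D (u j) = 0 := by
  have := derivation_aeval D u (f i)
  rw [huf, map_zero] at this
  exact this.symm

theorem df_y (T : Tan u i0 i1 jj t0 u0 y) (huf : ∀ i, aeval u (f i) = 0) (i : Fin s) (t : Fin r) :
    ∑ j, aeval u (pderiv j (f i)) * (y t j : K) = 0 := by
  obtain ⟨D, hD⟩ := T.der t
  have := df_der huf D i
  simpa only [hD] using this

theorem df_u (H : SmoothData n s d f) (huf : ∀ i, aeval u (f i) = 0) (i : Fin s) :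
    ∑ j, aeval u (pderiv j (f i)) * u j = 0 := by
  have := congrArg (aeval u) ((H.homog i).sum_X_mul_pderiv)
  rw [map_sum, map_nsmul, huf, smul_zero] at this
  simpa [mul_comm] using this

theorem indep (T : Tan u i0 i1 jj t0 u0 y) (H : SmoothData n s d f)
    (huf : ∀ i, aeval u (f i) = 0) (α : Fin (n+1) → K) (hα : ∀ t, ∑ j, α j * (y t j : K) = 0)
    (hαu : ∑ j, α j * u j = 0)
    (hns : ¬ ∃ l : Fin s → K, ∀ j, α j = ∑ i, l i * aeval u (pderiv j (f i))) :
    LinearIndependent K (fun (o : Option (Fin s)) (c : Rest i0 jj) =>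
      o.elim (α c) (fun i => aeval u (pderiv c.1 (f i)))) := by
  rw [Fintype.linearIndependent_iff]
  intro g hg
  have hg' : ∀ c : Rest i0 jj, g none * α c + ∑ i, g (some i) * aeval u (pderiv c.1 (f i)) = 0 := by
    intro c
    have := congrFun hg c
    rw [Fintype.sum_option] at this
    simpa using this
  have hz : (fun c => g none * α c + ∑ i, g (some i) * aeval u (pderiv c (f i))) = 0 := by
    refine T.ann_inj (algebraMap _ K) _ (fun t => ?_) ?_ hg'
    · have h1 := hα t
      have h2 : ∀ i, _ := fun i => T.df_y huf i t
      simp only [add_mul, Finset.sum_add_distrib, Finset.sum_mul]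
      rw [Finset.sum_comm]
      have e1 : ∑ x, g none * α x * algebraMap _ K (y t x) = g none * ∑ j, α j * (y t j : K) := by
        rw [Finset.mul_sum]; refine Finset.sum_congr rfl fun _ _ => ?_
        rw [mul_assoc]; rfl
      have e2 : ∀ i, ∑ x, g (some i) * aeval u (pderiv x (f i)) * algebraMap _ K (y t x)
          = g (some i) * ∑ j, aeval u (pderiv j (f i)) * (y t j : K) := by
        intro i
        rw [Finset.mul_sum]; refine Finset.sum_congr rfl fun _ _ => ?_
        rw [mul_assoc]; rfl
      rw [e1, h1]
      simp only [e2, h2]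
      simp
    · have h2 : ∀ i, _ := fun i => df_u H huf i
      have hu : ∀ c, algebraMap _ K (u0 c) = u c := T.hu0
      simp only [add_mul, Finset.sum_add_distrib, Finset.sum_mul, hu]
      rw [Finset.sum_comm]
      simp only [mul_assoc, ← Finset.mul_sum, hαu, h2]
      simp
  have hnone : g none = 0 := by
    by_contra hne
    apply hns
    refine ⟨fun i => - (g none)⁻¹ * g (some i), fun j => ?_⟩
    have := congrFun hz j
    simp only [Pi.zero_apply] at this
    simp only [mul_assoc]
    rw [← Finset.mul_sum]
    field_simp
    linear_combination this
  have hu : u ≠ 0 := by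
    intro h
    have h1 := T.hu0 i0
    rw [T.one, h] at h1
    exact one_ne_zero h1
  have hsome := jac_indep H u hu huf (fun i => g (some i)) (fun j => by
    have := congrFun hz j
    simpa [hnone] using this)
  rintro (_ | i)
  · exact hnone
  · exact congrFun hsome i

theorem card_le (T : Tan u i0 i1 jj t0 u0 y) (H : SmoothData n s d f)
    (huf : ∀ i, aeval u (f i) = 0) (α : Fin (n+1) → K) (hα : ∀ t, ∑ j, α j * (y t j : K) = 0)
    (hαu : ∑ j, α j * u j = 0)
    (hns : ¬ ∃ l : Fin s → K, ∀ j, α j = ∑ i, l i * aeval u (pderiv j (f i))) :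
    s + 1 + r ≤ n := by
  classical
  have h1 := (T.indep H huf α hα hαu hns).fintype_card_le_finrank
  have h2 := T.card_rest
  rw [Module.finrank_fintype_fun_eq_card, Fintype.card_option, Fintype.card_fin] at h1
  have : Fintype.card (Rest i0 jj) = @Fintype.card (Rest i0 jj) (Subtype.fintype _) := by
    congr!
  omega

theorem span_of_card (T : Tan u i0 i1 jj t0 u0 y) (H : SmoothData n s d f)
    (huf : ∀ i, aeval u (f i) = 0) (α : Fin (n+1) → K) (hα : ∀ t, ∑ j, α j * (y t j : K) = 0)
    (hαu : ∑ j, α j * u j = 0)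
    (hns : ¬ ∃ l : Fin s → K, ∀ j, α j = ∑ i, l i * aeval u (pderiv j (f i)))
    (hcard : s + 1 + r = n)
    (β : Fin (n+1) → K) (hβ : ∀ t, ∑ j, β j * (y t j : K) = 0) (hβu : ∑ j, β j * u j = 0) :
    ∃ (c : K) (l : Fin s → K), ∀ j, β j = c * α j + ∑ i, l i * aeval u (pderiv j (f i)) := by
  classical
  have hli := T.indep H huf α hα hαu hns
  have h2 := T.card_rest
  have hsp := hli.span_eq_top_of_card_eq_finrank' (by
    rw [Module.finrank_fintype_fun_eq_card, Fintype.card_option, Fintype.card_fin]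
    have : Fintype.card (Rest i0 jj) = @Fintype.card (Rest i0 jj) (Subtype.fintype _) := by
      congr!
    omega)
  have hmem : (fun c : Rest i0 jj => β c) ∈ Submodule.span K (Set.range
      (fun (o : Option (Fin s)) (c : Rest i0 jj) =>
      o.elim (α c) (fun i => aeval u (pderiv c.1 (f i))))) := by rw [hsp]; trivial
  rw [Submodule.mem_span_range_iff_exists_fun] at hmem
  obtain ⟨g, hg⟩ := hmem
  refine ⟨g none, fun i => g (some i), ?_⟩
  have hg' : ∀ c : Rest i0 jj, β c - (g none * α c + ∑ i, g (some i) * aeval u (pderiv c.1 (f i)))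
      = 0 := by
    intro c
    have := congrFun hg c
    rw [Fintype.sum_option] at this
    simp only [Pi.add_apply, Finset.sum_apply, Pi.smul_apply, smul_eq_mul, Option.elim] at this
    rw [← this]; ring
  have hz : (fun c => β c - (g none * α c + ∑ i, g (some i) * aeval u (pderiv c (f i)))) = 0 := by
    refine T.ann_inj (algebraMap _ K) _ (fun t => ?_) ?_ hg'
    · have h2 : ∀ i, _ := fun i => T.df_y huf i t
      have hy : ∀ c, algebraMap _ K (y t c) = (y t c : K) := fun _ => rfl
      simp only [sub_mul, add_mul, Finset.sum_sub_distrib, Finset.sum_add_distrib, Finset.sum_mul, hy]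
      rw [Finset.sum_comm (f := fun x i => g (some i) * _ * _)]
      simp only [mul_assoc, ← Finset.mul_sum, hα, hβ, h2]
      simp
    · have h2 : ∀ i, _ := fun i => df_u H huf i
      have hu : ∀ c, algebraMap _ K (u0 c) = u c := T.hu0
      simp only [sub_mul, add_mul, Finset.sum_sub_distrib, Finset.sum_add_distrib, Finset.sum_mul, hu]
      rw [Finset.sum_comm (f := fun x i => g (some i) * _ * _)]
      simp only [mul_assoc, ← Finset.mul_sum, hαu, hβu, h2]
      simp
  intro j
  exact sub_eq_zero.1 (congrFun hz j)

end Tan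

end FanoAux

namespace FanoAux
set_option linter.unusedSectionVars false
open MvPolynomial
variable {n s : ℕ} {d : Fin s → ℕ} {f : Fin s → PR n}

/-- The inclusion as a `ℂ`-algebra map. -/
abbrev sg (M K : Type) [Field M] [Algebra ℂ M] [Field K] [Algebra ℂ K] [Algebra M K]
    [IsScalarTower ℂ M K] : M →ₐ[ℂ] K := IsScalarTower.toAlgHom ℂ M K

/-- Coordinates extended to the bigger field. -/
abbrev exv {M : Type} (K : Type) [Field M] [Algebra ℂ M] [Field K] [Algebra ℂ K] [Algebra M K]
    [IsScalarTower ℂ M K] (U : Fin (n+1) → M) : Fin (n+1) → K := fun c => sg M K (U c)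

/-- The generic point of the generic line. -/
abbrev gpt {M : Type} {K : Type} [Field M] [Algebra ℂ M] [Field K] [Algebra ℂ K] [Algebra M K]
    [IsScalarTower ℂ M K] (U V : Fin (n+1) → M) (ρ : K) : Fin (n+1) → K :=
  fun c => exv K U c + ρ * exv K V c

structure Setup {M : Type} {K : Type} [Field M] [Algebra ℂ M] [Field K] [Algebra ℂ K] [Algebra M K]
    [IsScalarTower ℂ M K] (d : Fin s → ℕ) (f : Fin s → PR n) (U V : Fin (n+1) → M)
    (i0 i1 : Fin (n+1)) (q : ℕ) (η : Fin s → PR n →ₗ[ℂ] M) (m : ℕ) (ρ : K) : Prop where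
  H : SmoothData n s d f
  fr : Frame U V i0 i1
  on : ∀ i, phi U V (f i) = 0
  gen : IntermediateField.adjoin ℂ (Set.range U ∪ Set.range V) = ⊤
  ne : η ≠ 0
  adm : Adm d f (plu U V) q η
  max : ∀ η' : Fin s → PR n →ₗ[ℂ] M, Adm d f (plu U V) (q + 1) η' → η' = 0
  bas : ∃ x : Fin m → M, IsTranscendenceBasis ℂ x
  tr : Transcendental M ρ
  genK : IntermediateField.adjoin M {ρ} = ⊤

namespace Setup
variable {M : Type} {K : Type} [Field M] [Algebra ℂ M] [Field K] [Algebra ℂ K] [Algebra M K]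
    [IsScalarTower ℂ M K] {U V : Fin (n+1) → M}
    {i0 i1 : Fin (n+1)} {q : ℕ} {η : Fin s → PR n →ₗ[ℂ] M} {m : ℕ} {ρ : K}

theorem frK (S : Setup d f U V i0 i1 q η m ρ) : Frame (exv K U) (exv K V) i0 i1 :=
  S.fr.map (sg M K)

theorem onK (S : Setup d f U V i0 i1 q η m ρ) (i : Fin s) : phi (exv K U) (exv K V) (f i) = 0 := by
  rw [phi_map, S.on, Polynomial.map_zero]

theorem plu_ext : plu (exv K U) (exv K V) = fun a b => sg M K (plu U V a b) := by
  funext a b; simp [plu, exv]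

theorem u_i0 (S : Setup d f U V i0 i1 q η m ρ) : gpt U V ρ i0 = 1 := by
  simp [gpt, exv, S.fr.U0, S.fr.V0]

theorem u_i1 (S : Setup d f U V i0 i1 q η m ρ) : gpt U V ρ i1 = ρ := by
  simp [gpt, exv, S.fr.U1, S.fr.V1]

theorem huf (S : Setup d f U V i0 i1 q η m ρ) (i : Fin s) : aeval (gpt U V ρ) (f i) = 0 :=
  on_eval S.onK ρ i

theorem admK (S : Setup d f U V i0 i1 q η m ρ) : Adm d f (plu (exv K U) (exv K V)) q
    (fun i => (sg M K).toLinearMap ∘ₗ η i) := by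
  rw [plu_ext]; exact S.adm.map (sg M K)

theorem neK (S : Setup d f U V i0 i1 q η m ρ) : (fun i => (sg M K).toLinearMap ∘ₗ η i) ≠ 0 := by
  intro h
  apply S.ne
  funext i
  refine LinearMap.ext fun g0 => ?_
  have := congrArg (fun g : Fin s → PR n →ₗ[ℂ] K => g i g0) h
  simp only [LinearMap.coe_comp, Function.comp_apply] at this
  exact (sg M K).injective (by simpa using this)

theorem maxK (S : Setup d f U V i0 i1 q η m ρ) (ξ : Fin s → PR n →ₗ[ℂ] K)
    (h : Adm d f (plu (exv K U) (exv K V)) (q+1) ξ) : ξ = 0 := by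
  by_contra hne
  rw [plu_ext] at h
  obtain ⟨η', h1, h2⟩ := adm_descend (sg M K) hne h
  exact h1 (S.max η' h2)

theorem trC (S : Setup d f U V i0 i1 q η m ρ) : Transcendental ℂ (gpt U V ρ i1) := by
  rw [S.u_i1]
  intro h
  exact S.tr (h.tower_top M)

/-- The form `α`. -/
abbrev al (_S : Setup d f U V i0 i1 q η m ρ) : Fin (n+1) → K :=
  thetaDiv d f (exv K U) (exv K V) i0 i1 q (fun i => (sg M K).toLinearMap ∘ₗ η i) ρ

theorem al_ns (S : Setup d f U V i0 i1 q η m ρ) :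
    ¬ ∃ l : Fin s → K, ∀ j, S.al j = ∑ i, l i * aeval (gpt U V ρ) (pderiv j (f i)) := by
  rintro ⟨l, hl⟩
  obtain ⟨ξ, hξ, hR⟩ := divide S.H S.frK S.onK S.admK ρ
  obtain ⟨ξ', h1, h2⟩ := correct S.H hξ (plu_u _ _ ρ) S.huf hR l hl
  exact RRel.ne_zero S.frK h2 S.neK (S.maxK _ h1)

theorem al_u (S : Setup d f U V i0 i1 q η m ρ) : ∑ j, S.al j * gpt U V ρ j = 0 :=
  alpha_u S.H S.frK S.onK S.admK ρ

theorem al_der (S : Setup d f U V i0 i1 q η m ρ) (D : Derivation ℂ K K) :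
    ∑ j, S.al j * D (gpt U V ρ j) = 0 :=
  alpha_der S.H S.frK S.onK S.admK ρ D

theorem genuV (S : Setup d f U V i0 i1 q η m ρ) :
    IntermediateField.adjoin ℂ (Set.range (gpt U V ρ) ∪ Set.range (exv K V)) = ⊤ := by
  set E := IntermediateField.adjoin ℂ (Set.range (gpt U V ρ) ∪ Set.range (exv K V)) with hE
  have hu : ∀ c, gpt U V ρ c ∈ E := fun c =>
    IntermediateField.subset_adjoin _ _ (Or.inl ⟨c, rfl⟩)
  have hV : ∀ c, exv K V c ∈ E := fun c =>
    IntermediateField.subset_adjoin _ _ (Or.inr ⟨c, rfl⟩)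
  have hρ : ρ ∈ E := by rw [← S.u_i1]; exact hu i1
  have hU : ∀ c, exv K U c ∈ E := fun c => by
    have : exv K U c = gpt U V ρ c - ρ * exv K V c := by simp [gpt]
    rw [this]
    exact sub_mem (hu c) (mul_mem hρ (hV c))
  have hM : ∀ a : M, algebraMap M K a ∈ E := by
    have : (⊤ : IntermediateField ℂ M) ≤ E.comap (sg M K) := by
      rw [← S.gen, IntermediateField.adjoin_le_iff]
      rintro _ (⟨c, rfl⟩ | ⟨c, rfl⟩)
      · exact hU c
      · exact hV c
    intro a
    exact this (x := a) trivial
  have hKK : (⊤ : IntermediateField M K) ≤ E.toSubfield.toIntermediateField hM := by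
    rw [← S.genK, IntermediateField.adjoin_le_iff]
    intro t ht
    rw [Set.mem_singleton_iff.1 ht]
    exact hρ
  rw [eq_top_iff]
  intro a _
  exact hKK (x := a) trivial

theorem algM (S : Setup d f U V i0 i1 q η m ρ) :
    Algebra.IsAlgebraic (IntermediateField.adjoin M (Set.range (fun _ : Unit => ρ))) K := by
  refine isAlg_of_gen {ρ} S.genK _ ?_
  intro t ht
  rw [Set.mem_singleton_iff.1 ht]
  exact isAlgebraic_algebraMap (⟨ρ, IntermediateField.subset_adjoin _ _ ⟨(), rfl⟩⟩ :
        IntermediateField.adjoin M (Set.range (fun _ : Unit => ρ)))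

theorem basρ (S : Setup d f U V i0 i1 q η m ρ) :
    IsTranscendenceBasis M (fun _ : Unit => ρ) := by
  have h1 : AlgebraicIndependent M (fun _ : Unit => ρ) := by
    rw [algebraicIndependent_unique_type_iff]; exact S.tr
  refine h1.isTranscendenceBasis_iff_isAlgebraic.2 ?_
  exact isAlg_adjoin _ S.algM

theorem basK (S : Setup d f U V i0 i1 q η m ρ) :
    ∃ x : Fin (m+1) → K, IsTranscendenceBasis ℂ x := by
  obtain ⟨x, hx⟩ := S.bas
  have := hx.sumElim_comp S.basρ
  let e : Fin (m+1) ≃ Unit ⊕ Fin m := Fintype.equivOfCardEq (by simp [add_comm])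
  exact ⟨_, (isTranscendenceBasis_equiv e).2 this⟩

end Setup
end FanoAux

namespace FanoAux
set_option linter.unusedSectionVars false
open MvPolynomial
variable {n s : ℕ} {d : Fin s → ℕ} {f : Fin s → PR n}

section num
variable {K : Type} [Field K] [Algebra ℂ K] {K0 : IntermediateField ℂ K} {r m : ℕ}
  {b : Fin r → K0} {x : Fin m → K}

theorem num0 (hb : IsTranscendenceBasis ℂ b) (hx : IsTranscendenceBasis ℂ x) {ι : Type} [Fintype ι]
    (g : ι → K) (hg : IsTranscendenceBasis K0 g) : Fintype.card ι + r = m := by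
  have h1 := hb.sumElim_comp hg
  have h2 := h1.cardinalMk_eq hx
  rw [Cardinal.mk_fintype, Cardinal.mk_fintype, Fintype.card_sum, Fintype.card_fin,
    Fintype.card_fin] at h2
  exact_mod_cast h2

theorem num1 (hb : IsTranscendenceBasis ℂ b) (hx : IsTranscendenceBasis ℂ x) {ι : Type} [Fintype ι]
    (g : ι → K) (hg : Algebra.IsAlgebraic (IntermediateField.adjoin K0 (Set.range g)) K) :
    m ≤ Fintype.card ι + r ∧ (Fintype.card ι + r ≤ m → IsTranscendenceBasis K0 g) := by
  classical
  haveI := isAlg_adjoin _ hg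
  obtain ⟨t, ht, hB⟩ := exists_isTranscendenceBasis_subset (R := K0) (Set.range g)
  haveI : Fintype t := ((Set.finite_range g).subset ht).fintype
  have h1 : Fintype.card t + r = m := num0 hb hx (fun z : t => (z : K)) hB
  have h2 : Fintype.card t ≤ Fintype.card ι := by
    have := Finset.card_le_card (s := t.toFinset) (t := Finset.univ.image g) (by
      intro a ha
      obtain ⟨i, hi⟩ := ht (Set.mem_toFinset.1 ha)
      exact Finset.mem_image.2 ⟨i, Finset.mem_univ _, hi⟩)
    rw [Set.toFinset_card] at this
    exact this.trans Finset.card_image_le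
  refine ⟨by omega, fun h => ?_⟩
  refine Algebra.IsAlgebraic.isTranscendenceBasis_of_le_trdeg_of_finite K0 g ?_
  rw [← hB.cardinalMk_eq_trdeg, Cardinal.mk_fintype, Cardinal.mk_fintype]
  exact_mod_cast (by omega : Fintype.card ι ≤ Fintype.card t)

end num

section lin
variable {K0 : Type} [Field K0] [Algebra ℂ K0] {r : ℕ}
  (u0 : Fin (n+1) → K0) (y : Fin r → Fin (n+1) → K0)

/-- The generic point of the tangent space. -/
def linp (c : Fin (n+1)) : MvPolynomial (Option (Fin r)) K0 :=
  X none * C (u0 c) + ∑ t, X (some t) * C (y t c)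

theorem linp_homog (c : Fin (n+1)) : (linp u0 y c).IsHomogeneous 1 := by
  refine IsHomogeneous.add ?_ (IsHomogeneous.sum _ _ _ fun t _ => ?_)
  · exact (isHomogeneous_X _ _).mul (isHomogeneous_C _ _)
  · exact (isHomogeneous_X _ _).mul (isHomogeneous_C _ _)

theorem linp_aeval {A : Type} [CommRing A] [Algebra K0 A] [Algebra ℂ A] [IsScalarTower ℂ K0 A]
    (x : Option (Fin r) → A) (p : PR n) :
    aeval x (aeval (linp u0 y) p) =
      aeval (fun c => x none * algebraMap K0 A (u0 c) + ∑ t, x (some t) * algebraMap K0 A (y t c)) p := by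
  have := comp_aeval_apply (R := ℂ) (linp u0 y) ((aeval (R := K0) x).restrictScalars ℂ) p
  have e : (fun c => ((aeval (R := K0) x).restrictScalars ℂ) (linp u0 y c)) =
    (fun c => x none * algebraMap K0 A (u0 c) + ∑ t, x (some t) * algebraMap K0 A (y t c)) := by
    funext c
    simp [linp]
  rw [← e, ← this]
  rfl

theorem linp_pderiv (t : Fin r) (p : PR n) :
    pderiv (some t) (aeval (linp u0 y) p) =
      ∑ j, aeval (linp u0 y) (pderiv j p) * C (y t j) := by
  classical
  have := derivation_aeval ((pderiv (R := K0) (some t)).restrictScalars ℂ) (linp u0 y) p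
  refine this.trans ?_
  refine Finset.sum_congr rfl fun j _ => ?_
  rw [smul_eq_mul]
  congr 1
  change pderiv (some t) (linp u0 y j) = _
  rw [linp]
  simp [pderiv_X, Pi.single_apply, ite_mul]

theorem linp_pderiv_none (p : PR n) :
    pderiv none (aeval (linp u0 y) p) =
      ∑ j, aeval (linp u0 y) (pderiv j p) * C (u0 j) := by
  classical
  have := derivation_aeval ((pderiv (R := K0) (none : Option (Fin r))).restrictScalars ℂ) (linp u0 y) p
  refine this.trans ?_
  refine Finset.sum_congr rfl fun j _ => ?_
  rw [smul_eq_mul]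
  congr 1
  change pderiv none (linp u0 y j) = _
  rw [linp]
  simp [pderiv_X, Pi.single_apply]

end lin

theorem poly_vanish {K0 K : Type} [Field K0] [Infinite K0] [Field K] [Algebra K0 K] {r : ℕ} (t0 : Fin r)
    (v : Fin r → K) (hv : v t0 = 1) (hv' : AlgebraicIndependent K0 (fun t : {t // t ≠ t0} => v t.1))
    {e : ℕ} (P : MvPolynomial (Option (Fin r)) K0) (hPh : P.IsHomogeneous e)
    (h : ∀ lam : K0, aeval (fun o : Option (Fin r) => o.elim 1 (fun t => algebraMap K0 K lam * v t)) P = 0) :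
    P = 0 := by
  classical
  let w : K0 → Option (Fin r) → MvPolynomial {t // t ≠ t0} K0 := fun lam o =>
    o.elim 1 (fun t => if h : t = t0 then C lam else C lam * X ⟨t, h⟩)
  have hw : ∀ lam, aeval (w lam) P = 0 := by
    intro lam
    apply hv'
    rw [map_zero, comp_aeval_apply, ← h lam]
    congr 2
    funext o
    rcases o with _ | t
    · simp [w]
    · simp only [w, Option.elim]
      split_ifs with h
      · rw [h, hv, aeval_C]; simp
      · rw [map_mul, aeval_C, aeval_X]
  have hPX : P * (X none * X (some t0)) = 0 := by
    apply MvPolynomial.funext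
    intro x
    rw [map_zero, map_mul, map_mul, eval_X, eval_X]
    by_cases h0 : x none = 0
    · rw [h0]; ring
    by_cases h0' : x (some t0) = 0
    · rw [h0']; ring
    suffices eval x P = 0 by rw [this]; ring
    have h3 := hw (x (some t0) / x none)
    have h4 := congrArg (aeval (fun t : {t // t ≠ t0} => x (some t.1) / x (some t0))) h3
    rw [map_zero] at h4
    have e1 : aeval (fun t : {t // t ≠ t0} => x (some t.1) / x (some t0))
        (aeval (w (x (some t0) / x none)) P) = aeval (fun o => (x none)⁻¹ * x o) P := by
      rw [comp_aeval_apply]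
      congr 2
      funext o
      rcases o with _ | t
      · simp [w, h0]
      · simp only [w, Option.elim]
        split_ifs with h
        · rw [h, aeval_C]; simp [div_eq_mul_inv, mul_comm]
        · rw [map_mul, aeval_C, aeval_X, Algebra.algebraMap_self, RingHom.id_apply]
          field_simp
    rw [e1, eval_scale hPh] at h4
    rcases mul_eq_zero.1 h4 with h5 | h5
    · exact absurd h5 (pow_ne_zero _ (inv_ne_zero h0))
    · exact h5
  rcases mul_eq_zero.1 hPX with h | h
  · exact h
  · exact absurd h (mul_ne_zero (X_ne_zero _) (X_ne_zero _))

/-- Conclusion of case 1: the tangent space cannot lie in `X`. -/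
theorem tan_not_in {K : Type} [Field K] [Algebra ℂ K] {u : Fin (n+1) → K} {i0 i1 : Fin (n+1)} {r : ℕ}
    {jj : Fin r → Fin (n+1)} {t0 : Fin r}
    {u0 : Fin (n+1) → IntermediateField.adjoin ℂ (Set.range u)}
    {y : Fin r → Fin (n+1) → IntermediateField.adjoin ℂ (Set.range u)}
    (T : Tan u i0 i1 jj t0 u0 y) (H : SmoothData n s d f) (hs : 0 < s)
    (hr : n + 1 ≤ s + 2 * r)
    (hP : ∀ i, aeval (linp u0 y) (f i) = 0) : False := by
  classical
  have hcard := T.card_rest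
  obtain ⟨κ, hκ, σ, x, l, hx, hl, hG⟩ := lemmaD (k := IntermediateField.adjoin ℂ (Set.range u))
    (τ := Option (Fin r)) (γ := Rest i0 jj) none (fun i => d i - 1)
    (fun i => by have := H.two_le i; omega) hs
    (fun i c => aeval (linp u0 y) (pderiv c.1 (f i)))
    (fun i c => by
      have := ((H.homog i).pderiv (i := c.1)).aeval (linp u0 y) (linp_homog u0 y)
      rwa [one_mul] at this)
    (by
      rw [Fintype.card_option, Fintype.card_fin]
      have : Fintype.card (Rest i0 jj) = @Fintype.card (Rest i0 jj) (Subtype.fintype _) := by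
        congr!
      omega)
  letI : Algebra (IntermediateField.adjoin ℂ (Set.range u)) κ := σ.toAlgebra
  letI : Algebra ℂ κ := (σ.comp (algebraMap ℂ _)).toAlgebra
  haveI : IsScalarTower ℂ (IntermediateField.adjoin ℂ (Set.range u)) κ := IsScalarTower.of_algebraMap_eq' rfl
  have hσ : ∀ a, algebraMap (IntermediateField.adjoin ℂ (Set.range u)) κ a = σ a := fun _ => rfl
  have hev : ∀ p, eval₂ σ x p = aeval x p := fun p => rfl
  set v : Fin (n+1) → κ := fun c => x none * σ (u0 c) + ∑ t, x (some t) * σ (y t c) with hv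
  have hlin : ∀ p : PR n, aeval x (aeval (linp u0 y) p) = aeval v p := fun p => linp_aeval u0 y x p
  have hv0 : v ≠ 0 := by
    intro h
    have h1 : x none = 0 := by
      have := congrFun h i0
      simpa [hv, T.one, T.zero] using this
    apply hx
    funext o
    rcases o with _ | t
    · exact h1
    · have := congrFun h (jj t)
      have e : ∀ t', σ (y t' (jj t)) = if t = t' then 1 else 0 := by
        intro t'; rw [T.delta]; split_ifs <;> simp
      simp only [hv, e, h1] at this
      simpa using this
  have hvf : ∀ i, aeval v (f i) = 0 := by
    intro i
    rw [← hlin, hP, map_zero]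
  have hdy : ∀ i t, ∑ j, aeval v (pderiv j (f i)) * σ (y t j) = 0 := by
    intro i t
    have := linp_pderiv u0 y t (f i)
    rw [hP, map_zero] at this
    have h2 := congrArg (aeval x) this
    rw [map_zero, map_sum] at h2
    simp only [map_mul, hlin, aeval_C, hσ] at h2
    exact h2.symm
  have hdu : ∀ i, ∑ j, aeval v (pderiv j (f i)) * σ (u0 j) = 0 := by
    intro i
    have := linp_pderiv_none u0 y (f i)
    rw [hP, map_zero] at this
    have h2 := congrArg (aeval x) this
    rw [map_zero, map_sum] at h2
    simp only [map_mul, hlin, aeval_C, hσ] at h2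
    exact h2.symm
  have hz := T.ann_inj σ (fun c => ∑ i, l i * aeval v (pderiv c (f i))) (fun t => by
      simp only [Finset.sum_mul]
      rw [Finset.sum_comm]
      simp only [mul_assoc, ← Finset.mul_sum, hdy]; simp) (by
      simp only [Finset.sum_mul]
      rw [Finset.sum_comm]
      simp only [mul_assoc, ← Finset.mul_sum, hdu]; simp) (fun c => by
      have := hG c
      simp only [hev, hlin] at this
      exact this)
  exact hl (jac_indep H v hv0 hvf l fun j => congrFun hz j)

namespace Setup
variable {M : Type} {K : Type} [Field M] [Algebra ℂ M] [Field K] [Algebra ℂ K] [Algebra M K]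
    [IsScalarTower ℂ M K] {U V : Fin (n+1) → M}
    {i0 i1 : Fin (n+1)} {q : ℕ} {η : Fin s → PR n →ₗ[ℂ] M} {m : ℕ} {ρ : K}
   {r : ℕ} {jj : Fin r → Fin (n+1)} {t0 : Fin r}
    {u0 : Fin (n+1) → IntermediateField.adjoin ℂ (Set.range (gpt U V ρ))}
    {y : Fin r → Fin (n+1) → IntermediateField.adjoin ℂ (Set.range (gpt U V ρ))}

theorem V_comb (S : Setup d f U V i0 i1 q η m ρ) (T : Tan (gpt U V ρ) i0 i1 jj t0 u0 y) (c) :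
    exv K V c = ∑ t, exv K V (jj t) * (y t c : K) := by
  haveI : CharZero M := charZero_of_injective_algebraMap (algebraMap ℂ M).injective
  obtain ⟨D, hD⟩ := exists_derivation _ S.basρ (fun _ => 1)
  have hD1 : ∀ a : M, D (algebraMap M K a) = 0 := fun a => D.map_algebraMap a
  have h := T.comb (D.restrictScalars ℂ) c
  have h2 : ∀ c, (D.restrictScalars ℂ) (gpt U V ρ c) = exv K V c := by
    intro c
    change D (algebraMap M K (U c) + ρ * algebraMap M K (V c)) = algebraMap M K (V c)
    rw [map_add, Derivation.leibniz, hD1, hD1, hD ()]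
    simp
  simpa only [h2] using h

theorem alg_of_V (S : Setup d f U V i0 i1 q η m ρ)
    (E : IntermediateField (IntermediateField.adjoin ℂ (Set.range (gpt U V ρ))) K)
    (hE : ∀ c, exv K V c ∈ E) :
    Algebra.IsAlgebraic E K := by
  have htop : ∀ a : K, a ∈ E := by
    have : (⊤ : IntermediateField ℂ K) ≤ E.restrictScalars ℂ := by
      rw [← S.genuV, IntermediateField.adjoin_le_iff]
      rintro _ (⟨c, rfl⟩ | ⟨c, rfl⟩)
      · exact E.algebraMap_mem (⟨_, IntermediateField.subset_adjoin _ _ ⟨c, rfl⟩⟩ :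
          IntermediateField.adjoin ℂ (Set.range (gpt U V ρ)))
      · exact hE c
    intro a
    exact this (x := a) trivial
  constructor
  intro a
  exact isAlgebraic_algebraMap (⟨a, htop a⟩ : E)

theorem case1 (S : Setup d f U V i0 i1 q η m ρ) (T : Tan (gpt U V ρ) i0 i1 jj t0 u0 y)
    (hs : 0 < s) (hr : r + s + 2 ≤ n) (hm : 2 * n ≤ m + ∑ i, d i + s + 1)
    (hd : ∑ i, d i ≤ s + 5) (hn : ∑ i, d i ≤ n) : False := by
  classical
  have hrpos : 0 < r := t0.pos
  let g : {t // t ≠ t0} → K := fun t => exv K V (jj t)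
  obtain ⟨xK, hxK⟩ := S.basK
  have hVt0 : exv K V (jj t0) = 1 := by rw [T.jt0]; simp [exv, S.fr.V1]
  have halg : Algebra.IsAlgebraic (IntermediateField.adjoin
      (IntermediateField.adjoin ℂ (Set.range (gpt U V ρ))) (Set.range g)) K := by
    refine S.alg_of_V _ fun c => ?_
    rw [S.V_comb T c]
    refine sum_mem fun t _ => mul_mem ?_ (IntermediateField.algebraMap_mem _ _)
    by_cases ht : t = t0
    · rw [ht, hVt0]; exact one_mem _
    · exact IntermediateField.subset_adjoin _ _ ⟨⟨t, ht⟩, rfl⟩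
  obtain ⟨h1, h2⟩ := num1 T.basis hxK g halg
  have hc : Fintype.card {t // t ≠ t0} = r - 1 := by
    rw [Fintype.card_subtype_compl]; simp
  have hbas := h2 (by omega)
  refine tan_not_in T S.H hs (by omega) fun i => ?_
  refine poly_vanish t0 (fun t => exv K V (jj t)) hVt0 hbas.1 _
    ((S.H.homog i).aeval (linp u0 y) (linp_homog u0 y)) fun lam => ?_
  rw [linp_aeval]
  have := on_eval S.onK (ρ + algebraMap _ K lam) i
  rw [← this]
  congr 2
  funext c
  have hu : algebraMap _ K (u0 c) = gpt U V ρ c := T.hu0 c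
  have h6 : ∑ t, exv K V (jj t) * algebraMap _ K (y t c) = exv K V c := (S.V_comb T c).symm
  simp only [Option.elim, mul_assoc]
  rw [← Finset.mul_sum, h6, hu]
  simp only [gpt]
  ring

end Setup
end FanoAux

namespace FanoAux
set_option linter.unusedSectionVars false
open MvPolynomial
variable {n s : ℕ} {d : Fin s → ℕ} {f : Fin s → PR n}

/-- A place of a field extension of `ℂ`. -/
structure Place {K κ : Type} [Field K] [Algebra ℂ K] [Field κ] [Algebra ℂ κ]
    (O : ValuationSubring K) (rd : K → κ) : Prop where
  C_mem : ∀ z : ℂ, algebraMap ℂ K z ∈ O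
  rd_C : ∀ z : ℂ, rd (algebraMap ℂ K z) = algebraMap ℂ κ z
  rd_add : ∀ a ∈ O, ∀ b ∈ O, rd (a + b) = rd a + rd b
  rd_mul : ∀ a ∈ O, ∀ b ∈ O, rd (a * b) = rd a * rd b
  rd_inv : ∀ a ∈ O, a⁻¹ ∉ O → rd a = 0

theorem exists_place {K : Type} [Field K] [Algebra ℂ K] (O : ValuationSubring K)
    (hO : ∀ z : ℂ, algebraMap ℂ K z ∈ O) :
    ∃ (κ : Type) (_ : Field κ) (_ : Algebra ℂ κ) (rd : K → κ), Place O rd := by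
  classical
  let ι : ℂ →+* O := (algebraMap ℂ K).codRestrict O.toSubring hO
  let π : O →+* IsLocalRing.ResidueField O := IsLocalRing.residue O
  letI : Algebra ℂ (IsLocalRing.ResidueField O) := (π.comp ι).toAlgebra
  refine ⟨IsLocalRing.ResidueField O, inferInstance, inferInstance,
    fun a => if h : a ∈ O then π ⟨a, h⟩ else 0, hO, ?_, ?_, ?_, ?_⟩
  · intro z
    simp only [hO z, dif_pos]
    rfl
  · intro a ha b hb
    simp only [ha, hb, add_mem ha hb, dif_pos, ← map_add]
    rfl
  · intro a ha b hb
    simp only [ha, hb, mul_mem ha hb, dif_pos, ← map_mul]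
    rfl
  · intro a ha hb
    simp only [ha, dif_pos]
    rw [IsLocalRing.residue_eq_zero_iff, IsLocalRing.mem_maximalIdeal, mem_nonunits_iff]
    rintro ⟨v, hv⟩
    apply hb
    have h1 : (v : O) * ((v⁻¹ : Oˣ) : O) = 1 := v.mul_inv
    rw [hv] at h1
    have h2 : a * (((v⁻¹ : Oˣ) : O) : K) = 1 := congrArg Subtype.val h1
    rw [inv_eq_of_mul_eq_one_right h2]
    exact ((v⁻¹ : Oˣ) : O).2

namespace Place
variable {K κ : Type} [Field K] [Algebra ℂ K] [Field κ] [Algebra ℂ κ]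
    {O : ValuationSubring K} {rd : K → κ}

theorem rd_zero (R : Place O rd) : rd 0 = 0 := by
  have := R.rd_C 0; simpa using this

theorem rd_one (R : Place O rd) : rd 1 = 1 := by
  have := R.rd_C 1; simpa using this

theorem rd_ne (R : Place O rd) {a : K} (h0 : a ≠ 0) (h1 : a ∈ O) (h2 : a⁻¹ ∈ O) : rd a ≠ 0 := by
  intro h
  have := R.rd_mul a h1 _ h2
  rw [mul_inv_cancel₀ h0, R.rd_one, h, zero_mul] at this
  exact one_ne_zero this

theorem rd_sub (R : Place O rd) {a b : K} (h1 : a ∈ O) (h2 : b ∈ O) : rd (a - b) = rd a - rd b := by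
  have := R.rd_add (a - b) (sub_mem h1 h2) b h2
  rw [sub_add_cancel] at this
  rw [this]; ring

theorem rd_sum (R : Place O rd) {ι : Type} (t : Finset ι) (g : ι → K) (h : ∀ i, g i ∈ O) :
    rd (∑ i ∈ t, g i) = ∑ i ∈ t, rd (g i) := by
  classical
  induction t using Finset.induction_on with
  | empty => simp [R.rd_zero]
  | insert a t ha ih =>
    rw [Finset.sum_insert ha, Finset.sum_insert ha, R.rd_add _ (h a) _ (sum_mem fun i _ => h i), ih]

theorem rd_aeval (R : Place O rd) {ι : Type} (x : ι → K) (hx : ∀ i, x i ∈ O)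
    (p : MvPolynomial ι ℂ) : aeval x p ∈ O ∧ rd (aeval x p) = aeval (fun i => rd (x i)) p := by
  induction p using MvPolynomial.induction_on with
  | C a => simp only [aeval_C]; exact ⟨R.C_mem a, R.rd_C a⟩
  | add p q hp hq =>
    simp only [map_add]
    exact ⟨add_mem hp.1 hq.1, by rw [R.rd_add _ hp.1 _ hq.1, hp.2, hq.2]⟩
  | mul_X p i hp =>
    simp only [map_mul, aeval_X]
    exact ⟨mul_mem hp.1 (hx i), by rw [R.rd_mul _ hp.1 _ (hx i), hp.2]⟩

/-- The reduction of a functional. -/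
def redMap (R : Place O rd) (η : PR n →ₗ[ℂ] K) (h : ∀ g, η g ∈ O) : PR n →ₗ[ℂ] κ where
  toFun g := rd (η g)
  map_add' a b := by rw [map_add, R.rd_add _ (h a) _ (h b)]
  map_smul' z a := by
    rw [map_smul, Algebra.smul_def, R.rd_mul _ (R.C_mem z) _ (h a), R.rd_C, RingHom.id_apply,
      Algebra.smul_def]

theorem star (R : Place O rd) {P : Fin (n + 1) → Fin (n + 1) → K} {Q : ℕ}
    {u θ : Fin (n + 1) → K} {η : Fin s → PR n →ₗ[ℂ] K} (h : Star d f P Q u θ η)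
    (hP : ∀ a b, P a b ∈ O) (hu : ∀ c, u c ∈ O) (hθ : ∀ c, θ c ∈ O) (hη : ∀ i g, η i g ∈ O) :
    Star d f (fun a b => rd (P a b)) Q (fun c => rd (u c)) (fun c => rd (θ c))
      (fun i => R.redMap (η i) (hη i)) := by
  constructor
  · intro i e g hg he
    change rd (η i g) = 0
    rw [h.deg i e g hg he, R.rd_zero]
  · intro i a b c g
    change rd (P a b) * rd (η i (X c * g)) - rd (P a c) * rd (η i (X b * g))
      + rd (P b c) * rd (η i (X a * g)) = 0
    rw [← R.rd_mul _ (hP _ _) _ (hη _ _), ← R.rd_mul _ (hP _ _) _ (hη _ _),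
      ← R.rd_mul _ (hP _ _) _ (hη _ _), ← R.rd_sub (mul_mem (hP _ _) (hη _ _))
      (mul_mem (hP _ _) (hη _ _)), ← R.rd_add _ (sub_mem (mul_mem (hP _ _) (hη _ _))
      (mul_mem (hP _ _) (hη _ _))) _ (mul_mem (hP _ _) (hη _ _)), h.supp, R.rd_zero]
  · intro i k g
    change rd (η i (f k * g)) = 0
    rw [h.van, R.rd_zero]
  · intro j g hg
    change ∑ i, rd (η i (g * pderiv j (f i))) = _
    rw [← R.rd_sum _ (fun i => η i (g * pderiv j (f i))) (fun i => hη _ _), h.kill j g hg,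
      R.rd_mul _ (R.rd_aeval u hu g).1 _ (hθ j), (R.rd_aeval u hu g).2]

theorem rrel (R : Place O rd) {P : Fin (n + 1) → Fin (n + 1) → K} {c : K}
    {u : Fin (n + 1) → K} {η ξ : Fin s → PR n →ₗ[ℂ] K} (h : RRel P c u η ξ) (hc : c ∈ O)
    (hP : ∀ a b, P a b ∈ O) (hu : ∀ c, u c ∈ O) (hη : ∀ i g, η i g ∈ O) (hξ : ∀ i g, ξ i g ∈ O) :
    RRel (fun a b => rd (P a b)) (rd c) (fun c => rd (u c))
      (fun i => R.redMap (η i) (hη i)) (fun i => R.redMap (ξ i) (hξ i)) := by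
  intro i a b g
  change rd (u a) * rd (ξ i (X b * g)) - rd (u b) * rd (ξ i (X a * g)) = rd c * rd (P a b) * rd (η i g)
  rw [← R.rd_mul _ (hu _) _ (hξ _ _), ← R.rd_mul _ (hu _) _ (hξ _ _),
    ← R.rd_sub (mul_mem (hu _) (hξ _ _)) (mul_mem (hu _) (hξ _ _)), h i a b g,
    R.rd_mul _ (mul_mem hc (hP _ _)) _ (hη _ _), R.rd_mul _ hc _ (hP _ _)]

/-- Independent elements in the residue field lift. -/
theorem indep_lift (R : Place O rd) {ι : Type} (x : ι → K) (hx : ∀ i, x i ∈ O)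
    (h : AlgebraicIndependent ℂ (fun i => rd (x i))) :
    AlgebraicIndependent ℂ x ∧ ∀ y ∈ IntermediateField.adjoin ℂ (Set.range x), y ∈ O := by
  have key : ∀ p : MvPolynomial ι ℂ, p ≠ 0 → rd (aeval x p) ≠ 0 := by
    intro p hp h0
    rw [(R.rd_aeval x hx p).2] at h0
    exact hp ((algebraicIndependent_iff.1 h) p h0)
  constructor
  · rw [algebraicIndependent_iff]
    intro p hp
    by_contra hne
    exact key p hne (by rw [hp, R.rd_zero])
  · intro y hy
    rw [IntermediateField.mem_adjoin_range_iff] at hy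
    obtain ⟨p, q, rfl⟩ := hy
    by_cases hq : q = 0
    · simp [hq, zero_mem]
    · rw [div_eq_mul_inv]
      refine mul_mem (R.rd_aeval x hx p).1 ?_
      by_contra hcon
      exact key q hq (R.rd_inv _ (R.rd_aeval x hx q).1 hcon)

theorem indep_red (R : Place O rd) {ι : Type} (x : ι → K)
    (hx : ∀ y ∈ IntermediateField.adjoin ℂ (Set.range x), y ∈ O)
    (h : AlgebraicIndependent ℂ x) : AlgebraicIndependent ℂ (fun i => rd (x i)) := by
  have hx' : ∀ i, x i ∈ O := fun i => hx _ (IntermediateField.subset_adjoin _ _ ⟨i, rfl⟩)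
  rw [algebraicIndependent_iff]
  intro p hp
  by_contra hne
  rw [← (R.rd_aeval x hx' p).2] at hp
  have h0 : aeval x p ≠ 0 := fun h0 => hne (algebraicIndependent_iff.1 h p h0)
  have hm : aeval x p ∈ IntermediateField.adjoin ℂ (Set.range x) :=
    (IntermediateField.mem_adjoin_range_iff _ _ _).2 ⟨p, 1, by simp⟩
  exact R.rd_ne h0 (hx _ hm) (hx _ (inv_mem hm)) hp

end Place

section misc
variable {K : Type} [Field K] [Algebra ℂ K]

theorem Star.smul {P : Fin (n + 1) → Fin (n + 1) → K} {Q : ℕ}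
    {u θ : Fin (n + 1) → K} {η : Fin s → PR n →ₗ[ℂ] K} (h : Star d f P Q u θ η) (k : K) :
    Star d f P Q u (fun j => k * θ j) (fun i => k • η i) := by
  constructor
  · intro i e g hg he
    simp [h.deg i e g hg he]
  · intro i a b c g
    simp only [LinearMap.smul_apply, smul_eq_mul]
    linear_combination k * h.supp i a b c g
  · intro i k' g
    simp [h.van]
  · intro j g hg
    simp only [LinearMap.smul_apply, smul_eq_mul, ← Finset.mul_sum, h.kill j g hg]
    ring

theorem Adm.smul {P : Fin (n + 1) → Fin (n + 1) → K} {Q : ℕ}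
    {η : Fin s → PR n →ₗ[ℂ] K} (h : Adm d f P Q η) (k : K) : Adm d f P Q (fun i => k • η i) := by
  have := Star.smul h k
  simp only [Pi.zero_apply, mul_zero] at this
  exact this

theorem Star.scaleP {P : Fin (n + 1) → Fin (n + 1) → K} {Q : ℕ}
    {u θ : Fin (n + 1) → K} {η : Fin s → PR n →ₗ[ℂ] K} (h : Star d f P Q u θ η) (k : K) :
    Star d f (fun a b => k * P a b) Q u θ η := by
  refine ⟨h.deg, ?_, h.van, h.kill⟩
  intro i a b c g
  linear_combination k * h.supp i a b c g

theorem RRel.smul {P : Fin (n + 1) → Fin (n + 1) → K} {c : K}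
    {u : Fin (n + 1) → K} {η ξ : Fin s → PR n →ₗ[ℂ] K} (h : RRel P c u η ξ) (k : K) :
    RRel P (k * c) u η (fun i => k • ξ i) := by
  intro i a b g
  simp only [LinearMap.smul_apply, smul_eq_mul]
  linear_combination k * h i a b g

theorem sub_ev_gen (H : SmoothData n s d f) {P : Fin (n + 1) → Fin (n + 1) → K} {Q : ℕ} {c : K}
    {u θ θ' : Fin (n + 1) → K} {η ξ : Fin s → PR n →ₗ[ℂ] K}
    (h : Star d f P Q u θ ξ) (huP : ∀ a b c, P a b * u c - P a c * u b + P b c * u a = 0)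
    (huf : ∀ i, aeval u (f i) = 0) (hR : RRel P c u η ξ) (l : Fin s → K)
    (hl : ∀ j, θ j = θ' j + ∑ i, l i * aeval u (pderiv j (f i))) :
    ∃ ξ', Star d f P Q u θ' ξ' ∧ RRel P c u η ξ' := by
  refine ⟨fun i => ξ i - l i • (aeval u : PR n →ₐ[ℂ] K).toLinearMap ∘ₗ
      homogeneousComponent (d i + Q - 1), ?_, ?_⟩
  · constructor
    · intro i e g hg he
      have h2 := H.two_le i
      simp only [LinearMap.sub_apply, LinearMap.smul_apply, LinearMap.comp_apply]
      rw [h.deg i e g hg he, homogeneousComponent_of_mem hg, if_neg (by omega)]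
      simp
    · intro i a b c g
      have h2 := H.two_le i
      obtain ⟨e, he⟩ : ∃ e, d i + Q - 1 = e + 1 := ⟨d i + Q - 2, by omega⟩
      simp only [LinearMap.sub_apply, LinearMap.smul_apply, LinearMap.comp_apply, he, hshift,
        AlgHom.toLinearMap_apply, map_mul, aeval_X, smul_eq_mul]
      linear_combination h.supp i a b c g - l i * (aeval u (homogeneousComponent e g)) * huP a b c
    · intro i k g
      simp only [LinearMap.sub_apply, LinearMap.smul_apply, LinearMap.comp_apply, h.van,
        AlgHom.toLinearMap_apply]
      have : aeval u (homogeneousComponent (d i + Q - 1) (f k * g)) = 0 := by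
        conv_lhs => rw [← sum_homogeneousComponent g, Finset.mul_sum, map_sum, map_sum]
        refine Finset.sum_eq_zero fun e _ => ?_
        rw [homogeneousComponent_of_mem ((H.homog k).mul (homogeneousComponent_isHomogeneous e g))]
        split_ifs
        · rw [map_mul, huf, zero_mul]
        · simp
      rw [this]; simp
    · intro j g hg
      have h3 : ∀ i, homogeneousComponent (d i + Q - 1) (g * pderiv j (f i)) = g * pderiv j (f i) := by
        intro i
        have h2 := H.two_le i
        rw [homogeneousComponent_of_mem (hg.mul (H.homog i).pderiv), if_pos (by omega)]
      simp only [LinearMap.sub_apply, LinearMap.smul_apply, LinearMap.comp_apply, h3,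
        Finset.sum_sub_distrib, h.kill j g hg, hl, AlgHom.toLinearMap_apply, map_mul, smul_eq_mul,
        mul_add, Finset.mul_sum]
      rw [add_sub_assoc, ← Finset.sum_sub_distrib, Finset.sum_eq_zero fun i _ => by ring, add_zero]
  · intro i a b g
    have h2 := H.two_le i
    obtain ⟨e, he⟩ : ∃ e, d i + Q - 1 = e + 1 := ⟨d i + Q - 2, by omega⟩
    have := hR i a b g
    simp only [LinearMap.sub_apply, LinearMap.smul_apply, LinearMap.comp_apply, he, hshift,
        AlgHom.toLinearMap_apply, map_mul, aeval_X, smul_eq_mul]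
    linear_combination this

theorem ev_zero (H : SmoothData n s d f) {P : Fin (n + 1) → Fin (n + 1) → K} {Q : ℕ}
    {u : Fin (n + 1) → K} {η ξ : Fin s → PR n →ₗ[ℂ] K} (h : Adm d f P Q ξ)
    (hR : RRel P 0 u η ξ) {j0 : Fin (n + 1)} (h0 : u j0 = 1) (huf : ∀ i, aeval u (f i) = 0) :
    ξ = 0 := by
  have hu : u ≠ 0 := by rintro rfl; simp at h0
  have hev : ∀ i D g, g.IsHomogeneous D → ξ i g = aeval u g * ξ i (X j0 ^ D) := by
    intro i D g hg
    refine ev_lemma u j0 (ξ i) ?_ D g hg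
    intro c g
    have := hR i j0 c g
    rw [h0] at this
    linear_combination this
  have hl := jac_indep H u hu huf (fun i => ξ i (X j0 ^ (Q + (d i - 1)))) (by
    intro j
    have hq : ((X j0 : PR n) ^ Q).IsHomogeneous Q := isHomogeneous_X_pow j0 Q
    have := h.kill j _ hq
    simp only [Pi.zero_apply, mul_zero] at this
    rw [← this]
    refine Finset.sum_congr rfl fun i _ => ?_
    rw [hev i _ _ (hq.mul (H.homog i).pderiv), map_mul, map_pow (aeval u), aeval_X, h0]
    ring)
  funext i
  refine LinearMap.ext fun g => ?_
  have h2 := H.two_le i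
  rw [apply_comp (d i + Q - 1) (ξ i) (fun e g hg he => h.deg i e g hg (by omega)) g,
    hev i _ _ (homogeneousComponent_isHomogeneous _ _),
    show d i + Q - 1 = Q + (d i - 1) by omega]
  have := congrFun hl i
  simp only [Pi.zero_apply] at this
  rw [this]; simp

theorem on_comb {U V : Fin (n + 1) → K} (H : SmoothData n s d f) (on : ∀ i, phi U V (f i) = 0)
    (a b : K) (i) : aeval (fun c => a * U c + b * V c) (f i) = 0 := by
  have hp : phi (fun c => a * U c + b * V c) U (f i) = 0 := by
    refine Polynomial.eq_zero_of_infinite_isRoot _ (Set.Infinite.mono ?_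
      (Set.Infinite.diff (Set.infinite_univ (α := K)) (Set.finite_singleton (-a))))
    intro r hr
    have hr' : a + r ≠ 0 := fun h => hr.2 (by
      rw [Set.mem_singleton_iff]; linear_combination h)
    change Polynomial.eval r _ = 0
    rw [phi_eval]
    have := eval_scale (H.homog i) (a + r) (fun c => U c + (b / (a + r)) * V c)
    rw [on_eval on, mul_zero] at this
    rw [← this]
    congr 1
    congr 1
    funext c
    field_simp
    ring
  have := phi_eval (fun c => a * U c + b * V c) U 0 (f i)
  rw [hp] at this
  simpa using this.symm

/-- Normalizing a functional with respect to a valuation. -/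
theorem scale (O : ValuationSubring K) (hC : ∀ z : ℂ, algebraMap ℂ K z ∈ O)
    (ξ : Fin s → PR n →ₗ[ℂ] K) (hne : ξ ≠ 0) (D : Fin s → ℕ)
    (hD : ∀ i e h, h.IsHomogeneous e → e ≠ D i → ξ i h = 0) :
    ∃ μ ≠ 0, (∃ i g, ξ i g = μ) ∧ ∀ i g, μ⁻¹ * ξ i g ∈ O := by
  classical
  let y : (Σ i : Fin s, ↥(Finset.univ.finsuppAntidiag (D i) : Finset (Fin (n+1) →₀ ℕ))) → K :=
    fun p => ξ p.1 (monomial p.2.1 1)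
  have hexp : ∀ i g, ξ i g = ∑ v ∈ (homogeneousComponent (D i) g).support,
      algebraMap ℂ K (coeff v (homogeneousComponent (D i) g)) * ξ i (monomial v 1) := by
    intro i g
    rw [apply_comp (D i) (ξ i) (hD i) g]
    conv_lhs => rw [(homogeneousComponent (D i) g).as_sum, map_sum]
    refine Finset.sum_congr rfl fun v _ => ?_
    rw [← Algebra.smul_def, ← map_smul, smul_monomial, smul_eq_mul, mul_one]
  have hmem : ∀ i (g : PR n), ∀ v ∈ (homogeneousComponent (D i) g).support,
      v ∈ (Finset.univ.finsuppAntidiag (D i) : Finset (Fin (n+1) →₀ ℕ)) := by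
    intro i g v hv
    rw [Finset.mem_finsuppAntidiag]
    refine ⟨?_, Finset.subset_univ _⟩
    by_contra hcon
    rw [mem_support_iff] at hv
    apply hv
    apply (homogeneousComponent_isHomogeneous (D i) g).coeff_eq_zero
    rwa [Finsupp.degree_eq_sum]
  have hy : y ≠ 0 := by
    intro hy
    apply hne
    funext i
    refine LinearMap.ext fun g => ?_
    rw [hexp]
    refine Finset.sum_eq_zero fun v hv => ?_
    have := congrFun hy ⟨i, v, hmem i g v hv⟩
    simp only [y, Pi.zero_apply] at this
    rw [this, mul_zero]
  obtain ⟨p, hp0, hp⟩ := exists_max_val O y hy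
  refine ⟨y p, hp0, ⟨p.1, _, rfl⟩, fun i g => ?_⟩
  rw [hexp, Finset.mul_sum]
  refine sum_mem fun v hv => ?_
  have h1 := mul_mem (hC (coeff v (homogeneousComponent (D i) g))) (hp ⟨i, v, hmem i g v hv⟩)
  convert h1 using 1
  simp only [y, div_eq_mul_inv]; ring

end misc
end FanoAux

namespace FanoAux
set_option linter.unusedSectionVars false
open MvPolynomial
variable {n s : ℕ} {d : Fin s → ℕ} {f : Fin s → PR n}

theorem exists_sub_place {M K κ : Type} [Field M] [Algebra ℂ M] [Field K] [Algebra ℂ K] [Algebra M K]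
    [IsScalarTower ℂ M K] [Field κ] [Algebra ℂ κ] {O : ValuationSubring K} {rd : K → κ}
    (R : Place O rd) :
    ∃ (k : IntermediateField ℂ κ) (rdM : M → k), Place (O.comap (algebraMap M K)) rdM ∧
      (∀ a, algebraMap M K a ∈ O → (rdM a : κ) = rd (algebraMap M K a)) ∧
      ∀ z : k, ∃ a, algebraMap M K a ∈ O ∧ rdM a = z := by
  classical
  let A : Subalgebra ℂ κ :=
    { carrier := {z | ∃ a : M, algebraMap M K a ∈ O ∧ rd (algebraMap M K a) = z}
      mul_mem' := by
        rintro _ _ ⟨a, ha, rfl⟩ ⟨b, hb, rfl⟩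
        exact ⟨a * b, by rw [map_mul]; exact mul_mem ha hb, by rw [map_mul, R.rd_mul _ ha _ hb]⟩
      add_mem' := by
        rintro _ _ ⟨a, ha, rfl⟩ ⟨b, hb, rfl⟩
        exact ⟨a + b, by rw [map_add]; exact add_mem ha hb, by rw [map_add, R.rd_add _ ha _ hb]⟩
      algebraMap_mem' := by
        intro z
        refine ⟨algebraMap ℂ M z, ?_, ?_⟩
        · rw [← IsScalarTower.algebraMap_apply]; exact R.C_mem z
        · rw [← IsScalarTower.algebraMap_apply]; exact R.rd_C z }
  let k : IntermediateField ℂ κ := A.toIntermediateField (by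
    rintro _ ⟨a, ha, rfl⟩
    by_cases h0 : rd (algebraMap M K a) = 0
    · rw [h0, inv_zero]; exact zero_mem _
    · have hinv : (algebraMap M K a)⁻¹ ∈ O := by
        by_contra hcon
        exact h0 (R.rd_inv _ ha hcon)
      have hne : algebraMap M K a ≠ 0 := by
        intro h; rw [h, R.rd_zero] at h0; exact h0 rfl
      refine ⟨a⁻¹, by rw [map_inv₀]; exact hinv, ?_⟩
      rw [map_inv₀]
      refine eq_inv_of_mul_eq_one_left ?_
      rw [← R.rd_mul _ hinv _ ha, inv_mul_cancel₀ hne, R.rd_one])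
  have hk : ∀ a, algebraMap M K a ∈ O → rd (algebraMap M K a) ∈ k := fun a ha => ⟨a, ha, rfl⟩
  let rdM : M → k := fun a => if h : algebraMap M K a ∈ O then ⟨rd (algebraMap M K a), hk a h⟩ else 0
  have hrd : ∀ a, algebraMap M K a ∈ O → (rdM a : κ) = rd (algebraMap M K a) := by
    intro a ha; simp only [rdM, ha, dif_pos]
  refine ⟨k, rdM, ⟨?_, ?_, ?_, ?_, ?_⟩, hrd, ?_⟩
  · intro z
    rw [ValuationSubring.mem_comap, ← IsScalarTower.algebraMap_apply]; exact R.C_mem z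
  · intro z
    apply Subtype.ext
    have hz : algebraMap M K (algebraMap ℂ M z) ∈ O := by
      rw [← IsScalarTower.algebraMap_apply]; exact R.C_mem z
    rw [hrd _ hz, ← IsScalarTower.algebraMap_apply, R.rd_C]; rfl
  · intro a ha b hb
    rw [ValuationSubring.mem_comap] at ha hb
    apply Subtype.ext
    rw [hrd _ (by rw [map_add]; exact add_mem ha hb), map_add, R.rd_add _ ha _ hb, ← hrd _ ha,
      ← hrd _ hb]; rfl
  · intro a ha b hb
    rw [ValuationSubring.mem_comap] at ha hb
    apply Subtype.ext
    rw [hrd _ (by rw [map_mul]; exact mul_mem ha hb), map_mul, R.rd_mul _ ha _ hb, ← hrd _ ha,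
      ← hrd _ hb]; rfl
  · intro a ha hb
    rw [ValuationSubring.mem_comap] at ha hb
    apply Subtype.ext
    rw [hrd _ ha, R.rd_inv _ ha (by rwa [map_inv₀] at hb)]; rfl
  · rintro ⟨z, a, ha, rfl⟩
    exact ⟨a, ha, Subtype.ext (hrd a ha)⟩

theorem mem_of_adjoin_alg {M : Type} [Field M] [Algebra ℂ M] (O : ValuationSubring M)
    (E : IntermediateField ℂ M) (hE : ∀ y ∈ E, y ∈ O) (h : Algebra.IsAlgebraic E M) (y : M) : y ∈ O := by
  obtain ⟨p, hp, hy⟩ := (h.isAlgebraic y).isIntegral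
  let j : E →+* O := E.val.toRingHom.codRestrict O.toSubring (fun y => hE y y.2)
  have hi : IsIntegral O y := by
    refine ⟨p.map j, hp.map j, ?_⟩
    rw [Polynomial.eval₂_map]
    exact hy
  obtain ⟨z, hz⟩ := IsIntegrallyClosed.isIntegral_iff.1 hi
  rw [← hz]; exact z.2

theorem exists_indep_of_alg {κ : Type} [Field κ] [Algebra ℂ κ] (k : IntermediateField ℂ κ) {ι : Type}
    [Fintype ι] {m : ℕ} (hm : Fintype.card ι = m) (g : ι → κ) (hg : AlgebraicIndependent ℂ g)
    (ha : ∀ i, IsAlgebraic k (g i)) : ∃ x : Fin m → k, AlgebraicIndependent ℂ x := by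
  let A := (algebraicClosure k κ)
  let g' : ι → A := fun i => ⟨g i, mem_algebraicClosure_iff.2 (ha i)⟩
  have hg' : AlgebraicIndependent ℂ g' := by
    exact AlgebraicIndependent.of_comp ((A.val).restrictScalars ℂ) hg
  have h1 := hg'.cardinalMk_le_trdeg
  haveI : FaithfulSMul k A := (faithfulSMul_iff_algebraMap_injective k A).2 (algebraMap k A).injective
  have h2 := trdeg_add_eq ℂ k (A := A)
  haveI : Algebra.IsAlgebraic k A := algebraicClosure.isAlgebraic k κ
  rw [trdeg_eq_zero (R := k) (A := A), add_zero] at h2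
  rw [← h2] at h1
  obtain ⟨t, ht⟩ := exists_isTranscendenceBasis ℂ k
  rw [← ht.cardinalMk_eq_trdeg, Cardinal.mk_fintype, hm] at h1
  have h3 : Cardinal.mk (Fin m) ≤ Cardinal.mk t := by rwa [Cardinal.mk_fin]
  obtain ⟨e⟩ := h3
  exact ⟨_, ht.1.comp e e.injective⟩

theorem place_full {M κ : Type} [Field M] [Algebra ℂ M] [Field κ] [Algebra ℂ κ]
    (k : IntermediateField ℂ κ) {O : ValuationSubring M} {rd : M → k} (R : Place O rd)
    (hs : ∀ z : k, ∃ a ∈ O, rd a = z)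
    {ι : Type} [Fintype ι] {m : ℕ} (hm : Fintype.card ι = m) (g : ι → κ)
    (hg : AlgebraicIndependent ℂ g)
    (ha : ∀ i, IsAlgebraic k (g i)) (hx : ∃ x : Fin m → M, IsTranscendenceBasis ℂ x) (y : M) :
    y ∈ O := by
  obtain ⟨z, hz⟩ := exists_indep_of_alg k hm g hg ha
  choose a ha1 ha2 using fun i => hs (z i)
  have hz' : AlgebraicIndependent ℂ (fun i => rd (a i)) := by
    simpa only [ha2] using hz
  obtain ⟨h1, h2⟩ := R.indep_lift a ha1 hz'
  obtain ⟨x, hx⟩ := hx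
  have h3 : IsTranscendenceBasis ℂ a := by
    refine AlgebraicIndependent.isTranscendenceBasis_of_trdeg_le_of_finite h1 ?_
    rw [← hx.cardinalMk_eq_trdeg]
  exact mem_of_adjoin_alg O _ h2 h3.isAlgebraic_field y
end FanoAux

namespace FanoAux
set_option linter.unusedSectionVars false
open MvPolynomial
variable {n s : ℕ} {d : Fin s → ℕ} {f : Fin s → PR n}

/-- The new frame with pivots `j0, j1`. -/
def frU {M : Type} [Field M] (U V : Fin (n+1) → M) (j0 j1 : Fin (n+1)) (c : Fin (n+1)) : M :=
  (plu U V j0 j1)⁻¹ * plu U V c j1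

def frV {M : Type} [Field M] (U V : Fin (n+1) → M) (j0 j1 : Fin (n+1)) (c : Fin (n+1)) : M :=
  (plu U V j0 j1)⁻¹ * plu U V j0 c

section fr
variable {M : Type} [Field M] [Algebra ℂ M] {U V : Fin (n+1) → M} {j0 j1 : Fin (n+1)}

theorem fr_frame (h : plu U V j0 j1 ≠ 0) : Frame (frU U V j0 j1) (frV U V j0 j1) j0 j1 := by
  constructor
  · exact inv_mul_cancel₀ h
  · simp [frU, plu]
  · simp [frV, plu]
  · exact inv_mul_cancel₀ h

theorem fr_plu (h : plu U V j0 j1 ≠ 0) (a b) : plu (frU U V j0 j1) (frV U V j0 j1) a b =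
    (plu U V j0 j1)⁻¹ * plu U V a b := by
  have : plu (frU U V j0 j1) (frV U V j0 j1) a b * (plu U V j0 j1) ^ 2
     = plu U V j0 j1 * plu U V a b := by
    have h2 : ∀ c, frU U V j0 j1 c * plu U V j0 j1 = plu U V c j1 := by
      intro c; rw [frU]; field_simp
    have h3 : ∀ c, frV U V j0 j1 c * plu U V j0 j1 = plu U V j0 c := by
      intro c; rw [frV]; field_simp
    have : plu (frU U V j0 j1) (frV U V j0 j1) a b * (plu U V j0 j1) ^ 2 =
      plu U V a j1 * plu U V j0 b - plu U V b j1 * plu U V j0 a := by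
      rw [← h2 a, ← h2 b, ← h3 a, ← h3 b]
      change (frU U V j0 j1 a * frV U V j0 j1 b - frU U V j0 j1 b * frV U V j0 j1 a) * _ = _
      ring
    rw [this]; simp only [plu]; ring
  rw [← mul_right_inj' (pow_ne_zero 2 h), mul_comm, this]
  field_simp

theorem fr_on (H : SmoothData n s d f) (on : ∀ i, phi U V (f i) = 0) (r : M) (i) :
    aeval (fun c => frU U V j0 j1 c + r * frV U V j0 j1 c) (f i) = 0 := by
  have := on_comb H on ((plu U V j0 j1)⁻¹ * (V j1 - r * V j0))
    ((plu U V j0 j1)⁻¹ * (- U j1 + r * U j0)) i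
  rw [← this]
  congr 2
  funext c
  simp only [frU, frV]
  generalize (plu U V j0 j1)⁻¹ = δ
  simp only [plu]; ring

end fr

namespace Setup
variable {M : Type} {K : Type} [Field M] [Algebra ℂ M] [Field K] [Algebra ℂ K] [Algebra M K]
    [IsScalarTower ℂ M K] {U V : Fin (n+1) → M}
    {i0 i1 : Fin (n+1)} {q : ℕ} {η : Fin s → PR n →ₗ[ℂ] M} {m : ℕ} {ρ : K}

theorem caseA (S : Setup d f U V i0 i1 q η m ρ) {κ : Type} [Field κ] [Algebra ℂ κ]
    {O : ValuationSubring K} {rd : K → κ} (R : Place O rd) (hM : ∀ a : M, algebraMap M K a ∈ O)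
    (ξ : Fin s → PR n →ₗ[ℂ] κ) (hne : ξ ≠ 0)
    (hξ : Adm d f (fun a b => rd (plu (exv K U) (exv K V) a b)) (q + 1) ξ) : False := by
  let σ : M →ₐ[ℂ] κ :=
    { toFun := fun a => rd (algebraMap M K a)
      map_one' := by rw [map_one, R.rd_one]
      map_zero' := by rw [map_zero, R.rd_zero]
      map_mul' := fun a b => by rw [map_mul, R.rd_mul _ (hM a) _ (hM b)]
      map_add' := fun a b => by rw [map_add, R.rd_add _ (hM a) _ (hM b)]
      commutes' := fun z => by rw [← IsScalarTower.algebraMap_apply, R.rd_C] }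
  rw [plu_ext] at hξ
  obtain ⟨η', h1, h2⟩ := adm_descend σ hne hξ
  exact h1 (S.max η' h2)

theorem caseB (S : Setup d f U V i0 i1 q η m ρ) {κ : Type} [Field κ] [Algebra ℂ κ]
    {O : ValuationSubring K} {rd : K → κ} (R : Place O rd)
    (hu : ∀ c, gpt U V ρ c ∈ O) (hui : ∀ c, (gpt U V ρ c)⁻¹ ∈ O)
    {θ : Fin (n+1) → K} (hθ : ∀ c, θ c ∈ O) (hθ0 : ∀ c, rd (θ c) = 0)
    (ξ : Fin s → PR n →ₗ[ℂ] K) (hξO : ∀ i g, ξ i g ∈ O) (hξ1 : ∃ i g, ξ i g = 1)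
    (hξ : Star d f (plu (exv K U) (exv K V)) (q + 1) (gpt U V ρ) θ ξ) {c : K}
    (hR : RRel (plu (exv K U) (exv K V)) c (gpt U V ρ)
      (fun i => (sg M K).toLinearMap ∘ₗ η i) ξ)
    {ι : Type} [Fintype ι] (hι : Fintype.card ι = m) (g : ι → K) (hg : AlgebraicIndependent ℂ g)
    (hgO : ∀ y ∈ IntermediateField.adjoin ℂ (Set.range g), y ∈ O)
    (hgt : ∀ i, (∃ c, g i = gpt U V ρ c) ∨ ∃ a : M, g i = algebraMap M K a) (a : M) :
    algebraMap M K a ∈ O := by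
  classical
  obtain ⟨k, rdM, RM, hrdM, hsurj⟩ := exists_sub_place (M := M) R
  -- pivots
  obtain ⟨⟨j0, j1⟩, hδ0, hδ⟩ := exists_max_val (O.comap (algebraMap M K))
    (fun p : Fin (n+1) × Fin (n+1) => plu U V p.1 p.2) (by
      intro h
      have := congrFun h (i0, i1)
      simp [plu, S.fr.U0, S.fr.V0, S.fr.U1, S.fr.V1] at this)
  simp only at hδ0 hδ
  set δ := plu U V j0 j1 with hδd
  set U' := frU U V j0 j1 with hU'
  set V' := frV U V j0 j1 with hV'
  have hP' : ∀ a b, plu U' V' a b ∈ O.comap (algebraMap M K) := by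
    intro a b
    rw [fr_plu hδ0, inv_mul_eq_div]; exact hδ (a, b)
  have hUO : ∀ c, U' c ∈ O.comap (algebraMap M K) := by
    intro c; rw [hU', frU, inv_mul_eq_div]; exact hδ (c, j1)
  have hVO : ∀ c, V' c ∈ O.comap (algebraMap M K) := by
    intro c; rw [hV', frV, inv_mul_eq_div]; exact hδ (j0, c)
  have hfr' : Frame U' V' j0 j1 := fr_frame hδ0
  -- scaling of eta
  obtain ⟨μ, hμ0, ⟨iμ, gμ, hμ⟩, hμO⟩ := scale (O.comap (algebraMap M K)) RM.C_mem η S.ne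
    (fun i => d i + q - 1) (fun i e h hh he => S.adm.deg i e h hh (by
      have := S.H.two_le i; omega))
  let η0 : Fin s → PR n →ₗ[ℂ] M := fun i => μ⁻¹ • η i
  have hη0O : ∀ i g, η0 i g ∈ O.comap (algebraMap M K) := hμO
  have hη0a : Adm d f (plu U' V') q η0 := by
    have := (S.adm.smul μ⁻¹).scaleP δ⁻¹
    have e : plu U' V' = fun a b => δ⁻¹ * plu U V a b := by
      funext a b; exact fr_plu hδ0 a b
    rw [e]; exact this
  let ηb : Fin s → PR n →ₗ[ℂ] k := fun i => RM.redMap (η0 i) (hη0O i)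
  have hpluM : (fun a b => rdM (plu U' V' a b)) = plu (fun c => rdM (U' c)) (fun c => rdM (V' c)) := by
    funext a b
    simp only [plu]
    rw [RM.rd_sub (mul_mem (hUO _) (hVO _)) (mul_mem (hUO _) (hVO _)), RM.rd_mul _ (hUO _) _ (hVO _),
      RM.rd_mul _ (hUO _) _ (hVO _)]
  have hηba : Adm d f (plu (fun c => rdM (U' c)) (fun c => rdM (V' c))) q ηb := by
    have := RM.star hη0a hP' (fun _ => zero_mem _) (fun _ => zero_mem _) hη0O
    simp only [Pi.zero_apply, RM.rd_zero] at this
    rw [hpluM] at this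
    exact this
  have hηb1 : ηb iμ gμ = 1 := by
    change rdM (μ⁻¹ * η iμ gμ) = 1
    rw [hμ, inv_mul_cancel₀ hμ0, RM.rd_one]
  have hηb0 : ηb ≠ 0 := by
    intro h
    rw [h] at hηb1
    simp at hηb1
  have hfrb : Frame (fun c => rdM (U' c)) (fun c => rdM (V' c)) j0 j1 := by
    constructor
    · rw [hfr'.U0, RM.rd_one]
    · rw [hfr'.U1, RM.rd_zero]
    · rw [hfr'.V0, RM.rd_zero]
    · rw [hfr'.V1, RM.rd_one]
  have honb : ∀ i, phi (fun c => rdM (U' c)) (fun c => rdM (V' c)) (f i) = 0 := by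
    intro i
    refine poly_zero_of_complex _ fun r => ?_
    rw [phi_eval]
    have h1 : ∀ c, U' c + algebraMap ℂ M r * V' c ∈ O.comap (algebraMap M K) := fun c =>
      add_mem (hUO c) (mul_mem (RM.C_mem r) (hVO c))
    have h2 := (RM.rd_aeval _ h1 (f i)).2
    rw [fr_on S.H S.on, RM.rd_zero] at h2
    rw [h2]
    congr 2
    funext c
    rw [RM.rd_add _ (hUO c) _ (mul_mem (RM.C_mem r) (hVO c)), RM.rd_mul _ (RM.C_mem r) _ (hVO c),
      RM.rd_C]
  -- over K
  have hδK : algebraMap M K δ ≠ 0 := by simpa using hδ0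
  have hμK : algebraMap M K μ ≠ 0 := by simpa using hμ0
  let PK : Fin (n+1) → Fin (n+1) → K := fun a b => algebraMap M K (plu U' V' a b)
  have hPK : ∀ a b, plu (exv K U) (exv K V) a b = algebraMap M K δ * PK a b := by
    intro a b
    have := congrFun (congrFun (plu_ext (K := K) (U := U) (V := V)) a) b
    rw [this]
    change algebraMap M K (plu U V a b) = _
    simp only [PK]
    rw [fr_plu hδ0, ← map_mul, mul_inv_cancel_left₀ hδ0]
  let ηK0 : Fin s → PR n →ₗ[ℂ] K := fun i => (sg M K).toLinearMap ∘ₗ η0 i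
  have hηK0 : ∀ i g, algebraMap M K (η i g) = algebraMap M K μ * ηK0 i g := by
    intro i g
    change _ = _ * algebraMap M K (μ⁻¹ * η i g)
    rw [← map_mul, mul_inv_cancel_left₀ hμ0]
  let c' := c * algebraMap M K δ * algebraMap M K μ
  have hR' : RRel PK c' (gpt U V ρ) ηK0 ξ := by
    intro i a b g
    have := hR i a b g
    rw [this, hPK]
    change _ * algebraMap M K (η i g) = _
    rw [hηK0]
    simp only [c']; ring
  have hξ' : Star d f PK (q+1) (gpt U V ρ) θ ξ := by
    have := hξ.scaleP (algebraMap M K δ)⁻¹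
    have e : PK = fun a b => (algebraMap M K δ)⁻¹ * plu (exv K U) (exv K V) a b := by
      funext a b; rw [hPK, inv_mul_cancel_left₀ hδK]
    rw [e]; exact this
  have hPK1 : PK j0 j1 = 1 := by
    simp only [PK]
    rw [fr_plu hδ0, inv_mul_cancel₀ hδ0, map_one]
  have hηK1 : ηK0 iμ gμ = 1 := by
    change algebraMap M K (μ⁻¹ * η iμ gμ) = 1
    rw [hμ, inv_mul_cancel₀ hμ0, map_one]
  have hc'O : c' ∈ O := by
    have := hR' iμ j0 j1 gμ
    rw [hPK1, hηK1, mul_one, mul_one] at this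
    rw [← this]
    exact sub_mem (mul_mem (hu _) (hξO _ _)) (mul_mem (hu _) (hξO _ _))
  have hηKO : ∀ i g, ηK0 i g ∈ O := hη0O
  -- reduce
  let ξb : Fin s → PR n →ₗ[ℂ] κ := fun i => R.redMap (ξ i) (hξO i)
  have hξb0 : ξb ≠ 0 := by
    obtain ⟨i, g, h1⟩ := hξ1
    intro h
    have h2 : ξb i g = 1 := by
      change rd (ξ i g) = 1
      rw [h1, R.rd_one]
    rw [h] at h2
    simp at h2
  have hplub : (fun a b => rd (PK a b)) = plu (fun c => k.val (rdM (U' c))) (fun c => k.val (rdM (V' c))) := by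
    funext a b
    have h1 := congrFun (congrFun hpluM a) b
    have h2 := hrdM _ (hP' a b)
    rw [h1] at h2
    rw [← h2]
    simp [plu]
  have hξba : Adm d f (plu (fun c => k.val (rdM (U' c))) (fun c => k.val (rdM (V' c)))) (q+1) ξb := by
    have := R.star hξ' hP' hu hθ hξO
    rw [hplub] at this
    refine Star.adm (u := fun c => rd (gpt U V ρ c)) ?_
    convert this using 1
    funext c; exact (hθ0 c).symm
  have hRb := R.rrel hR' hc'O hP' hu hηKO hξO
  rw [hplub] at hRb
  have hηe : (fun i => R.redMap (ηK0 i) (hηKO i)) = fun i => k.val.toLinearMap ∘ₗ ηb i := by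
    funext i
    refine LinearMap.ext fun g => ?_
    change rd (algebraMap M K (η0 i g)) = ((rdM (η0 i g) : k) : κ)
    rw [hrdM _ (hη0O i g)]
  rw [hηe] at hRb
  set ub : Fin (n+1) → κ := fun c => rd (gpt U V ρ c) with hub
  have hub0 : ub i0 = 1 := by
    simp only [hub]; rw [S.u_i0, R.rd_one]
  have hubf : ∀ i, aeval ub (f i) = 0 := by
    intro i
    rw [hub, ← (R.rd_aeval _ hu (f i)).2, S.huf, R.rd_zero]
  have hc0 : rd c' ≠ 0 := by
    intro h0
    rw [h0] at hRb
    exact hξb0 (ev_zero S.H hξba hRb hub0 hubf)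
  have hubc : ∀ c, ub c = ub j0 * k.val (rdM (U' c)) + ub j1 * k.val (rdM (V' c)) := by
    intro c
    have h1 : gpt U V ρ c = gpt U V ρ j0 * algebraMap M K (U' c) + gpt U V ρ j1 * algebraMap M K (V' c) := by
      have h2 : plu (exv K U) (exv K V) j0 j1 * gpt U V ρ c - plu (exv K U) (exv K V) j0 c * gpt U V ρ j1
          + plu (exv K U) (exv K V) j1 c * gpt U V ρ j0 = 0 := plu_u (exv K U) (exv K V) ρ j0 j1 c
      rw [← mul_right_inj' hδK]
      have e1 : algebraMap M K δ * algebraMap M K (U' c) = plu (exv K U) (exv K V) c j1 := by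
        rw [hU', frU, ← map_mul, ← hδd, mul_inv_cancel_left₀ hδ0]
        exact (congrFun (congrFun (plu_ext (K := K) (U := U) (V := V)) c) j1).symm
      have e2 : algebraMap M K δ * algebraMap M K (V' c) = plu (exv K U) (exv K V) j0 c := by
        rw [hV', frV, ← map_mul, ← hδd, mul_inv_cancel_left₀ hδ0]
        exact (congrFun (congrFun (plu_ext (K := K) (U := U) (V := V)) j0) c).symm
      have e3 : algebraMap M K δ = plu (exv K U) (exv K V) j0 j1 :=
        (congrFun (congrFun (plu_ext (K := K) (U := U) (V := V)) j0) j1).symm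
      have e4 : plu (exv K U) (exv K V) j1 c = - plu (exv K U) (exv K V) c j1 := by
        simp only [plu]; ring
      rw [e4] at h2
      linear_combination h2 + gpt U V ρ c * e3 - gpt U V ρ j0 * e1 - gpt U V ρ j1 * e2
    simp only [hub]
    conv_lhs => rw [h1]
    rw [R.rd_add _ (mul_mem (hu _) (hUO c)) _ (mul_mem (hu _) (hVO c)), R.rd_mul _ (hu _) _ (hUO c),
      R.rd_mul _ (hu _) _ (hVO c)]
    simp only [IntermediateField.coe_val]
    rw [hrdM _ (hUO c), hrdM _ (hVO c)]
  have hubj : ub j0 ≠ 0 := by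
    refine R.rd_ne ?_ (hu _) (hui _)
    intro h0
    have hV0 : V j0 = 0 := by
      by_contra hne
      apply S.tr
      have : ρ = algebraMap M K (-U j0 / V j0) := by
        have hne' : algebraMap M K (V j0) ≠ 0 := by simpa using hne
        rw [map_div₀, map_neg, eq_div_iff hne']
        have : algebraMap M K (U j0) + ρ * algebraMap M K (V j0) = 0 := h0
        linear_combination this
      rw [this]
      exact isAlgebraic_algebraMap _
    have hU0 : U j0 = 0 := by
      have : algebraMap M K (U j0) + ρ * algebraMap M K (V j0) = 0 := h0
      simpa [hV0] using this
    exact hδ0 (by simp [hδd, plu, hU0, hV0])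
  let ρ' := ub j1 / ub j0
  have hρ' : IsAlgebraic k ρ' := by
    by_contra htr
    refine lemmaZ S.H hfrb honb hηb0 hηba k.val ρ' ?_ (ξ := fun i => (ub j0 / rd c') • ξb i)
      (hξba.smul _) ?_
    · intro p hp
      by_contra hp0
      exact htr ⟨p, hp0, hp⟩
    · intro i a b g
      have := hRb i a b g
      simp only [LinearMap.smul_apply, smul_eq_mul]
      have hv : ∀ c, k.val (rdM (U' c)) + ρ' * k.val (rdM (V' c)) = ub c / ub j0 := by
        intro c
        rw [hubc c]; simp only [ρ']; field_simp
      rw [hv, hv]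
      field_simp
      field_simp at this
      linear_combination this
  have hkalg : ∀ z : k, IsAlgebraic k (k.val z) := fun z => isAlgebraic_algebraMap z
  have hw : ∀ c, IsAlgebraic k (k.val (rdM (U' c)) + ρ' * k.val (rdM (V' c))) := fun c =>
    (hkalg _).add (hρ'.mul (hkalg _))
  have huw : ∀ c, ub c = ub j0 * (k.val (rdM (U' c)) + ρ' * k.val (rdM (V' c))) := by
    intro c
    conv_lhs => rw [hubc c]
    simp only [ρ']; field_simp
  have huj : IsAlgebraic k (ub j0) := by
    have h1 := huw i0
    rw [hub0] at h1
    rw [eq_inv_of_mul_eq_one_left h1.symm]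
    exact (hw i0).inv
  have hua : ∀ c, IsAlgebraic k (ub c) := fun c => by
    rw [huw c]; exact huj.mul (hw c)
  refine place_full k RM (fun z => ?_) hι (fun i => rd (g i)) (R.indep_red g hgO hg) (fun i => ?_)
    S.bas a
  · obtain ⟨a, h1, h2⟩ := hsurj z
    exact ⟨a, h1, h2⟩
  · rcases hgt i with ⟨c, hc⟩ | ⟨a, ha⟩
    · rw [hc]; exact hua c
    · have : algebraMap M K a ∈ O := by
        rw [← ha]; exact hgO _ (IntermediateField.subset_adjoin _ _ ⟨i, rfl⟩)
      rw [ha, ← hrdM a this]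
      exact hkalg _

theorem claim (S : Setup d f U V i0 i1 q η m ρ) 
    (O : ValuationSubring K) (hC : ∀ z : ℂ, algebraMap ℂ K z ∈ O)
    (hu : ∀ c, gpt U V ρ c ∈ O) (hui : ∀ c, (gpt U V ρ c)⁻¹ ∈ O)
    {θ : Fin (n+1) → K} (hθ : ∀ c, θ c ∈ O)
    (ξ : Fin s → PR n →ₗ[ℂ] K)
    (hξ : Star d f (plu (exv K U) (exv K V)) (q + 1) (gpt U V ρ) θ ξ) {c : K}
    (hR : RRel (plu (exv K U) (exv K V)) c (gpt U V ρ)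
      (fun i => (sg M K).toLinearMap ∘ₗ η i) ξ)
    {ι : Type} [Fintype ι] (hι : Fintype.card ι = m) (g : ι → K) (hg : AlgebraicIndependent ℂ g)
    (hgO : ∀ y ∈ IntermediateField.adjoin ℂ (Set.range g), y ∈ O)
    (hgt : ∀ i, (∃ c, g i = gpt U V ρ c) ∨ ∃ a : M, g i = algebraMap M K a) :
    ∀ i h, ξ i h ∈ O := by
  by_contra hcon
  push Not at hcon
  obtain ⟨i2, h2, hcon⟩ := hcon
  have hne : ξ ≠ 0 := by
    rintro rfl
    exact hcon (by simp [zero_mem])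
  obtain ⟨μ, hμ0, ⟨iμ, gμ, hμ⟩, hμO⟩ := scale O hC ξ hne
    (fun i => d i + (q+1) - 1) (fun i e h hh he => hξ.deg i e h hh (by
      have := S.H.two_le i; omega))
  have hμn : μ ∉ O := by
    intro h
    apply hcon
    have := mul_mem h (hμO i2 h2)
    rwa [mul_inv_cancel_left₀ hμ0] at this
  have hμi : μ⁻¹ ∈ O := (O.mem_or_inv_mem μ).resolve_left hμn
  obtain ⟨κ, _, _, rd, R⟩ := exists_place O hC
  have hrμ : rd μ⁻¹ = 0 := R.rd_inv _ hμi (by rwa [inv_inv])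
  have hθ' : ∀ c, μ⁻¹ * θ c ∈ O := fun c => mul_mem hμi (hθ c)
  have hθ0 : ∀ c, rd (μ⁻¹ * θ c) = 0 := fun c => by
    rw [R.rd_mul _ hμi _ (hθ c), hrμ, zero_mul]
  have hM := S.caseB R hu hui hθ' hθ0 (fun i => μ⁻¹ • ξ i) hμO
    ⟨iμ, gμ, by simp [hμ, hμ0]⟩ (hξ.smul μ⁻¹) (hR.smul μ⁻¹) hι g hg hgO hgt
  have hP : ∀ a b, plu (exv K U) (exv K V) a b ∈ O := by
    intro a b; rw [plu_ext]; exact hM _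
  have h5 := R.star (hξ.smul μ⁻¹) hP hu hθ' hμO
  refine S.caseA R hM (fun i => R.redMap (μ⁻¹ • ξ i) (hμO i)) ?_ (Star.adm (u := fun c => rd (gpt U V ρ c)) ?_)
  · intro h
    have h3 : rd (μ⁻¹ * ξ iμ gμ) = 0 := congrArg (fun z : Fin s → PR n →ₗ[ℂ] κ => z iμ gμ) h
    rw [hμ, inv_mul_cancel₀ hμ0, R.rd_one] at h3
    exact one_ne_zero h3
  · convert h5 using 1
    funext c; exact (hθ0 c).symm

end Setup
end FanoAux

namespace FanoAux
set_option linter.unusedSectionVars false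
open MvPolynomial
variable {n s : ℕ} {d : Fin s → ℕ} {f : Fin s → PR n}

theorem exists_not_span {K0 : Type} [Field K0] {n s r : ℕ} (hcard : s + 1 + r = n)
    (a : Option (Fin r) → Fin (n+1) → K0) (w : Fin s → Fin (n+1) → K0) :
    ∃ θ : Fin (n+1) → K0, (∀ t, ∑ j, θ j * a t j = 0) ∧
      ¬ ∃ l : Fin s → K0, ∀ j, θ j = ∑ i, l i * w i j := by
  by_contra hcon
  push Not at hcon
  let L : (Fin (n+1) → K0) →ₗ[K0] (Option (Fin r) → K0) :=
    LinearMap.pi (fun t => ∑ j, (a t j) • LinearMap.proj j)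
  have hL : ∀ θ t, L θ t = ∑ j, θ j * a t j := by
    intro θ t
    simp [L, mul_comm]
  have h1 := L.finrank_range_add_finrank_ker
  have h2 : Module.finrank K0 (LinearMap.range L) ≤ r + 1 := by
    refine (Submodule.finrank_le _).trans ?_
    simp
  have h3 : LinearMap.ker L ≤ Submodule.span K0 (Set.range w) := by
    intro θ hθ
    obtain ⟨l, hl⟩ := hcon θ (fun t => by rw [← hL]; rw [LinearMap.mem_ker] at hθ; rw [hθ]; rfl)
    have : θ = ∑ i, l i • w i := by
      funext j; rw [hl j]; simp [Finset.sum_apply]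
    rw [this]
    exact Submodule.sum_mem _ fun i _ => Submodule.smul_mem _ _ (Submodule.subset_span ⟨i, rfl⟩)
  have h4 := Submodule.finrank_mono h3
  have h5 : Module.finrank K0 (Submodule.span K0 (Set.range w)) ≤ s := by
    have := finrank_range_le_card (R := K0) w
    simpa [Set.finrank] using this
  simp at h1
  omega

theorem Tan.exists_theta {K : Type} [Field K] [Algebra ℂ K] {u : Fin (n+1) → K} {i0 i1 : Fin (n+1)}
    {r : ℕ} {jj : Fin r → Fin (n+1)} {t0 : Fin r}
    {u0 : Fin (n+1) → IntermediateField.adjoin ℂ (Set.range u)}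
    {y : Fin r → Fin (n+1) → IntermediateField.adjoin ℂ (Set.range u)}
    (T : Tan u i0 i1 jj t0 u0 y) (hcard : s + 1 + r = n) (f : Fin s → PR n) :
    ∃ θ : Fin (n+1) → IntermediateField.adjoin ℂ (Set.range u),
      (∀ t, ∑ j, (θ j : K) * (y t j : K) = 0) ∧ (∑ j, (θ j : K) * u j = 0) ∧
      ¬ ∃ l : Fin s → K, ∀ j, (θ j : K) = ∑ i, l i * aeval u (pderiv j (f i)) := by
  obtain ⟨θ, h1, h2⟩ := exists_not_span hcard (fun t => t.elim u0 y)
    (fun i j => aeval u0 (pderiv j (f i)))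
  refine ⟨θ, fun t => ?_, ?_, ?_⟩
  · have := congrArg (algebraMap _ K) (h1 (some t))
    simpa [map_sum] using this
  · have := congrArg (algebraMap _ K) (h1 none)
    simpa [map_sum, T.hu0] using this
  · rintro ⟨l, hl⟩
    obtain ⟨ψ, hψ⟩ := LinearMap.exists_leftInverse_of_injective
      (Algebra.linearMap (IntermediateField.adjoin ℂ (Set.range u)) K)
      (LinearMap.ker_eq_bot.mpr (algebraMap (IntermediateField.adjoin ℂ (Set.range u)) K).injective)
    refine h2 ⟨fun i => ψ (l i), fun j => ?_⟩
    have e := congrArg ψ (hl j)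
    have hψ' : ∀ z : IntermediateField.adjoin ℂ (Set.range u), ψ (z : K) = z :=
      fun z => LinearMap.congr_fun hψ z
    rw [hψ', map_sum] at e
    rw [e]
    refine Finset.sum_congr rfl fun i _ => ?_
    rw [← T.aeval_coe, mul_comm, mul_comm (ψ _)]
    exact ψ.map_smul (aeval u0 (pderiv j (f i))) (l i)

/-- Transcendence of one basis element over the field generated by the others. -/
theorem tb_transcendental {F K ι : Type} [Field F] [Field K] [Algebra F K] (x : ι → K)
    (hx : AlgebraicIndependent F x) (i : ι) :
    Transcendental (IntermediateField.adjoin F (x '' {j | j ≠ i})) (x i) := by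
  have h := hx.transcendental_adjoin (s := {j | j ≠ i}) (i := i) (by simp)
  intro hal
  apply h
  exact (IntermediateField.isAlgebraic_adjoin_iff (F := F) (E := K)).mp hal

namespace Setup
variable {M : Type} {K : Type} [Field M] [Algebra ℂ M] [Field K] [Algebra ℂ K] [Algebra M K]
    [IsScalarTower ℂ M K] {U V : Fin (n+1) → M}
    {i0 i1 : Fin (n+1)} {q : ℕ} {η : Fin s → PR n →ₗ[ℂ] M} {m : ℕ} {ρ : K}
    {r : ℕ} {jj : Fin r → Fin (n+1)} {t0 : Fin r}
    {u0 : Fin (n+1) → IntermediateField.adjoin ℂ (Set.range (gpt U V ρ))}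
    {y : Fin r → Fin (n+1) → IntermediateField.adjoin ℂ (Set.range (gpt U V ρ))}

theorem case2 (S : Setup d f U V i0 i1 q η m ρ) (T : Tan (gpt U V ρ) i0 i1 jj t0 u0 y)
    (hcard : s + 1 + r = n) (hm : 2 * n ≤ m + ∑ i, d i + s + 1) (hn : ∑ i, d i ≤ n) : False := by
  obtain ⟨θ, hθy, hθu, hθn⟩ := T.exists_theta hcard f
  have hal : ∀ t, ∑ j, S.al j * (y t j : K) = 0 := by
    intro t
    obtain ⟨D, hD⟩ := T.der t
    rw [← S.al_der D]
    exact Finset.sum_congr rfl fun j _ => by rw [hD]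
  obtain ⟨c, l, hcl⟩ := T.span_of_card S.H S.huf (fun j => (θ j : K)) hθy hθu hθn hcard S.al hal S.al_u
  have hc : c ≠ 0 := by
    rintro rfl
    exact S.al_ns ⟨l, fun j => by rw [hcl j]; simp⟩
  obtain ⟨ξ1, hξ1, hR1⟩ := divide S.H S.frK S.onK S.admK ρ
  obtain ⟨ξ2, hξ2, hR2⟩ := sub_ev_gen S.H hξ1 (plu_u _ _ ρ) S.huf hR1 l hcl
  have hξ := hξ2.smul c⁻¹
  have hR := hR2.smul c⁻¹
  obtain ⟨ξ, hξe⟩ : ∃ ξ : Fin s → PR n →ₗ[ℂ] K, ξ = fun i => c⁻¹ • ξ2 i := ⟨_, rfl⟩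
  rw [← hξe] at hξ hR
  have hθc : (fun j => c⁻¹ * (c * (θ j : K))) = fun j => (θ j : K) := by
    funext j; field_simp
  rw [hθc] at hξ
  obtain ⟨xK, hxK⟩ := S.basK
  -- a coordinate transcendental over K0
  have hcs : ∃ cs, Transcendental (IntermediateField.adjoin ℂ (Set.range (gpt U V ρ))) (exv K V cs) := by
    by_contra hcon
    simp only [Transcendental, not_exists, not_not] at hcon
    have h1 := num1 T.basis hxK (ι := Empty) (fun e => e.elim) (by
      have hA := S.alg_of_V (IntermediateField.adjoin _ (Set.range (exv K V)))
        (fun c => IntermediateField.subset_adjoin _ _ ⟨c, rfl⟩)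
      have hB := IntermediateField.isAlgebraic_adjoin_iff_isAlgebraic (F :=
        IntermediateField.adjoin ℂ (Set.range (gpt U V ρ))) (E := K) (S := Set.range (exv K V))
      have hB' := hB.mpr (by rintro _ ⟨c, rfl⟩; exact hcon c)
      have hC : Algebra.IsAlgebraic (IntermediateField.adjoin ℂ (Set.range (gpt U V ρ))) K :=
        Algebra.IsAlgebraic.trans _ (IntermediateField.adjoin
          (IntermediateField.adjoin ℂ (Set.range (gpt U V ρ))) (Set.range (exv K V))) K
      exact Algebra.IsAlgebraic.tower_top (K := IntermediateField.adjoin ℂ (Set.range (gpt U V ρ))) _)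
    have := h1.1
    simp at this
    omega
  obtain ⟨cs, hcs⟩ := hcs
  obtain ⟨r2, jz, z0, hz0, hz⟩ := exists_TB (exv K V) (S.alg_of_V _
    (fun c => IntermediateField.subset_adjoin _ _ ⟨c, rfl⟩)) cs hcs
  have hnum := num0 T.basis hxK _ hz
  simp only [Fintype.card_fin] at hnum
  have hbig := T.basis.sumElim_comp hz
  have htr := tb_transcendental _ hz.1 z0
  obtain ⟨E, hE⟩ : ∃ E, E = IntermediateField.adjoin
    (IntermediateField.adjoin ℂ (Set.range (gpt U V ρ))) ((fun t => exv K V (jz t)) '' {j | j ≠ z0}) :=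
    ⟨_, rfl⟩
  rw [← hE] at htr
  simp only [hz0] at htr
  have hK0E : ∀ z : IntermediateField.adjoin ℂ (Set.range (gpt U V ρ)), (z : K) ∈ E :=
    fun z => E.algebraMap_mem z
  have huE : ∀ c, gpt U V ρ c ∈ E := fun c => by rw [← T.hu0]; exact hK0E _
  have hal : ∀ i h, IsAlgebraic E (ξ i h) := by
    intro i h
    refine isAlgebraic_of_val E _ fun O hO => ?_
    have hOu : ∀ c, gpt U V ρ c ∈ O := fun c => hO (huE c)
    refine S.claim O ?_ hOu (fun c => hO (inv_mem (huE c))) (θ := fun j => (θ j : K))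
      (fun j => hO (hK0E _)) ξ hξ hR (ι := {z : Fin r2 // z ≠ z0} ⊕ Fin r) ?_
      (Sum.elim (fun z => exv K V (jz z)) (fun t => gpt U V ρ (jj t))) ?_ ?_ ?_ i h
    · intro z
      exact hO (hK0E (algebraMap ℂ _ z))
    · simp [Fintype.card_subtype_compl]
      have := z0.pos
      omega
    · have h1 := hbig.1.comp (Sum.map (Subtype.val : {z : Fin r2 // z ≠ z0} → Fin r2) id)
        (Sum.map_injective.mpr ⟨Subtype.val_injective, Function.injective_id⟩)
      convert h1 using 1
      funext z
      rcases z with z | t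
      · rfl
      · exact (T.hu0 _).symm
    · have hle : IntermediateField.adjoin ℂ (Set.range (Sum.elim
          (fun z : {z : Fin r2 // z ≠ z0} => exv K V (jz z)) (fun t => gpt U V ρ (jj t)))) ≤
          E.restrictScalars ℂ := by
        rw [IntermediateField.adjoin_le_iff]
        rintro _ ⟨z | t, rfl⟩
        · change exv K V (jz z) ∈ E
          rw [hE]
          exact IntermediateField.subset_adjoin _ _ ⟨z, z.2, rfl⟩
        · exact huE _
      intro z hz'
      exact hO (hle hz')
    · rintro (z | t)
      · exact Or.inr ⟨_, rfl⟩
      · exact Or.inl ⟨_, rfl⟩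
  have hkey : ∀ i h, ξ i (X i1 * h) - ρ * ξ i (X i0 * h) = 0 := by
    intro i h
    by_contra hne
    apply htr
    have e := hξ.frame_supp S.frK i cs h
    have hρ : IsAlgebraic E ρ := by
      have := huE i1
      rw [S.u_i1] at this
      exact isAlgebraic_algebraMap (⟨ρ, this⟩ : E)
    have hu : IsAlgebraic E (gpt U V ρ cs) := isAlgebraic_algebraMap (⟨_, huE cs⟩ : E)
    have : exv K V cs = (ξ i (X cs * h) - gpt U V ρ cs * ξ i (X i0 * h)) *
        (ξ i (X i1 * h) - ρ * ξ i (X i0 * h))⁻¹ := by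
      rw [eq_mul_inv_iff_mul_eq₀ hne, e]
      simp only [gpt]; ring
    rw [this]
    exact ((hal _ _).sub (hu.mul (hal _ _))).mul ((hal _ _).sub (hρ.mul (hal _ _))).inv
  have hrow : ∀ i c h, ξ i (X c * h) = gpt U V ρ c * ξ i (X i0 * h) := by
    intro i c h
    rw [hξ.frame_supp S.frK i c h, sub_eq_zero.mp (hkey i h)]
    simp only [gpt]; ring
  refine hθn (theta_of_adm S.H hξ (c := 0) (η := 0) (ξ' := 0) ?_ ?_ ?_ S.u_i0)
  · intro i a b h
    rw [hrow, hrow i a]; ring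
  · refine ⟨?_, ?_, ?_, ?_⟩ <;> intros <;> simp
  · intro i a b h
    simp

end Setup

theorem partB {M : Type} [Field M] [Algebra ℂ M] {U V : Fin (n+1) → M} {i0 i1 : Fin (n+1)}
    (H : SmoothData n s d f) (fr : Frame U V i0 i1) (on : ∀ i, phi U V (f i) = 0)
    (gen : IntermediateField.adjoin ℂ (Set.range U ∪ Set.range V) = ⊤)
    {m : ℕ} (x : Fin m → M) (hx : IsTranscendenceBasis ℂ x)
    (hs : 0 < s) (hm : 2 * n ≤ m + ∑ i, d i + s + 1) (hd : ∑ i, d i ≤ s + 5) (hn : ∑ i, d i ≤ n) :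
    False := by
  classical
  obtain ⟨B, hB⟩ := adm_bound H
  have hb := badness H fr on gen x hx hm
  have hex : ∃ q, ¬ ∃ η : Fin s → PR n →ₗ[ℂ] M, η ≠ 0 ∧ Adm d f (plu U V) (q + 1) η := by
    refine ⟨B, ?_⟩
    rintro ⟨η, h0, h1⟩
    exact h0 (hB M _ _ _ h1 (by omega))
  have hmin := Nat.find_spec hex
  have hlt : ∃ η : Fin s → PR n →ₗ[ℂ] M, η ≠ 0 ∧ Adm d f (plu U V) (Nat.find hex) η := by
    rcases Nat.eq_zero_or_pos (Nat.find hex) with h0 | h0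
    · rw [h0] at hmin
      exact absurd hb hmin
    · have := Nat.find_min hex (m := Nat.find hex - 1) (by omega)
      rw [not_not, Nat.sub_add_cancel h0] at this
      exact this
  obtain ⟨η, hη0, hη⟩ := hlt
  obtain ⟨K, _, _, z, hz, hgen⟩ := exists_purelyTrans M Unit
  letI : Algebra ℂ K := ((algebraMap M K).comp (algebraMap ℂ M)).toAlgebra
  haveI : IsScalarTower ℂ M K := IsScalarTower.of_algebraMap_eq fun _ => rfl
  have S : Setup d f U V i0 i1 (Nat.find hex) η m (z ()) := by
    refine ⟨H, fr, on, gen, hη0, hη, ?_, ⟨x, hx⟩, hz.transcendental (), ?_⟩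
    · intro η' h'
      by_contra h0
      exact hmin ⟨η', h0, h'⟩
    · rw [← hgen]; congr 1; ext t
      constructor
      · rintro rfl; exact ⟨_, rfl⟩
      · rintro ⟨⟨⟩, rfl⟩; rfl
  obtain ⟨r, jj, t0, u0, y, T⟩ := exists_tan (gpt U V (z ())) i0 i1 S.u_i0 S.trC
  have hal : ∀ t, ∑ j, S.al j * (y t j : K) = 0 := by
    intro t
    obtain ⟨D, hD⟩ := T.der t
    rw [← S.al_der D]
    exact Finset.sum_congr rfl fun j _ => by rw [hD]
  have hle := T.card_le H S.huf S.al hal S.al_u S.al_ns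
  rcases hle.eq_or_lt with h | h
  · exact S.case2 T h hm hn
  · exact S.case1 T hs (by omega) hm hd hn

end FanoAux

namespace FanoAux
set_option linter.unusedSectionVars false
open MvPolynomial

section krull
variable {ι : Type} [Fintype ι]

theorem ringKrullDim_poly : ringKrullDim (MvPolynomial ι ℂ) = (Fintype.card ι : ℕ) := by
  rw [MvPolynomial.ringKrullDim_of_isNoetherianRing, ringKrullDim_eq_zero_of_field]
  simp

/-- Translation automorphism. -/
def transl (p : ι → ℂ) : MvPolynomial ι ℂ ≃ₐ[ℂ] MvPolynomial ι ℂ :=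
  AlgEquiv.ofAlgHom (aeval fun i => X i + C (p i)) (aeval fun i => X i - C (p i))
    (by ext i; simp [algebraMap_eq]) (by ext i; simp [algebraMap_eq])

theorem aeval_transl (p x : ι → ℂ) (h : MvPolynomial ι ℂ) :
    aeval x (transl p h) = aeval (fun i => x i + p i) h := by
  have : ((aeval x).comp (transl p).toAlgHom : MvPolynomial ι ℂ →ₐ[ℂ] ℂ) =
      aeval (fun i => x i + p i) := by
    ext i; simp [transl]
  exact DFunLike.congr_fun this h

theorem height_point (p : ι → ℂ) :
    (vanishingIdeal ℂ {p} : Ideal (MvPolynomial ι ℂ)).height = (Fintype.card ι : ℕ) := by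
  haveI : FiniteRingKrullDim (MvPolynomial ι ℂ) := by
    rw [finiteRingKrullDim_iff_ne_bot_and_top, ringKrullDim_poly]
    constructor
    · exact WithBot.natCast_ne_bot _
    · intro h
      have h' : ((Fintype.card ι : ℕ∞) : WithBot ℕ∞) = ((⊤ : ℕ∞) : WithBot ℕ∞) := h
      exact ENat.coe_ne_top _ (WithBot.coe_inj.mp h')
  obtain ⟨Q, hQ, hQh⟩ := Ideal.exists_isMaximal_height (R := MvPolynomial ι ℂ)
  obtain ⟨x, rfl⟩ := isMaximal_iff_eq_vanishingIdeal_singleton.mp hQ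
  have h1 : (vanishingIdeal ℂ {p} : Ideal (MvPolynomial ι ℂ)) =
      Ideal.comap (transl (fun i => p i - x i)).toRingEquiv (vanishingIdeal ℂ {x}) := by
    ext h
    rw [Ideal.mem_comap, mem_vanishingIdeal_singleton_iff, mem_vanishingIdeal_singleton_iff]
    change _ ↔ aeval x (transl (fun i => p i - x i) h) = 0
    rw [aeval_transl]
    simp
  rw [h1, RingEquiv.height_comap]
  rw [ringKrullDim_poly] at hQh
  exact_mod_cast hQh

theorem specialize_point {κ : Type} [Field κ] [Algebra ℂ κ] (w : ι → κ) :
    ∃ w0 : ι → ℂ, ∀ p : MvPolynomial ι ℂ, aeval w p = 0 → aeval w0 p = 0 := by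
  obtain ⟨Q, hQ, hle⟩ := Ideal.exists_le_maximal (RingHom.ker (aeval (R := ℂ) w).toRingHom)
    (RingHom.ker_ne_top _)
  obtain ⟨x, rfl⟩ := isMaximal_iff_eq_vanishingIdeal_singleton.mp hQ
  exact ⟨x, fun p hp => (mem_vanishingIdeal_singleton_iff x p).mp (hle hp)⟩

theorem krull_curve (g : ι → MvPolynomial (Option ι) ℂ)
    (hg : ∀ i, ∃ h, g i = X (some i) + X none * h) :
    ∃ Q : Ideal (MvPolynomial (Option ι) ℂ), Q.IsPrime ∧ (∀ i, g i ∈ Q) ∧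
      (∀ h ∈ Q, aeval (fun _ => (0:ℂ)) h = 0) ∧ X none ∉ Q := by
  have hle : Ideal.span (Set.range g) ≤ vanishingIdeal ℂ {fun _ => (0:ℂ)} := by
    rw [Ideal.span_le]
    rintro _ ⟨i, rfl⟩
    obtain ⟨h, hh⟩ := hg i
    rw [SetLike.mem_coe, mem_vanishingIdeal_singleton_iff, hh]
    simp
  obtain ⟨Q, hQ, hQle⟩ := Ideal.exists_minimalPrimes_le hle
  haveI : Q.IsPrime := hQ.1.1
  have hgQ : ∀ i, g i ∈ Q := fun i => hQ.1.2 (Ideal.subset_span ⟨i, rfl⟩)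
  refine ⟨Q, inferInstance, hgQ, fun h hh => (mem_vanishingIdeal_singleton_iff _ h).mp (hQle hh), ?_⟩
  intro hX
  have h1 : Q.height ≤ (Set.range g).ncard :=
    Ideal.height_le_card_of_mem_minimalPrimes_span (Set.finite_range g) hQ
  have h2 : (Set.range g).ncard ≤ Fintype.card ι := by
    rw [← Nat.card_eq_fintype_card, ← Set.ncard_univ, ← Set.image_univ]
    exact Set.ncard_image_le Set.finite_univ
  have h3 : ∀ o : Option ι, X o ∈ Q := by
    rintro (_ | i)
    · exact hX
    · obtain ⟨h, hh⟩ := hg i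
      have : X (some i) = g i - X none * h := by rw [hh]; ring
      rw [this]
      exact Q.sub_mem (hgQ i) (Q.mul_mem_right _ hX)
  have h4 : Q = vanishingIdeal ℂ {fun _ => (0:ℂ)} := by
    refine le_antisymm hQle fun h hh => ?_
    rw [mem_vanishingIdeal_singleton_iff] at hh
    have key : ∀ h : MvPolynomial (Option ι) ℂ, h - C (aeval (fun _ => (0:ℂ)) h) ∈ Q := by
      intro h
      induction h using MvPolynomial.induction_on with
      | C a => simp
      | add p q hp hq =>
        have := Q.add_mem hp hq
        convert this using 1
        simp; ring
      | mul_X p o hp =>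
        simpa using Q.mul_mem_left p (h3 o)
    simpa [hh] using key h
  rw [h4, height_point] at h1
  have h5 := Nat.cast_le.mp h1
  simp at h5
  omega

end krull

end FanoAux

namespace FanoAux
set_option linter.unusedSectionVars false
open MvPolynomial
variable {n s : ℕ} {d : Fin s → ℕ}

structure CMap (d : Fin s → ℕ) (j0 j1 : Fin (n+1)) (i1 i2 : Fin s) (c : Fin s → ℕ → Fin (n+1)) :
    Prop where
  ne : ∀ i a, a < d i → c i a ≠ j0 ∧ c i a ≠ j1
  merge : c i1 (d i1 - 1) = c i2 0
  inj : ∀ i a i' a', a < d i → a' < d i' → c i a = c i' a' → (i = i' ∧ a = a') ∨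
    ((i = i1 ∧ a = d i1 - 1) ∧ (i' = i2 ∧ a' = 0)) ∨ ((i = i2 ∧ a = 0) ∧ (i' = i1 ∧ a' = d i1 - 1))

theorem exists_cmap (hd : ∀ i, 2 ≤ d i) (hn : ∑ i, d i ≤ n) (j0 j1 : Fin (n+1)) (hj : j0 ≠ j1)
    (i1 i2 : Fin s) (hi : i1 ≠ i2) : ∃ c, CMap d j0 j1 i1 i2 c := by
  classical
  let z2 : Σ i : Fin s, Fin (d i) := ⟨i2, ⟨0, by have := hd i2; omega⟩⟩
  let z1 : Σ i : Fin s, Fin (d i) := ⟨i1, ⟨d i1 - 1, by have := hd i1; omega⟩⟩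
  have hz : z1 ≠ z2 := fun h => hi (congrArg Sigma.fst h)
  have hcard : Fintype.card {p : Σ i : Fin s, Fin (d i) // p ≠ z2} ≤
      Fintype.card {j : Fin (n+1) // j ∉ ({j0, j1} : Finset (Fin (n+1)))} := by
    have h1 := Fintype.card_subtype_compl (fun p : Σ i : Fin s, Fin (d i) => p = z2)
    have h2 := Fintype.card_subtype_compl (fun j : Fin (n+1) => j ∈ ({j0, j1} : Finset (Fin (n+1))))
    rw [Fintype.card_coe, Finset.card_pair hj] at h2
    simp only [Fintype.card_sigma, Fintype.card_fin, Fintype.card_subtype_eq] at h1 h2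
    have h3 : Fintype.card {p : Σ i : Fin s, Fin (d i) // p ≠ z2} = ∑ i, d i - 1 := h1
    rw [h3, h2]
    omega
  obtain ⟨e⟩ := Function.Embedding.nonempty_of_card_le hcard
  let κ : (Σ i : Fin s, Fin (d i)) → {p : Σ i : Fin s, Fin (d i) // p ≠ z2} :=
    fun p => if h : p = z2 then ⟨z1, hz⟩ else ⟨p, h⟩
  refine ⟨fun i a => if h : a < d i then (e (κ ⟨i, ⟨a, h⟩⟩) : Fin (n+1)) else j0, ?_, ?_, ?_⟩
  · intro i a h
    simp only [h, dif_pos]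
    have := (e (κ ⟨i, ⟨a, h⟩⟩)).2
    simpa using this
  · have h1 : d i1 - 1 < d i1 := by have := hd i1; omega
    have h2 : 0 < d i2 := by have := hd i2; omega
    simp only [h1, h2, dif_pos]
    congr 2
    change κ z1 = κ z2
    simp [κ, hz]
  · intro i a i' a' h h' heq
    simp only [h, h', dif_pos] at heq
    have h1 := e.injective (Subtype.ext heq)
    have hκ : ∀ p, (κ p).1 = if p = z2 then z1 else p := by
      intro p; simp only [κ]; split_ifs <;> rfl
    have h2 := congrArg Subtype.val h1
    rw [hκ, hκ] at h2
    have hz1 : ∀ i a (h : a < d i), (⟨i, ⟨a, h⟩⟩ : Σ i : Fin s, Fin (d i)) = z1 → i = i1 ∧ a = d i1 - 1 := by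
      intro i a h hh
      have hi := congrArg Sigma.fst hh
      simp only [z1] at hi
      subst hi
      simpa [z1] using hh
    have hz2 : ∀ i a (h : a < d i), (⟨i, ⟨a, h⟩⟩ : Σ i : Fin s, Fin (d i)) = z2 → i = i2 ∧ a = 0 := by
      intro i a h hh
      have hi := congrArg Sigma.fst hh
      simp only [z2] at hi
      subst hi
      simpa [z2] using hh
    split_ifs at h2 with h3 h4 h4
    · left
      have e1 := hz2 _ _ _ h3
      have e2 := hz2 _ _ _ h4
      exact ⟨e1.1.trans e2.1.symm, e1.2.trans e2.2.symm⟩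
    · exact Or.inr (Or.inr ⟨hz2 _ _ _ h3, hz1 _ _ _ h2.symm⟩)
    · exact Or.inr (Or.inl ⟨hz1 _ _ _ h2, hz2 _ _ _ h4⟩)
    · left
      have hi := congrArg Sigma.fst h2
      simp only at hi
      subst hi
      simpa using h2

/-- Index type of the equations. -/
abbrev Eqn (d : Fin s → ℕ) : Type := Σ i : Fin s, Fin (d i + 1)

/-- The linear system. -/
def linL (d : Fin s → ℕ) (c : Fin s → ℕ → Fin (n+1)) :
    ((Fin (n+1) → ℂ) × (Fin (n+1) → ℂ)) →ₗ[ℂ] (Eqn d → ℂ) where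
  toFun w := fun p => (if (p.2 : ℕ) < d p.1 then w.1 (c p.1 p.2) else 0) +
    (if 0 < (p.2 : ℕ) then w.2 (c p.1 (p.2 - 1)) else 0)
  map_add' w w' := by
    funext p; simp only [Prod.fst_add, Prod.snd_add, Pi.add_apply]
    split_ifs <;> ring
  map_smul' t w := by
    funext p; simp only [Prod.smul_fst, Prod.smul_snd, Pi.smul_apply, smul_eq_mul, RingHom.id_apply]
    split_ifs <;> ring

def basE (d : Fin s → ℕ) (i : Fin s) (k : ℕ) : Eqn d → ℂ :=
  fun p => if p.1 = i ∧ (p.2 : ℕ) = k then 1 else 0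

theorem linL_surj (hd : ∀ i, 2 ≤ d i) {j0 j1 : Fin (n+1)} {i1 i2 : Fin s} (hi : i1 ≠ i2)
    {c : Fin s → ℕ → Fin (n+1)} (hc : CMap d j0 j1 i1 i2 c) :
    Function.Surjective (linL d c) := by
  classical
  have hd1 := hd i1
  have hd2 := hd i2
  -- non-special positions
  have hns : ∀ i a, a < d i → ¬ (i = i1 ∧ a = d i1 - 1) → ¬ (i = i2 ∧ a = 0) →
      ∀ i' a', a' < d i' → (c i' a' = c i a ↔ i' = i ∧ a' = a) := by
    intro i a h h1 h2 i' a' h'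
    constructor
    · intro he
      rcases hc.inj _ _ _ _ h' h he with h3 | h3 | h3
      · exact h3
      · exact absurd h3.2 h2
      · exact absurd h3.2 h1
    · rintro ⟨rfl, rfl⟩; rfl
  have hA : ∀ i a, a < d i → ¬ (i = i1 ∧ a = d i1 - 1) → ¬ (i = i2 ∧ a = 0) →
      basE d i a ∈ LinearMap.range (linL d c) := by
    intro i a h h1 h2
    refine ⟨(Pi.single (c i a) 1, 0), ?_⟩
    funext p
    simp only [linL, LinearMap.coe_mk, AddHom.coe_mk, Pi.zero_apply, ite_self, add_zero, basE,
      Pi.single_apply]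
    have hp := p.2.2
    by_cases h3 : (p.2 : ℕ) < d p.1
    · simp only [h3, if_true, hns i a h h1 h2 _ _ h3]
    · rw [if_neg h3, if_neg]
      rintro ⟨h4, h5⟩
      rw [h5, h4] at h3
      exact h3 h
  have hB : ∀ i a, a < d i → ¬ (i = i1 ∧ a = d i1 - 1) → ¬ (i = i2 ∧ a = 0) →
      basE d i (a + 1) ∈ LinearMap.range (linL d c) := by
    intro i a h h1 h2
    refine ⟨(0, Pi.single (c i a) 1), ?_⟩
    funext p
    simp only [linL, LinearMap.coe_mk, AddHom.coe_mk, Pi.zero_apply, ite_self, zero_add, basE,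
      Pi.single_apply]
    have hp := p.2.2
    by_cases h3 : 0 < (p.2 : ℕ)
    · have h4 := hns i a h h1 h2 p.1 (p.2 - 1) (by omega)
      simp only [h3, if_true, h4]
      congr 1
      simp only [eq_iff_iff, and_congr_right_iff]
      intro; omega
    · rw [if_neg h3, if_neg]
      rintro ⟨h4, h5⟩
      omega
  have hm : ∀ i a, a < d i → (c i a = c i2 0 ↔ (i = i1 ∧ a = d i1 - 1) ∨ (i = i2 ∧ a = 0)) := by
    intro i a h
    constructor
    · intro he
      rcases hc.inj _ _ _ _ h (by omega) he with h3 | h3 | h3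
      · exact Or.inr h3
      · exact Or.inl h3.1
      · exact absurd h3.2.1.symm hi
    · rintro (⟨rfl, rfl⟩ | ⟨rfl, rfl⟩)
      · exact hc.merge
      · rfl
  have hA' : basE d i1 (d i1 - 1) + basE d i2 0 ∈ LinearMap.range (linL d c) := by
    refine ⟨(Pi.single (c i2 0) 1, 0), ?_⟩
    funext p
    simp only [linL, LinearMap.coe_mk, AddHom.coe_mk, Pi.zero_apply, ite_self, add_zero, basE,
      Pi.single_apply, Pi.add_apply]
    have hp := p.2.2
    by_cases h3 : (p.2 : ℕ) < d p.1
    · simp only [h3, if_true, hm _ _ h3]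
      grind
    · grind
  have hB' : basE d i1 (d i1) + basE d i2 1 ∈ LinearMap.range (linL d c) := by
    refine ⟨(0, Pi.single (c i2 0) 1), ?_⟩
    funext p
    simp only [linL, LinearMap.coe_mk, AddHom.coe_mk, Pi.zero_apply, ite_self, zero_add, basE,
      Pi.single_apply, Pi.add_apply]
    have hp := p.2.2
    by_cases h3 : 0 < (p.2 : ℕ)
    · have h4 := hm p.1 (p.2 - 1) (by omega)
      simp only [h3, if_true, h4]
      grind
    · grind
  have h1 : basE d i2 1 ∈ LinearMap.range (linL d c) :=
    hA i2 1 (by omega) (by rintro ⟨h, -⟩; exact hi h.symm) (by simp)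
  have h2 : basE d i1 (d i1) ∈ LinearMap.range (linL d c) := by
    simpa using Submodule.sub_mem _ hB' h1
  have h3 : basE d i1 (d i1 - 1) ∈ LinearMap.range (linL d c) := by
    have := hB i1 (d i1 - 2) (by omega) (by omega) (by rintro ⟨h, -⟩; exact hi h)
    rwa [show d i1 - 2 + 1 = d i1 - 1 by omega] at this
  have h4 : basE d i2 0 ∈ LinearMap.range (linL d c) := by
    simpa using Submodule.sub_mem _ hA' h3
  have hall : ∀ i k, k ≤ d i → basE d i k ∈ LinearMap.range (linL d c) := by
    intro i k hk
    by_cases ha : i = i1 ∧ k = d i1 - 1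
    · rw [ha.1, ha.2]; exact h3
    by_cases hb : i = i2 ∧ k = 0
    · rw [hb.1, hb.2]; exact h4
    rcases hk.lt_or_eq with h | h
    · exact hA i k h ha hb
    · by_cases h5 : i = i1
      · subst h5; rw [h]; exact h2
      · have hdi := hd i
        have := hB i (k - 1) (by omega) (by rintro ⟨h, -⟩; exact h5 h) (by rintro ⟨-, h⟩; omega)
        rwa [show k - 1 + 1 = k by omega] at this
  intro x
  have : x = ∑ p : Eqn d, x p • basE d p.1 p.2 := by
    funext p
    rw [Finset.sum_apply, Finset.sum_eq_single p]
    · simp [basE]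
    · intro b _ hb
      simp only [basE, Pi.smul_apply, smul_eq_mul]
      rw [if_neg, mul_zero]
      rintro ⟨h5, h6⟩
      apply hb
      rcases p with ⟨i, k⟩
      rcases b with ⟨i', k'⟩
      simp only at h5 h6
      subst h5
      simp only [Sigma.mk.injEq, heq_eq_eq, true_and]
      exact Fin.ext h6.symm
    · simp
  rw [this]
  exact Submodule.sum_mem _ fun p _ => Submodule.smul_mem _ _ (hall _ _ (by have := p.2.2; omega))

end FanoAux

namespace FanoAux
set_option linter.unusedSectionVars false
open MvPolynomial
variable {n s : ℕ} {d : Fin s → ℕ}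

/-- Restriction to a parametrised line over a ring. -/
def psi {A : Type} [CommRing A] [Algebra ℂ A] (U V : Fin (n + 1) → A) : PR n →ₐ[ℂ] Polynomial A :=
  aeval (fun c => Polynomial.C (U c) + Polynomial.C (V c) * Polynomial.X)

theorem psi_map {A M : Type} [CommRing A] [Algebra ℂ A] [Field M] [Algebra ℂ M] (σ : A →ₐ[ℂ] M)
    (U V : Fin (n + 1) → A) (h : PR n) :
    phi (fun c => σ (U c)) (fun c => σ (V c)) h = (psi U V h).map σ.toRingHom := by
  have : phi (fun c => σ (U c)) (fun c => σ (V c)) =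
      (Polynomial.mapAlgHom σ).comp (psi U V) := by
    apply MvPolynomial.algHom_ext
    intro c
    simp [phi, psi]
  rw [this]
  rfl

/-- The special system. -/
def fz (d : Fin s → ℕ) (j0 j1 : Fin (n+1)) (c : Fin s → ℕ → Fin (n+1)) (i : Fin s) : PR n :=
  ∑ a ∈ Finset.range (d i), X (c i a) * X j0 ^ (d i - 1 - a) * X j1 ^ a

theorem fz_homog (j0 j1 : Fin (n+1)) (c : Fin s → ℕ → Fin (n+1)) (i : Fin s) :
    (fz d j0 j1 c i).IsHomogeneous (d i) := by
  refine IsHomogeneous.sum _ _ _ fun a ha => ?_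
  have h1 := ((isHomogeneous_X ℂ (c i a)).mul (isHomogeneous_X_pow (R := ℂ) j0 (d i - 1 - a))).mul
    (isHomogeneous_X_pow (R := ℂ) j1 a)
  have : 1 + (d i - 1 - a) + a = d i := by
    have := Finset.mem_range.mp ha
    omega
  rwa [this] at h1

theorem psi_fz {A : Type} [CommRing A] [Algebra ℂ A] (U V : Fin (n + 1) → A) {j0 j1 : Fin (n+1)}
    (hU0 : U j0 = 1) (hU1 : U j1 = 0) (hV0 : V j0 = 0) (hV1 : V j1 = 1)
    (c : Fin s → ℕ → Fin (n+1)) (i : Fin s) (k : ℕ) (hk : k ≤ d i) :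
    (psi U V (fz d j0 j1 c i)).coeff k = (if k < d i then U (c i k) else 0) +
      (if 0 < k then V (c i (k-1)) else 0) := by
  have h1 : psi U V (fz d j0 j1 c i) = ∑ a ∈ Finset.range (d i),
      (Polynomial.C (U (c i a)) * Polynomial.X ^ a + Polynomial.C (V (c i a)) * Polynomial.X ^ (a+1)) := by
    rw [fz, map_sum]
    refine Finset.sum_congr rfl fun a _ => ?_
    simp only [psi, map_mul, map_pow, aeval_X, hU0, hU1, hV0, hV1]
    simp
    ring
  rw [h1, Polynomial.finsetSum_coeff]
  simp only [Polynomial.coeff_add, Polynomial.coeff_C_mul_X_pow, Finset.sum_add_distrib]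
  congr 1
  · rw [Finset.sum_ite_eq]; simp
  · split_ifs with h
    · rw [Finset.sum_eq_single (k-1)]
      · rw [if_pos (by omega)]
      · intro b _ hb
        rw [if_neg (by omega)]
      · intro hh
        exact absurd (Finset.mem_range.mpr (by omega)) hh
    · exact Finset.sum_eq_zero fun b _ => if_neg (by omega)

theorem exists_generic_line (f : Fin s → PR n) (hd : ∀ i, 2 ≤ d i) (hf : ∀ i, (f i).IsHomogeneous (d i))
    (hn : ∑ i, d i ≤ n) (j0 j1 : Fin (n+1)) (hj : j0 ≠ j1) (i1 i2 : Fin s) (hi : i1 ≠ i2) :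
    ∃ (M : Type) (_ : Field M) (_ : Algebra ℂ M) (τ : M) (U V : Fin (n+1) → M) (f0 : Fin s → PR n),
      Transcendental ℂ τ ∧ Frame U V j0 j1 ∧ (∀ i, (f0 i).IsHomogeneous (d i)) ∧
      ∀ i, Polynomial.C (1 - τ) * phi U V (f0 i) + Polynomial.C τ * phi U V (f i) = 0 := by
  classical
  obtain ⟨c, hc⟩ := exists_cmap hd hn j0 j1 hj i1 i2 hi
  obtain ⟨σ, hσ⟩ := LinearMap.exists_rightInverse_of_surjective (linL d c)
    (LinearMap.range_eq_top.mpr (linL_surj hd hi hc))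
  let S := MvPolynomial (Option (Eqn d)) ℂ
  let U : Fin (n+1) → S := fun j => if j = j0 then 1 else if j = j1 then 0 else
    ∑ p : Eqn d, C ((σ (Pi.single p 1)).1 j) * X (some p)
  let V : Fin (n+1) → S := fun j => if j = j0 then 0 else if j = j1 then 1 else
    ∑ p : Eqn d, C ((σ (Pi.single p 1)).2 j) * X (some p)
  have hU0 : U j0 = 1 := by simp [U]
  have hU1 : U j1 = 0 := by simp [U, hj.symm]
  have hV0 : V j0 = 0 := by simp [V]
  have hV1 : V j1 = 1 := by simp [V, hj.symm]
  have hz : ∀ p : Eqn d, (psi U V (fz d j0 j1 c p.1)).coeff p.2 = X (some p) := by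
    intro p
    rw [psi_fz U V hU0 hU1 hV0 hV1 c p.1 p.2 (by have := p.2.2; omega)]
    have h1 : ∀ p' : Eqn d, linL d c (σ (Pi.single p' 1)) p = if p = p' then 1 else 0 := by
      intro p'
      have := LinearMap.congr_fun hσ (Pi.single p' 1)
      rw [LinearMap.comp_apply, LinearMap.id_apply] at this
      rw [this, Pi.single_apply]
    have h2 : (if (p.2 : ℕ) < d p.1 then U (c p.1 p.2) else 0) =
        ∑ p' : Eqn d, C (if (p.2 : ℕ) < d p.1 then (σ (Pi.single p' 1)).1 (c p.1 p.2) else 0) * X (some p') := by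
      split_ifs with h
      · simp only [U]
        rw [if_neg (hc.ne _ _ h).1, if_neg (hc.ne _ _ h).2]
      · simp
    have h3 : (if 0 < (p.2 : ℕ) then V (c p.1 (p.2 - 1)) else 0) =
        ∑ p' : Eqn d, C (if 0 < (p.2 : ℕ) then (σ (Pi.single p' 1)).2 (c p.1 (p.2 - 1)) else 0) * X (some p') := by
      split_ifs with h
      · have h' : (p.2 : ℕ) - 1 < d p.1 := by have := p.2.2; omega
        simp only [V]
        rw [if_neg (hc.ne _ _ h').1, if_neg (hc.ne _ _ h').2]
      · simp
    rw [h2, h3, ← Finset.sum_add_distrib]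
    rw [Finset.sum_eq_single p]
    · rw [← add_mul, ← C_add]
      have := h1 p
      simp only [linL, LinearMap.coe_mk, AddHom.coe_mk, if_true] at this
      rw [this]; simp
    · intro p' _ hp'
      rw [← add_mul, ← C_add]
      have := h1 p'
      simp only [linL, LinearMap.coe_mk, AddHom.coe_mk] at this
      rw [this, if_neg hp'.symm]; simp
    · simp
  obtain ⟨Q, hQ, hgQ, hQ0, hτ⟩ := krull_curve (fun p : Eqn d =>
    (1 - X none) * (psi U V (fz d j0 j1 c p.1)).coeff p.2 + X none * (psi U V (f p.1)).coeff p.2)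
    (fun p => ⟨(psi U V (f p.1)).coeff p.2 - X (some p), by rw [hz]; ring⟩)
  let M := FractionRing (S ⧸ Q)
  let π : S →ₐ[ℂ] M := (IsScalarTower.toAlgHom ℂ (S ⧸ Q) M).comp (Ideal.Quotient.mkₐ ℂ Q)
  have hπ : ∀ x, π x = 0 ↔ x ∈ Q := by
    intro x
    rw [← Ideal.Quotient.eq_zero_iff_mem]
    exact (FaithfulSMul.algebraMap_injective (S ⧸ Q) M).eq_iff' (map_zero _)
  refine ⟨M, inferInstance, inferInstance, π (X none), fun j => π (U j), fun j => π (V j),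
    fz d j0 j1 c, ?_, ⟨?_, ?_, ?_, ?_⟩, fun i => fz_homog _ _ _ _, ?_⟩
  · intro hal
    have h1 := IsAlgClosed.degree_eq_one_of_irreducible ℂ (minpoly.irreducible hal.isIntegral)
    obtain ⟨z, hz'⟩ := minpoly.mem_range_of_degree_eq_one ℂ _ h1
    have h2 : X none - C z ∈ Q := by
      rw [← hπ, map_sub, sub_eq_zero, ← hz']
      exact (π.commutes z).symm
    have h3 := hQ0 _ h2
    simp at h3
    rw [h3] at h2
    simp at h2
    exact hτ h2
  · simp [hU0]
  · simp [hU1]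
  · simp [hV0]
  · simp [hV1]
  · intro i
    apply Polynomial.ext
    intro k
    rw [Polynomial.coeff_add, Polynomial.coeff_C_mul, Polynomial.coeff_C_mul, Polynomial.coeff_zero]
    by_cases hk : k ≤ d i
    · rw [psi_map, psi_map, Polynomial.coeff_map, Polynomial.coeff_map]
      have := (hπ _).mpr (hgQ ⟨i, ⟨k, by omega⟩⟩)
      simp only [map_add, map_mul, map_sub, map_one] at this
      exact this
    · rw [Polynomial.coeff_eq_zero_of_natDegree_lt, Polynomial.coeff_eq_zero_of_natDegree_lt (p := phi _ _ (f i))]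
      · simp
      · exact (phi_natDegree _ _ _ _ (hf i)).trans_lt (by omega)
      · exact (phi_natDegree _ _ _ _ (fz_homog j0 j1 c i)).trans_lt (by omega)

end FanoAux

namespace FanoAux
set_option linter.unusedSectionVars false
open MvPolynomial
variable {n s : ℕ} {d : Fin s → ℕ} {f : Fin s → PR n}

theorem comb_van {M : Type} [Field M] [Algebra ℂ M] {U V : Fin (n+1) → M} {e : ℕ} {g0 g : PR n}
    (h0 : g0.IsHomogeneous e) (h : g.IsHomogeneous e) (α β : M)
    (on : Polynomial.C α * phi U V g0 + Polynomial.C β * phi U V g = 0) (a b : M) :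
    α * aeval (fun c => a * U c + b * V c) g0 + β * aeval (fun c => a * U c + b * V c) g = 0 := by
  have hev : ∀ r : M, α * aeval (fun c => U c + r * V c) g0 + β * aeval (fun c => U c + r * V c) g = 0 := by
    intro r
    have := congrArg (Polynomial.eval r) on
    simpa [phi_eval] using this
  have hsc : ∀ a b : M, a ≠ 0 →
      α * aeval (fun c => a * U c + b * V c) g0 + β * aeval (fun c => a * U c + b * V c) g = 0 := by
    intro a b ha
    have e1 : (fun c => a * U c + b * V c) = fun c => a * (U c + (b / a) * V c) := by
      funext c; field_simp
    rw [e1, eval_scale h0 a (fun c => U c + b / a * V c), eval_scale h a (fun c => U c + b / a * V c)]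
    linear_combination a ^ e * hev (b / a)
  by_cases ha : a = 0
  · subst ha
    have hz : Polynomial.C α * phi (fun c => b * V c) U g0 + Polynomial.C β * phi (fun c => b * V c) U g = 0 := by
      refine Polynomial.eq_zero_of_infinite_isRoot _ ?_
      haveI : Infinite M := Infinite.of_injective _ (algebraMap ℂ M).injective
      refine (Set.Finite.infinite_compl (Set.finite_singleton (0:M))).mono ?_
      intro r hr
      have hr : r ≠ 0 := hr
      have := hsc r b hr
      simp only [Set.mem_setOf_eq, Polynomial.IsRoot.def, Polynomial.eval_add, Polynomial.eval_mul,
        Polynomial.eval_C, phi_eval]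
      rw [← this]
      congr 4 <;> funext c <;> ring
    have := congrArg (Polynomial.eval 0) hz
    simp only [Polynomial.eval_add, Polynomial.eval_mul,
        Polynomial.eval_C, phi_eval, Polynomial.eval_zero, zero_mul, add_zero] at this
    simpa only [zero_mul, zero_add] using this
  · exact hsc a b ha

theorem exists_val_one {M : Type} [Field M] [Algebra ℂ M] {τ : M} (hτ : Transcendental ℂ τ) :
    ∃ O : ValuationSubring M, (∀ z : ℂ, algebraMap ℂ M z ∈ O) ∧ τ ∈ O ∧ (τ - 1)⁻¹ ∉ O := by
  let A : Subring M := (Polynomial.aeval (R := ℂ) τ).range.toSubring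
  have hτA : τ ∈ A := ⟨Polynomial.X, by simp⟩
  have hCA : ∀ z : ℂ, algebraMap ℂ M z ∈ A := fun z => ⟨Polynomial.C z, by simp⟩
  have h1 : τ - 1 ∈ A := sub_mem hτA (one_mem _)
  let I : Ideal A := Ideal.span {⟨τ - 1, h1⟩}
  have hI : I ≠ ⊤ := by
    intro h
    rw [Ideal.span_singleton_eq_top] at h
    obtain ⟨⟨_, q, rfl⟩, hq⟩ := h.exists_right_inv
    have hq' : (τ - 1) * Polynomial.aeval τ q = 1 := congrArg Subtype.val hq
    have h2 : Polynomial.aeval τ ((Polynomial.X - 1) * q - 1) = 0 := by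
      simp [hq']
    have h3 := (transcendental_iff.1 hτ) _ h2
    have := congrArg (Polynomial.eval 1) h3
    simp at this
  obtain ⟨B, hB, hB2⟩ := Ideal.image_subset_nonunits_valuationSubring I hI
  refine ⟨B, fun z => hB (hCA z), hB hτA, ?_⟩
  have h5 : τ - 1 ∈ B.nonunits := hB2 ⟨⟨τ - 1, h1⟩, Ideal.mem_span_singleton_self _, rfl⟩
  intro h6
  rw [ValuationSubring.mem_nonunits_iff] at h5
  have hne : τ - 1 ≠ 0 := by
    intro h
    apply hτ
    have : τ = algebraMap ℂ M 1 := by rw [map_one]; linear_combination h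
    rw [this]; exact isAlgebraic_algebraMap _
  rw [← ValuationSubring.valuation_le_one_iff, map_inv₀] at h6
  have h7 : B.valuation (τ-1) ≠ 0 := by simpa using hne
  exact absurd h5 (not_lt.2 ((inv_le_one₀ (zero_lt_iff.2 h7)).1 h6))

theorem exists_line_kappa (f : Fin s → PR n) (hd : ∀ i, 2 ≤ d i) (hf : ∀ i, (f i).IsHomogeneous (d i))
    (hn : ∑ i, d i ≤ n) (j0 j1 : Fin (n+1)) (hj : j0 ≠ j1) (i1 i2 : Fin s) (hi : i1 ≠ i2) :
    ∃ (κ : Type) (_ : Field κ) (_ : Algebra ℂ κ) (U V : Fin (n+1) → κ) (j0 j1 : Fin (n+1)),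
      Frame U V j0 j1 ∧ ∀ i, ∀ r : ℂ, aeval (fun c => U c + algebraMap ℂ κ r * V c) (f i) = 0 := by
  obtain ⟨M, _, _, τ, U, V, f0, hτ, fr, hf0, on⟩ := exists_generic_line f hd hf hn j0 j1 hj i1 i2 hi
  obtain ⟨O, hC, hτO, hτ1⟩ := exists_val_one hτ
  obtain ⟨κ, _, _, rd, R⟩ := exists_place O hC
  have h10 : rd (τ - 1) = 0 := R.rd_inv _ (sub_mem hτO (one_mem _)) hτ1
  have hr1 : rd τ = 1 := by
    rw [R.rd_sub hτO (one_mem _), R.rd_one] at h10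
    linear_combination h10
  have hr0 : rd (1 - τ) = 0 := by
    rw [R.rd_sub (one_mem _) hτO, R.rd_one, hr1, sub_self]
  obtain ⟨⟨a0, a1⟩, hδ0, hδ⟩ := exists_max_val O
    (fun p : Fin (n+1) × Fin (n+1) => plu U V p.1 p.2) (by
      intro h
      have := congrFun h (j0, j1)
      simp [plu, fr.U0, fr.V0, fr.U1, fr.V1] at this)
  simp only at hδ0 hδ
  set U' := frU U V a0 a1 with hU'
  set V' := frV U V a0 a1 with hV'
  have hUO : ∀ c, U' c ∈ O := by
    intro c; rw [hU', frU, inv_mul_eq_div]; exact hδ (c, a1)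
  have hVO : ∀ c, V' c ∈ O := by
    intro c; rw [hV', frV, inv_mul_eq_div]; exact hδ (a0, c)
  have hfr' : Frame U' V' a0 a1 := fr_frame hδ0
  refine ⟨κ, inferInstance, inferInstance, fun c => rd (U' c), fun c => rd (V' c), a0, a1, ?_, ?_⟩
  · constructor
    · rw [hfr'.U0, R.rd_one]
    · rw [hfr'.U1, R.rd_zero]
    · rw [hfr'.V0, R.rd_zero]
    · rw [hfr'.V1, R.rd_one]
  · intro i r
    have h1 : ∀ c, U' c + algebraMap ℂ M r * V' c ∈ O := fun c =>
      add_mem (hUO c) (mul_mem (R.C_mem r) (hVO c))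
    obtain ⟨m1, e1⟩ := R.rd_aeval _ h1 (f i)
    obtain ⟨m0, e0⟩ := R.rd_aeval _ h1 (f0 i)
    have h2 : (1 - τ) * aeval (fun c => U' c + algebraMap ℂ M r * V' c) (f0 i) +
        τ * aeval (fun c => U' c + algebraMap ℂ M r * V' c) (f i) = 0 := by
      have := comb_van (hf0 i) (hf i) _ _ (on i) ((plu U V a0 a1)⁻¹ * (V a1 - algebraMap ℂ M r * V a0))
        ((plu U V a0 a1)⁻¹ * (- U a1 + algebraMap ℂ M r * U a0))
      rw [← this]
      congr 4 <;>
      · funext c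
        simp only [hU', hV', frU, frV]
        generalize (plu U V a0 a1)⁻¹ = δ
        simp only [plu]; ring
    have h3 := congrArg rd h2
    rw [R.rd_add _ (mul_mem (sub_mem (one_mem _) hτO) m0) _ (mul_mem hτO m1),
      R.rd_mul _ (sub_mem (one_mem _) hτO) _ m0, R.rd_mul _ hτO _ m1, hr0, hr1, zero_mul, zero_add,
      one_mul, R.rd_zero, e1] at h3
    rw [← h3]
    congr 2
    funext c
    rw [R.rd_add _ (hUO c) _ (mul_mem (R.C_mem r) (hVO c)), R.rd_mul _ (R.C_mem r) _ (hVO c),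
      R.rd_C]

/-- There is a line on every such complete intersection. -/
theorem exists_line (f : Fin s → PR n) (hd : ∀ i, 2 ≤ d i) (hf : ∀ i, (f i).IsHomogeneous (d i))
    (hn : ∑ i, d i ≤ n) (j0 j1 : Fin (n+1)) (hj : j0 ≠ j1) (i1 i2 : Fin s) (hi : i1 ≠ i2) :
    ∃ (U V : Fin (n+1) → ℂ) (j0 j1 : Fin (n+1)), Frame U V j0 j1 ∧ ∀ i, phi U V (f i) = 0 := by
  obtain ⟨κ, _, _, U, V, j0, j1, fr, on⟩ := exists_line_kappa f hd hf hn j0 j1 hj i1 i2 hi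
  obtain ⟨w, hw⟩ := specialize_point (Sum.elim U V)
  refine ⟨fun c => w (Sum.inl c), fun c => w (Sum.inr c), j0, j1, ⟨?_, ?_, ?_, ?_⟩, ?_⟩
  · have := hw (X (Sum.inl j0) - 1) (by simp [fr.U0])
    simpa [sub_eq_zero] using this
  · have := hw (X (Sum.inl j1)) (by simp [fr.U1])
    simpa using this
  · have := hw (X (Sum.inr j0)) (by simp [fr.V0])
    simpa using this
  · have := hw (X (Sum.inr j1) - 1) (by simp [fr.V1])
    simpa [sub_eq_zero] using this
  · intro i
    refine poly_zero_of_complex _ fun r => ?_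
    rw [phi_eval]
    have := hw (aeval (fun c => X (Sum.inl c) + C r * X (Sum.inr c)) (f i)) (by
      rw [← on i r, comp_aeval_apply]
      congr 2
      funext c; simp)
    rw [comp_aeval_apply] at this
    rw [← this]
    congr 2
    funext c; simp
end FanoAux

namespace FanoAux
set_option linter.unusedSectionVars false
open MvPolynomial
variable {n s : ℕ} {d : Fin s → ℕ} {f : Fin s → PR n}

theorem aeval_cons {A : Type} [CommRing A] [Algebra ℂ A] {m : ℕ} (g : A) (x : Fin m → A)
    (p : MvPolynomial (Fin (m+1)) ℂ) :
    aeval (Fin.cons g x : Fin (m+1) → A) p =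
      Polynomial.eval₂ (aeval (R := ℂ) x).toRingHom g (finSuccEquiv ℂ m p) := by
  induction p using MvPolynomial.induction_on with
  | C a => simp [finSuccEquiv_apply]
  | add p q hp hq => simp only [map_add, Polynomial.eval₂_add, hp, hq]
  | mul_X p i hp =>
    rw [map_mul, map_mul, Polynomial.eval₂_mul, hp]
    congr 1
    refine Fin.cases ?_ (fun j => ?_) i
    · simp [finSuccEquiv_X_zero]
    · simp [finSuccEquiv_X_succ]

theorem chain_step {A : Type} [CommRing A] [Algebra ℂ A] {P P' : Ideal A} [hP' : P'.IsPrime]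
    (hlt : P' < P) {m : ℕ} {x : Fin m → A} (hx : ∀ p : MvPolynomial (Fin m) ℂ, aeval x p ∈ P → p = 0) :
    ∃ y : Fin (m+1) → A, ∀ p : MvPolynomial (Fin (m+1)) ℂ, aeval y p ∈ P' → p = 0 := by
  obtain ⟨g, hg, hg'⟩ := SetLike.exists_of_lt hlt
  refine ⟨Fin.cons g x, fun p hp => ?_⟩
  have key : ∀ k, ∀ q : Polynomial (MvPolynomial (Fin m) ℂ), q.natDegree ≤ k →
      Polynomial.eval₂ (aeval (R := ℂ) x).toRingHom g q ∈ P' → q = 0 := by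
    intro k
    induction k with
    | zero =>
      intro q hq h
      rw [Polynomial.eq_C_of_natDegree_le_zero hq] at h ⊢
      rw [Polynomial.eval₂_C] at h
      rw [hx _ (hlt.le h), map_zero]
    | succ k ih =>
      intro q hq h
      have e := Polynomial.divX_mul_X_add q
      have h0 : q.coeff 0 = 0 := by
        apply hx
        rw [← e] at h
        rw [Polynomial.eval₂_add, Polynomial.eval₂_mul, Polynomial.eval₂_X, Polynomial.eval₂_C] at h
        have := P.sub_mem (hlt.le h) (P.mul_mem_left (Polynomial.eval₂ (aeval (R := ℂ) x).toRingHom g q.divX) hg)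
        rwa [add_sub_cancel_left] at this
      rw [h0, map_zero, add_zero] at e
      rw [← e, Polynomial.eval₂_mul, Polynomial.eval₂_X] at h
      have h2 := (hP'.mem_or_mem h).resolve_right hg'
      rw [← e, ih _ (by rw [Polynomial.natDegree_divX_eq_natDegree_tsub_one]; omega) h2, zero_mul]
  rw [aeval_cons] at hp
  have := key _ _ le_rfl hp
  simpa using this

theorem chain_indep {A : Type} [CommRing A] [Algebra ℂ A] (m : ℕ) (P : ℕ → Ideal A)
    (hP : ∀ i ≤ m, (P i).IsPrime) (hlt : ∀ i < m, P (i+1) < P i) :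
    ∃ x : Fin m → A, ∀ p : MvPolynomial (Fin m) ℂ, aeval x p ∈ P m → p = 0 := by
  induction m with
  | zero =>
    refine ⟨Fin.elim0, fun p hp => ?_⟩
    rw [eq_C_of_isEmpty p] at hp ⊢
    rw [aeval_C] at hp
    by_contra hne
    have : coeff 0 p ≠ 0 := fun h => hne (by rw [h, C_0])
    refine (hP 0 le_rfl).ne_top (Ideal.eq_top_of_isUnit_mem _ hp ?_)
    exact (isUnit_iff_ne_zero.2 this).map _
  | succ m ih =>
    obtain ⟨x, hx⟩ := ih (fun i hi => hP i (by omega)) (fun i hi => hlt i (by omega))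
    haveI := hP (m+1) le_rfl
    exact chain_step (hlt m (by omega)) hx

/-- Coordinates on charts. -/
abbrev Sg (n : ℕ) := Fin (n+1) ⊕ Fin (n+1)

/-- The equation saying that `f i` vanishes at `U + r V`. -/
def onEq (g : PR n) (r : ℂ) : MvPolynomial (Sg n) ℂ :=
  aeval (fun c => X (Sum.inl c) + C r * X (Sum.inr c)) g

theorem aeval_onEq {M : Type} [CommRing M] [Algebra ℂ M] (w : Sg n → M) (g : PR n) (r : ℂ) :
    aeval w (onEq g r) = aeval (fun c => w (Sum.inl c) + algebraMap ℂ M r * w (Sum.inr c)) g := by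
  rw [onEq, comp_aeval_apply]
  congr 2
  funext c; simp

theorem upper_alg (H : SmoothData n s d f) (hs : 0 < s) (hd : ∑ i, d i ≤ s + 5) (hn : ∑ i, d i ≤ n)
    (P : Ideal (MvPolynomial (Sg n) ℂ)) [P.IsPrime] (j0 j1 : Fin (n+1))
    (h00 : X (Sum.inl j0) - 1 ∈ P) (h01 : X (Sum.inl j1) ∈ P) (h10 : X (Sum.inr j0) ∈ P)
    (h11 : X (Sum.inr j1) - 1 ∈ P) (hon : ∀ i r, onEq (f i) r ∈ P) {m : ℕ}
    (x : Fin m → MvPolynomial (Sg n) ℂ) (hx : ∀ p : MvPolynomial (Fin m) ℂ, aeval x p ∈ P → p = 0)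
    (hm : 2 * n ≤ m + ∑ i, d i + s + 1) : False := by
  classical
  let S := MvPolynomial (Sg n) ℂ
  let M := FractionRing (S ⧸ P)
  let π : S →ₐ[ℂ] M := (IsScalarTower.toAlgHom ℂ (S ⧸ P) M).comp (Ideal.Quotient.mkₐ ℂ P)
  have hπ : ∀ x, π x = 0 ↔ x ∈ P := by
    intro x
    change algebraMap (S ⧸ P) M (Ideal.Quotient.mk P x) = 0 ↔ _
    rw [FaithfulSMul.algebraMap_eq_zero_iff, Ideal.Quotient.eq_zero_iff_mem]
  let w : Sg n → M := fun i => π (X i)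
  have hw : π = aeval w := by
    apply MvPolynomial.algHom_ext
    intro i; simp [w]
  let U : Fin (n+1) → M := fun c => w (Sum.inl c)
  let V : Fin (n+1) → M := fun c => w (Sum.inr c)
  have fr : Frame U V j0 j1 := by
    constructor
    · have := (hπ _).2 h00
      rw [map_sub, map_one, sub_eq_zero] at this; exact this
    · exact (hπ _).2 h01
    · exact (hπ _).2 h10
    · have := (hπ _).2 h11
      rw [map_sub, map_one, sub_eq_zero] at this; exact this
  have on : ∀ i, phi U V (f i) = 0 := by
    intro i
    refine poly_zero_of_complex _ fun r => ?_
    rw [phi_eval]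
    have := (hπ _).2 (hon i r)
    rw [hw, aeval_onEq] at this
    exact this
  have gen : IntermediateField.adjoin ℂ (Set.range U ∪ Set.range V) = ⊤ := by
    rw [eq_top_iff]
    have h1 : ∀ a : S, π a ∈ IntermediateField.adjoin ℂ (Set.range U ∪ Set.range V) := by
      intro a
      rw [hw]
      induction a using MvPolynomial.induction_on with
      | C a => rw [aeval_C]; exact IntermediateField.algebraMap_mem _ _
      | add p q hp hq => rw [map_add]; exact add_mem hp hq
      | mul_X p i hp =>
        rw [map_mul, aeval_X]
        refine mul_mem hp (IntermediateField.subset_adjoin _ _ ?_)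
        rcases i with c | c
        · exact Or.inl ⟨c, rfl⟩
        · exact Or.inr ⟨c, rfl⟩
    intro z _
    obtain ⟨a, b, -, rfl⟩ := IsFractionRing.div_surjective (A := S ⧸ P) z
    obtain ⟨a, rfl⟩ := Ideal.Quotient.mk_surjective a
    obtain ⟨b, rfl⟩ := Ideal.Quotient.mk_surjective b
    exact div_mem (h1 a) (h1 b)
  have hind : AlgebraicIndependent ℂ (fun i => π (x i)) := by
    rw [algebraicIndependent_iff]
    intro p hp
    apply hx
    rw [← hπ, comp_aeval_apply]
    exact hp
  -- a finite transcendence basis containing x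
  obtain ⟨B, hB1, hB2, hB3⟩ := exists_isTranscendenceBasis_between (R := ℂ)
    (Set.range fun i => π (x i)) (Set.range (fun i => π (x i)) ∪ Set.range w) Set.subset_union_left
    ((algebraicIndependent_subtype_range hind.injective).2 hind) (ht := by
      have hle : Algebra.adjoin ℂ (Set.range w) ≤ Algebra.adjoin ℂ (Set.range (fun i => π (x i)) ∪ Set.range w) :=
        Algebra.adjoin_mono Set.subset_union_right
      constructor
      intro z
      obtain ⟨a, b, hb, rfl⟩ := IsFractionRing.div_surjective (A := S ⧸ P) z
      obtain ⟨a, rfl⟩ := Ideal.Quotient.mk_surjective a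
      obtain ⟨b, rfl⟩ := Ideal.Quotient.mk_surjective b
      have h1 : ∀ a : S, π a ∈ Algebra.adjoin ℂ (Set.range (fun i => π (x i)) ∪ Set.range w) := by
        intro a
        apply hle
        rw [hw, ← MvPolynomial.aeval_range]
        exact ⟨a, rfl⟩
      have h2 : ∀ a : S, IsAlgebraic (Algebra.adjoin ℂ (Set.range (fun i => π (x i)) ∪ Set.range w)) (π a) :=
        fun a => isAlgebraic_algebraMap (⟨π a, h1 a⟩ : Algebra.adjoin ℂ (Set.range (fun i => π (x i)) ∪ Set.range w))
      rw [div_eq_mul_inv]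
      exact (h2 a).mul (h2 b).inv)
  have hfin : B.Finite := ((Set.finite_range _).union (Set.finite_range _)).subset hB2
  haveI := hfin.to_subtype
  haveI := Fintype.ofFinite B
  let e := Fintype.equivFin B
  have hcard : m ≤ Fintype.card B := by
    have h1 : (Set.range fun i => π (x i)).ncard ≤ B.ncard := Set.ncard_le_ncard hB1 hfin
    rw [← Set.image_univ, Set.ncard_image_of_injective _ hind.injective, Set.ncard_univ, Nat.card_fin,
      ← Nat.card_coe_set_eq, Nat.card_eq_fintype_card] at h1
    exact h1
  refine partB H fr on gen (fun i => ((e.symm i : B) : M)) (hB3.comp_equiv e.symm) hs (m := Fintype.card B) ?_ hd hn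
  omega

/-- The equations of the chart. -/
def gens (d : Fin s → ℕ) (f : Fin s → PR n) (j0 j1 : Fin (n+1)) :
    Fin 4 ⊕ Eqn d → MvPolynomial (Sg n) ℂ :=
  Sum.elim ![X (Sum.inl j0) - 1, X (Sum.inl j1), X (Sum.inr j0), X (Sum.inr j1) - 1]
    (fun p => (psi (fun c => X (Sum.inl c)) (fun c => X (Sum.inr c)) (f p.1)).coeff p.2)

theorem gens_iff (hf : ∀ i, (f i).IsHomogeneous (d i)) (j0 j1 : Fin (n+1)) (w : Sg n → ℂ) :
    (∀ g, aeval w (gens d f j0 j1 g) = 0) ↔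
      (Frame (fun c => w (Sum.inl c)) (fun c => w (Sum.inr c)) j0 j1 ∧
        ∀ i, phi (fun c => w (Sum.inl c)) (fun c => w (Sum.inr c)) (f i) = 0) := by
  have hmap : ∀ i, phi (fun c => w (Sum.inl c)) (fun c => w (Sum.inr c)) (f i) =
      (psi (fun c => X (Sum.inl c)) (fun c => X (Sum.inr c)) (f i)).map (aeval (R := ℂ) w).toRingHom := by
    intro i
    rw [← psi_map]
    simp
  constructor
  · intro h
    refine ⟨⟨?_, ?_, ?_, ?_⟩, ?_⟩
    · have := h (Sum.inl 0)
      simpa [gens, sub_eq_zero] using this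
    · have := h (Sum.inl 1)
      simpa [gens, sub_eq_zero] using this
    · have := h (Sum.inl 2)
      simpa [gens, sub_eq_zero] using this
    · have := h (Sum.inl 3)
      simpa [gens, sub_eq_zero] using this
    · intro i
      ext k
      by_cases hk : k < d i + 1
      · rw [hmap, Polynomial.coeff_map]
        exact h (Sum.inr ⟨i, ⟨k, hk⟩⟩)
      · rw [Polynomial.coeff_zero]
        refine Polynomial.coeff_eq_zero_of_natDegree_lt ?_
        have := phi_natDegree (fun c => w (Sum.inl c)) (fun c => w (Sum.inr c)) _ _ (hf i)
        omega
  · rintro ⟨fr, on⟩ (g | ⟨i, k⟩)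
    · fin_cases g
      · simp [gens, fr.U0]
      · simp [gens, fr.U1]
      · simp [gens, fr.V0]
      · simp [gens, fr.V1]
    · have := on i
      rw [hmap] at this
      have := congrArg (fun p => Polynomial.coeff p k) this
      simpa [gens, Polynomial.coeff_map] using this

theorem lower_alg (hf : ∀ i, (f i).IsHomogeneous (d i)) (j0 j1 : Fin (n+1)) (w : Sg n → ℂ)
    (fr : Frame (fun c => w (Sum.inl c)) (fun c => w (Sum.inr c)) j0 j1)
    (on : ∀ i, phi (fun c => w (Sum.inl c)) (fun c => w (Sum.inr c)) (f i) = 0) (e : ℕ)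
    (he : e + ∑ i, d i + s + 2 ≤ 2 * n) :
    ∃ Q : Fin (e+1) → Ideal (MvPolynomial (Sg n) ℂ), StrictMono Q ∧ (∀ i, (Q i).IsPrime) ∧
      ∀ i, ∀ w ∈ zeroLocus ℂ (Q i), Frame (fun c => w (Sum.inl c)) (fun c => w (Sum.inr c)) j0 j1 ∧
        ∀ i, phi (fun c => w (Sum.inl c)) (fun c => w (Sum.inr c)) (f i) = 0 := by
  classical
  have hw := (gens_iff hf j0 j1 w).2 ⟨fr, on⟩
  haveI : (vanishingIdeal ℂ {w} : Ideal (MvPolynomial (Sg n) ℂ)).IsPrime :=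
    (isMaximal_iff_eq_vanishingIdeal_singleton.2 ⟨w, rfl⟩).isPrime
  have h1 := Ideal.height_le_ringKrullDim_quotient_add_encard (p := vanishingIdeal ℂ {w})
    (Set.range (gens d f j0 j1)) (by
      rintro _ ⟨g, rfl⟩
      exact (mem_vanishingIdeal_singleton_iff w _).2 (hw g))
  rw [height_point] at h1
  have h2 : (Set.range (gens d f j0 j1)).encard ≤ ((4 + (∑ i, d i + s) : ℕ) : ℕ∞) := by
    rw [← Set.image_univ]
    refine (Set.encard_image_le _ _).trans ?_
    rw [Set.encard_univ, ENat.card_eq_coe_fintype_card]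
    have : Fintype.card (Fin 4 ⊕ Eqn d) = 4 + (∑ i, d i + s) := by
      simp [Eqn, Finset.sum_add_distrib]
    rw [this]
  set J := Ideal.span (Set.range (gens d f j0 j1)) with hJ
  have h3 : (e : WithBot ℕ∞) ≤ ringKrullDim (MvPolynomial (Sg n) ℂ ⧸ J) := by
    have hc : Fintype.card (Sg n) = 2 * n + 2 := by simp; ring
    rw [hc] at h1
    have h4 : (((2 * n + 2 : ℕ) : ℕ∞) : WithBot ℕ∞) ≤ ringKrullDim (MvPolynomial (Sg n) ℂ ⧸ J) +
        (((4 + (∑ i, d i + s) : ℕ) : ℕ∞) : WithBot ℕ∞) :=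
      le_trans h1 (add_le_add le_rfl (WithBot.coe_le_coe.2 h2))
    change ((e : ℕ∞) : WithBot ℕ∞) ≤ _
    generalize ringKrullDim (MvPolynomial (Sg n) ℂ ⧸ J) = D at h4
    induction D with
    | bot =>
      rw [WithBot.bot_add, le_bot_iff] at h4
      exact absurd h4 WithBot.coe_ne_bot
    | coe D =>
      rw [← WithBot.coe_add, WithBot.coe_le_coe] at h4
      rw [WithBot.coe_le_coe]
      induction D with
      | top => exact le_top
      | coe D =>
        have h5 : 2 * n + 2 ≤ D + (4 + (∑ i, d i + s)) := by exact_mod_cast h4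
        have : e ≤ D := by omega
        exact_mod_cast this
  rw [ringKrullDim, Order.le_krullDim_iff] at h3
  obtain ⟨l, hl⟩ := h3
  subst hl
  have hJQ : ∀ i, J ≤ (l i).asIdeal.comap (Ideal.Quotient.mk J) := by
    intro i x hx
    rw [Ideal.mem_comap, Ideal.Quotient.eq_zero_iff_mem.2 hx]
    exact zero_mem _
  refine ⟨fun i => (l i).asIdeal.comap (Ideal.Quotient.mk J), ?_, ?_, ?_⟩
  · intro i j hij
    have h5 : (l i).asIdeal < (l j).asIdeal := l.strictMono hij
    refine lt_of_le_of_ne (Ideal.comap_mono h5.le) fun h => h5.ne ?_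
    exact Ideal.comap_injective_of_surjective _ Ideal.Quotient.mk_surjective h
  · intro i
    exact Ideal.IsPrime.comap _
  · intro i v hv
    rw [← gens_iff hf]
    intro g
    rw [mem_zeroLocus_iff] at hv
    exact hv _ (hJQ i (Ideal.subset_span ⟨g, rfl⟩))
end FanoAux

namespace FanoAux
set_option linter.unusedSectionVars false
open MvPolynomial

/-- An affine chart of a topological space. -/
structure Chart {σ Y : Type} [TopologicalSpace Y] (Z : Set (σ → ℂ)) (Φ : Z → Y) : Prop where
  cont : ∀ T : Set Y, IsClosed T → ∃ S : Set (MvPolynomial σ ℂ), ∀ p : Z,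
    Φ p ∈ T ↔ ∀ h ∈ S, aeval p.1 h = 0
  loc : ∀ h : MvPolynomial σ ℂ, ∃ T : Set Y, IsClosed T ∧ (∀ p : Z, Φ p ∈ T ↔ aeval p.1 h = 0) ∧
    ∀ y, y ∉ Set.range Φ → y ∈ T

variable {σ Y : Type} [TopologicalSpace Y] {Z : Set (σ → ℂ)} {Φ : Z → Y}

/-- The ideal of a subset in a chart. -/
def idl (Φ : Z → Y) (T : Set Y) : Ideal (MvPolynomial σ ℂ) where
  carrier := {h | ∀ p : Z, Φ p ∈ T → aeval p.1 h = 0}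
  add_mem' := fun ha hb p hp => by rw [map_add, ha p hp, hb p hp, add_zero]
  zero_mem' := fun p _ => map_zero _
  smul_mem' := fun c x hx p hp => by rw [smul_eq_mul, map_mul, hx p hp, mul_zero]

theorem mem_idl {T : Set Y} {h : MvPolynomial σ ℂ} :
    h ∈ idl Φ T ↔ ∀ p : Z, Φ p ∈ T → aeval p.1 h = 0 := Iff.rfl

theorem Chart.prime (c : Chart Z Φ) {T : Set Y} (hT : IsIrreducible T) (p0 : Z) (hp0 : Φ p0 ∈ T) :
    (idl Φ T).IsPrime := by
  refine ⟨fun h => ?_, ?_⟩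
  · have := (Ideal.eq_top_iff_one _).1 h p0 hp0
    simp at this
  · intro g h hgh
    obtain ⟨A, hA, hA1, hA2⟩ := c.loc g
    obtain ⟨B, hB, hB1, hB2⟩ := c.loc h
    have hsub : T ⊆ A ∪ B := by
      intro y hy
      by_cases hr : y ∈ Set.range Φ
      · obtain ⟨p, rfl⟩ := hr
        have := hgh p hy
        rw [map_mul, mul_eq_zero] at this
        exact this.imp (hA1 p).2 (hB1 p).2
      · exact Or.inl (hA2 y hr)
    rcases isPreirreducible_iff_isClosed_union_isClosed.1 hT.2 A B hA hB hsub with h1 | h1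
    · exact Or.inl fun p hp => (hA1 p).1 (h1 hp)
    · exact Or.inr fun p hp => (hB1 p).1 (h1 hp)

theorem Chart.strict (c : Chart Z Φ) {T T' : Set Y} (hT : IsClosed T) (hT' : IsIrreducible T')
    (hlt : T < T') (p0 : Z) (hp0 : Φ p0 ∈ T') : idl Φ T' < idl Φ T := by
  refine lt_of_le_not_ge (fun h hh p hp => hh p (hlt.le hp)) fun hle => ?_
  obtain ⟨S, hS⟩ := c.cont T hT
  obtain ⟨A, hA, hA1, hA2⟩ := c.loc 1
  have hsub : T' ⊆ A ∪ T := by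
    intro y hy
    by_cases hr : y ∈ Set.range Φ
    · obtain ⟨p, rfl⟩ := hr
      right
      rw [hS]
      intro h hh
      exact hle (fun q hq => (hS q).1 hq h hh) p hy
    · exact Or.inl (hA2 y hr)
  rcases isPreirreducible_iff_isClosed_union_isClosed.1 hT'.2 A T hA hT hsub with h1 | h1
  · have := (hA1 p0).1 (h1 hp0)
    simp at this
  · exact not_lt_of_ge h1 hlt

theorem Chart.upper (c : Chart Z Φ) (l : LTSeries (TopologicalSpace.IrreducibleCloseds Y)) (p0 : Z)
    (hp0 : Φ p0 ∈ (l 0 : Set Y)) : ∃ P : ℕ → Ideal (MvPolynomial σ ℂ),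
      (∀ i ≤ l.length, (P i).IsPrime) ∧ (∀ i < l.length, P (i+1) < P i) ∧
      ∀ i ≤ l.length, ∀ h, (∀ p : Z, aeval p.1 h = 0) → h ∈ P i := by
  have h0 : ∀ i : Fin (l.length + 1), Φ p0 ∈ (l i : Set Y) := by
    intro i
    have : l 0 ≤ l i := l.monotone (Fin.zero_le i)
    exact this hp0
  refine ⟨fun i => if h : i < l.length + 1 then idl Φ (l ⟨i, h⟩ : Set Y) else ⊤, ?_, ?_, ?_⟩
  · intro i hi
    beta_reduce
    rw [dif_pos (by omega)]
    exact c.prime (l _).isIrreducible p0 (h0 _)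
  · intro i hi
    beta_reduce
    rw [dif_pos (by omega), dif_pos (by omega)]
    refine c.strict (l _).isClosed (l _).isIrreducible ?_ p0 (h0 _)
    exact l.strictMono (Fin.mk_lt_mk.2 (Nat.lt_succ_self i))
  · intro i hi h hh
    beta_reduce
    rw [dif_pos (by omega)]
    exact fun p _ => hh p

theorem null {σ : Type} [Finite σ] {Q : Ideal (MvPolynomial σ ℂ)} [Q.IsPrime] {h : MvPolynomial σ ℂ} (hh : h ∉ Q) :
    ∃ p ∈ zeroLocus ℂ Q, aeval p h ≠ 0 := by
  by_contra hcon
  push Not at hcon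
  apply hh
  rw [← MvPolynomial.IsPrime.vanishingIdeal_zeroLocus Q (K := ℂ)]
  exact hcon

theorem Chart.irred [Finite σ] (c : Chart Z Φ) (Q : Ideal (MvPolynomial σ ℂ)) [hQ : Q.IsPrime]
    (hZ : zeroLocus ℂ Q ⊆ Z) : IsIrreducible (Φ '' {p | p.1 ∈ zeroLocus ℂ Q}) := by
  constructor
  · obtain ⟨p, hp, -⟩ := null (Q := Q) (h := 1) (fun h => hQ.ne_top ((Ideal.eq_top_iff_one _).2 h))
    exact ⟨_, ⟨p, hZ hp⟩, hp, rfl⟩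
  · rw [isPreirreducible_iff_isClosed_union_isClosed]
    intro A B hA hB hsub
    obtain ⟨S, hS⟩ := c.cont A hA
    obtain ⟨S', hS'⟩ := c.cont B hB
    by_contra hcon
    push Not at hcon
    obtain ⟨h1, h2⟩ := hcon
    have aux : ∀ (A : Set Y) (S : Set (MvPolynomial σ ℂ)), (∀ p : Z, Φ p ∈ A ↔ ∀ h ∈ S, aeval p.1 h = 0) →
        ¬ (Φ '' {p | p.1 ∈ zeroLocus ℂ Q} ⊆ A) → ∃ h ∈ S, h ∉ Q := by
      intro A S hS hn
      rw [Set.not_subset] at hn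
      obtain ⟨_, ⟨p, hp, rfl⟩, hpA⟩ := hn
      rw [hS] at hpA
      push Not at hpA
      obtain ⟨h, hh, hne⟩ := hpA
      exact ⟨h, hh, fun hq => hne (hp h hq)⟩
    obtain ⟨g, hg, hgQ⟩ := aux A S hS h1
    obtain ⟨h, hh, hhQ⟩ := aux B S' hS' h2
    obtain ⟨p, hp, hne⟩ := null (Q := Q) (h := g * h) (fun hm => (hQ.mem_or_mem hm).elim hgQ hhQ)
    rw [map_mul] at hne
    rcases hsub ⟨⟨p, hZ hp⟩, hp, rfl⟩ with h3 | h3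
    · exact hne (by rw [(hS _).1 h3 g hg, zero_mul])
    · exact hne (by rw [(hS' _).1 h3 h hh, mul_zero])

theorem Chart.lower [Finite σ] (c : Chart Z Φ) {e : ℕ} (Q : Fin (e+1) → Ideal (MvPolynomial σ ℂ))
    (hQ : StrictMono Q) (hp : ∀ i, (Q i).IsPrime) (hZ : ∀ i, zeroLocus ℂ (Q i) ⊆ Z) :
    (e : WithBot ℕ∞) ≤ topologicalKrullDim Y := by
  let T : Fin (e+1) → TopologicalSpace.IrreducibleCloseds Y := fun i =>
    { carrier := closure (Φ '' {p | p.1 ∈ zeroLocus ℂ (Q i)})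
      isIrreducible' := by
        haveI := hp i
        exact (c.irred (Q i) (hZ i)).closure
      isClosed' := isClosed_closure }
  have hT : StrictAnti T := by
    intro i j hij
    have hlt := hQ hij
    refine lt_of_le_not_ge ?_ ?_
    · change closure _ ⊆ closure _
      refine closure_mono (Set.image_mono ?_)
      intro p hp h hh
      exact hp h (hlt.le hh)
    · intro hle
      obtain ⟨h, hj, hi⟩ := SetLike.exists_of_lt hlt
      haveI := hp i
      obtain ⟨p, hpz, hne⟩ := null hi
      obtain ⟨A, hA, hA1, hA2⟩ := c.loc h
      have h1 : closure (Φ '' {p | p.1 ∈ zeroLocus ℂ (Q j)}) ⊆ A := by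
        refine closure_minimal ?_ hA
        rintro _ ⟨q, hq, rfl⟩
        exact (hA1 q).2 (hq h hj)
      have h2 : Φ ⟨p, hZ i hpz⟩ ∈ closure (Φ '' {p | p.1 ∈ zeroLocus ℂ (Q i)}) :=
        subset_closure (Set.mem_image_of_mem Φ (x := (⟨p, hZ i hpz⟩ : Z)) hpz)
      have h3 : closure (Φ '' {p | p.1 ∈ zeroLocus ℂ (Q i)}) ⊆
        closure (Φ '' {p | p.1 ∈ zeroLocus ℂ (Q j)}) := hle
      have h4 := h1 (h3 h2)
      exact hne ((hA1 ⟨p, hZ i hpz⟩).1 h4)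
  rw [topologicalKrullDim, Order.le_krullDim_iff]
  refine ⟨⟨e, fun i => T i.rev, fun i => ?_⟩, rfl⟩
  apply hT
  rw [Fin.rev_lt_rev]
  exact Fin.castSucc_lt_succ
end FanoAux

namespace FanoAux
set_option linter.unusedSectionVars false
open MvPolynomial
variable {n s : ℕ} {d : Fin s → ℕ} {f : Fin s → PR n}

theorem ae_eval {ι : Type} (w : ι → ℂ) (h : MvPolynomial ι ℂ) : aeval w h = eval w h := by
  rw [aeval_def]; rfl

theorem frame_finrank {U V : Fin (n+1) → ℂ} {j0 j1} (fr : Frame U V j0 j1) :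
    Module.finrank ℂ (Submodule.span ℂ {U, V}) = 2 := by
  have hli : LinearIndependent ℂ ![U, V] := by
    rw [LinearIndependent.pair_iff]
    intro a b h
    have h0 := congrFun h j0
    have h1 := congrFun h j1
    simp [fr.U0, fr.V0, fr.U1, fr.V1] at h0 h1
    exact ⟨h0, h1⟩
  have := finrank_span_eq_card hli
  have e : Set.range ![U, V] = {U, V} := by
    simp only [Matrix.range_cons, Matrix.range_empty, Set.union_empty]; rfl
  rw [e] at this
  simpa using this

/-- The line spanned by a frame. -/
def mkLine (w : Sg n → ℂ) {j0 j1} (fr : Frame (fun c => w (Sum.inl c)) (fun c => w (Sum.inr c)) j0 j1) :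
    ProjLine n := ⟨Submodule.span ℂ {(fun c => w (Sum.inl c)), (fun c => w (Sum.inr c))}, frame_finrank fr⟩

theorem mem_mkLine {w : Sg n → ℂ} {j0 j1} {fr : Frame (fun c => w (Sum.inl c)) (fun c => w (Sum.inr c)) j0 j1}
    {z : Fin (n+1) → ℂ} : z ∈ (mkLine w fr).1 ↔
      ∃ a b : ℂ, z = fun c => a * w (Sum.inl c) + b * w (Sum.inr c) := by
  change z ∈ Submodule.span ℂ _ ↔ _
  rw [Submodule.mem_span_pair]
  constructor
  · rintro ⟨a, b, rfl⟩; exact ⟨a, b, rfl⟩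
  · rintro ⟨a, b, rfl⟩; exact ⟨a, b, rfl⟩

theorem fr_unique {w : Sg n → ℂ} {j0 j1} {fr : Frame (fun c => w (Sum.inl c)) (fun c => w (Sum.inr c)) j0 j1}
    {u v : Fin (n+1) → ℂ} (hu : u ∈ (mkLine w fr).1) (hv : v ∈ (mkLine w fr).1)
    (hp : plu u v j0 j1 ≠ 0) :
    frU u v j0 j1 = (fun c => w (Sum.inl c)) ∧ frV u v j0 j1 = (fun c => w (Sum.inr c)) := by
  obtain ⟨a, b, rfl⟩ := mem_mkLine.1 hu
  obtain ⟨a', b', rfl⟩ := mem_mkLine.1 hv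
  have hU0 := fr.U0
  have hU1 := fr.U1
  have hV0 := fr.V0
  have hV1 := fr.V1
  beta_reduce at hU0 hU1 hV0 hV1
  have e : ∀ x, (plu (fun c => a * w (Sum.inl c) + b * w (Sum.inr c))
      (fun c => a' * w (Sum.inl c) + b' * w (Sum.inr c)) x j1) =
      plu (fun c => a * w (Sum.inl c) + b * w (Sum.inr c))
      (fun c => a' * w (Sum.inl c) + b' * w (Sum.inr c)) j0 j1 * w (Sum.inl x) := by
    intro x
    simp only [plu, hU0, hU1, hV0, hV1]; ring
  have e' : ∀ x, (plu (fun c => a * w (Sum.inl c) + b * w (Sum.inr c))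
      (fun c => a' * w (Sum.inl c) + b' * w (Sum.inr c)) j0 x) =
      plu (fun c => a * w (Sum.inl c) + b * w (Sum.inr c))
      (fun c => a' * w (Sum.inl c) + b' * w (Sum.inr c)) j0 j1 * w (Sum.inr x) := by
    intro x
    simp only [plu, hU0, hU1, hV0, hV1]; ring
  constructor
  · funext x
    rw [frU, e x, inv_mul_cancel_left₀ hp]
  · funext x
    rw [frV, e' x, inv_mul_cancel_left₀ hp]

/-- Every line with a nonzero Pluecker coordinate lies in the chart. -/
theorem line_of_plu (W : ProjLine n) {u v : Fin (n+1) → ℂ} (hu : u ∈ W.1) (hv : v ∈ W.1) {j0 j1}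
    (hp : plu u v j0 j1 ≠ 0) : ∃ (w : Sg n → ℂ)
      (fr : Frame (fun c => w (Sum.inl c)) (fun c => w (Sum.inr c)) j0 j1), mkLine w fr = W := by
  refine ⟨Sum.elim (frU u v j0 j1) (frV u v j0 j1), fr_frame hp, ?_⟩
  apply Subtype.ext
  have h1 : frU u v j0 j1 ∈ W.1 := by
    have : frU u v j0 j1 = ((plu u v j0 j1)⁻¹ * v j1) • u - ((plu u v j0 j1)⁻¹ * u j1) • v := by
      funext c
      simp only [frU, plu, Pi.sub_apply, Pi.smul_apply, smul_eq_mul]; ring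
    rw [this]
    exact W.1.sub_mem (W.1.smul_mem _ hu) (W.1.smul_mem _ hv)
  have h2 : frV u v j0 j1 ∈ W.1 := by
    have : frV u v j0 j1 = ((plu u v j0 j1)⁻¹ * u j0) • v - ((plu u v j0 j1)⁻¹ * v j0) • u := by
      funext c
      simp only [frV, plu, Pi.sub_apply, Pi.smul_apply, smul_eq_mul]; ring
    rw [this]
    exact W.1.sub_mem (W.1.smul_mem _ hv) (W.1.smul_mem _ hu)
  refine Submodule.eq_of_le_of_finrank_eq ?_ ((mkLine _ _).2.trans W.2.symm)
  change Submodule.span ℂ _ ≤ _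
  rw [Submodule.span_le]
  rintro z (rfl | rfl)
  · exact h1
  · exact h2

theorem exists_plu (W : ProjLine n) : ∃ u ∈ W.1, ∃ v ∈ W.1, ∃ j0 j1, plu u v j0 j1 ≠ 0 := by
  by_contra hcon
  push Not at hcon
  have hpos : 0 < Module.finrank ℂ W.1 := by have := W.2; omega
  haveI := Module.finrank_pos_iff.1 hpos
  obtain ⟨⟨u, hu⟩, hne⟩ := exists_ne (0 : W.1)
  have hu0 : u ≠ 0 := fun h => hne (Subtype.ext h)
  obtain ⟨a, ha⟩ := Function.ne_iff.1 hu0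
  have ha : u a ≠ 0 := ha
  have : Module.finrank ℂ W.1 ≤ 1 := by
    refine finrank_le_one ⟨u, hu⟩ ?_
    rintro ⟨v, hv⟩
    refine ⟨v a / u a, Subtype.ext ?_⟩
    funext c
    have := hcon u hu v hv a c
    simp only [plu] at this
    change v a / u a * u c = v c
    field_simp
    linear_combination -this
  have := W.2
  omega

/-- The locus of lines on which `F` vanishes. -/
def vloc (F : MvPolynomial (Sg n) ℂ) : Set (ProjLine n) :=
  {W | ∀ u ∈ W.1, ∀ v ∈ W.1, eval (Sum.elim u v) F = 0}

theorem isClosed_vloc (F : MvPolynomial (Sg n) ℂ) : IsClosed (vloc F) := by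
  constructor
  exact TopologicalSpace.isOpen_generateFrom_of_mem ⟨F, rfl⟩

/-- Substitution of linear combinations. -/
def subst (F : MvPolynomial (Sg n) ℂ) (a b a' b' : ℂ) : MvPolynomial (Sg n) ℂ :=
  aeval (Sum.elim (fun c => C a * X (Sum.inl c) + C b * X (Sum.inr c))
    (fun c => C a' * X (Sum.inl c) + C b' * X (Sum.inr c))) F

theorem aeval_subst (F : MvPolynomial (Sg n) ℂ) (a b a' b' : ℂ) (w : Sg n → ℂ) :
    aeval w (subst F a b a' b') = eval (Sum.elim (fun c => a * w (Sum.inl c) + b * w (Sum.inr c))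
      (fun c => a' * w (Sum.inl c) + b' * w (Sum.inr c))) F := by
  rw [subst, comp_aeval_apply, ← ae_eval]
  congr 2
  funext c
  rcases c with c | c <;> simp

theorem open_pull (O : Set (ProjLine n)) (hO : IsOpen O) (j0 j1 : Fin (n+1)) :
    ∃ S : Set (MvPolynomial (Sg n) ℂ), ∀ (w : Sg n → ℂ)
      (fr : Frame (fun c => w (Sum.inl c)) (fun c => w (Sum.inr c)) j0 j1),
      mkLine w fr ∈ O ↔ ∃ h ∈ S, aeval w h ≠ 0 := by
  induction hO with
  | basic U hU =>
    obtain ⟨F, rfl⟩ := hU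
    refine ⟨{h | ∃ a b a' b', h = subst F a b a' b'}, fun w fr => ?_⟩
    constructor
    · intro h
      change ¬ ∀ u ∈ _, ∀ v ∈ _, _ at h
      push Not at h
      obtain ⟨u, hu, v, hv, hne⟩ := h
      obtain ⟨a, b, rfl⟩ := mem_mkLine.1 hu
      obtain ⟨a', b', rfl⟩ := mem_mkLine.1 hv
      exact ⟨_, ⟨a, b, a', b', rfl⟩, by rwa [aeval_subst]⟩
    · rintro ⟨_, ⟨a, b, a', b', rfl⟩, hne⟩ h
      rw [aeval_subst] at hne
      exact hne (h _ (mem_mkLine.2 ⟨a, b, rfl⟩) _ (mem_mkLine.2 ⟨a', b', rfl⟩))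
  | univ => exact ⟨{1}, fun w fr => by simp⟩
  | inter A B _ _ hA hB =>
    obtain ⟨S, hS⟩ := hA
    obtain ⟨S', hS'⟩ := hB
    refine ⟨{h | ∃ g ∈ S, ∃ g' ∈ S', h = g * g'}, fun w fr => ?_⟩
    rw [Set.mem_inter_iff, hS, hS']
    constructor
    · rintro ⟨⟨g, hg, h1⟩, ⟨g', hg', h2⟩⟩
      exact ⟨_, ⟨g, hg, g', hg', rfl⟩, by rw [map_mul]; exact mul_ne_zero h1 h2⟩
    · rintro ⟨_, ⟨g, hg, g', hg', rfl⟩, hne⟩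
      rw [map_mul] at hne
      exact ⟨⟨g, hg, left_ne_zero_of_mul hne⟩, ⟨g', hg', right_ne_zero_of_mul hne⟩⟩
  | sUnion K _ ih =>
    choose! S hS using ih
    refine ⟨⋃ A ∈ K, S A, fun w fr => ?_⟩
    rw [Set.mem_sUnion]
    constructor
    · rintro ⟨A, hA, hw⟩
      obtain ⟨h, h1, h2⟩ := (hS A hA w fr).1 hw
      exact ⟨h, Set.mem_biUnion hA h1, h2⟩
    · rintro ⟨h, h1, h2⟩
      obtain ⟨A, hA, h3⟩ := Set.mem_iUnion₂.1 h1
      exact ⟨A, hA, (hS A hA w fr).2 ⟨h, h3, h2⟩⟩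

/-- The Pluecker coordinate as a polynomial. -/
def pluP (a b : Fin (n+1)) : MvPolynomial (Sg n) ℂ :=
  X (Sum.inl a) * X (Sum.inr b) - X (Sum.inl b) * X (Sum.inr a)

theorem eval_pluP (a b : Fin (n+1)) (u v : Fin (n+1) → ℂ) : eval (Sum.elim u v) (pluP a b) = plu u v a b := by
  simp [pluP, plu]

theorem exists_hom (j0 j1 : Fin (n+1)) (h : MvPolynomial (Sg n) ℂ) :
    ∃ (N : ℕ) (G : MvPolynomial (Sg n) ℂ), ∀ u v : Fin (n+1) → ℂ, plu u v j0 j1 ≠ 0 →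
      eval (Sum.elim u v) G = plu u v j0 j1 ^ N * eval (Sum.elim (frU u v j0 j1) (frV u v j0 j1)) h := by
  induction h using MvPolynomial.induction_on with
  | C a => exact ⟨0, C a, fun u v _ => by simp⟩
  | add p q hp hq =>
    obtain ⟨N, G, hG⟩ := hp
    obtain ⟨N', G', hG'⟩ := hq
    refine ⟨N + N', pluP j0 j1 ^ N' * G + pluP j0 j1 ^ N * G', fun u v huv => ?_⟩
    rw [map_add, map_mul, map_mul, map_pow, map_pow, eval_pluP, hG u v huv, hG' u v huv, map_add]
    ring
  | mul_X p i hp =>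
    obtain ⟨N, G, hG⟩ := hp
    rcases i with c | c
    · refine ⟨N + 1, G * pluP c j1, fun u v huv => ?_⟩
      rw [map_mul, eval_pluP, hG u v huv, map_mul, eval_X, Sum.elim_inl, frU]
      field_simp
      ring
    · refine ⟨N + 1, G * pluP j0 c, fun u v huv => ?_⟩
      rw [map_mul, eval_pluP, hG u v huv, map_mul, eval_X, Sum.elim_inr, frV]
      field_simp
      ring

theorem exists_loc (j0 j1 : Fin (n+1)) (h : MvPolynomial (Sg n) ℂ) :
    ∃ T : Set (ProjLine n), IsClosed T ∧ (∀ (w : Sg n → ℂ)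
      (fr : Frame (fun c => w (Sum.inl c)) (fun c => w (Sum.inr c)) j0 j1),
      mkLine w fr ∈ T ↔ aeval w h = 0) ∧ ∀ W : ProjLine n, (¬ ∃ (w : Sg n → ℂ)
      (fr : Frame (fun c => w (Sum.inl c)) (fun c => w (Sum.inr c)) j0 j1), mkLine w fr = W) → W ∈ T := by
  obtain ⟨N, G, hG⟩ := exists_hom j0 j1 h
  refine ⟨vloc (pluP j0 j1 * G), isClosed_vloc _, ?_, ?_⟩
  · intro w fr
    have hel : Sum.elim (fun c => w (Sum.inl c)) (fun c => w (Sum.inr c)) = w := by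
      funext c; rcases c with c | c <;> rfl
    constructor
    · intro hW
      have hU : (fun c => w (Sum.inl c)) ∈ (mkLine w fr).1 := mem_mkLine.2 ⟨1, 0, by funext c; simp⟩
      have hV : (fun c => w (Sum.inr c)) ∈ (mkLine w fr).1 := mem_mkLine.2 ⟨0, 1, by funext c; simp⟩
      have hp : plu (fun c => w (Sum.inl c)) (fun c => w (Sum.inr c)) j0 j1 ≠ 0 := by
        have hU0 := fr.U0
        have hU1 := fr.U1
        have hV0 := fr.V0
        have hV1 := fr.V1
        beta_reduce at hU0 hU1 hV0 hV1
        simp [plu, hU0, hU1, hV0, hV1]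
      have h1 := hW _ hU _ hV
      obtain ⟨e1, e2⟩ := fr_unique hU hV hp
      rw [map_mul, eval_pluP, hG _ _ hp, e1, e2] at h1
      have h2 := (mul_eq_zero.1 ((mul_eq_zero.1 h1).resolve_left hp)).resolve_left (pow_ne_zero _ hp)
      rw [hel] at h2
      rw [ae_eval]; exact h2
    · intro hw u hu v hv
      rw [map_mul, eval_pluP]
      by_cases hp : plu u v j0 j1 = 0
      · rw [hp, zero_mul]
      · obtain ⟨e1, e2⟩ := fr_unique hu hv hp
        rw [hG _ _ hp, e1, e2, hel]
        rw [ae_eval] at hw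
        rw [show eval w h = 0 from hw, mul_zero, mul_zero]
  · intro W hW u hu v hv
    rw [map_mul, eval_pluP]
    by_cases hp : plu u v j0 j1 = 0
    · rw [hp, zero_mul]
    · exact absurd (line_of_plu W hu hv hp) hW
end FanoAux

namespace FanoAux
set_option linter.unusedSectionVars false
open MvPolynomial
variable {n s : ℕ} {d : Fin s → ℕ} {f : Fin s → PR n}

theorem mem_fano (hf : ∀ i, (f i).IsHomogeneous (d i)) {Xs : Set (Projectivization ℂ (Fin (n + 1) → ℂ))}
    (hX : Xs = {x | ∀ i, eval x.rep (f i) = 0}) (hd : ∀ i, 2 ≤ d i) (W : ProjLine n) :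
    W ∈ fanoLines Xs ↔ ∀ z ∈ W.1, ∀ i, eval z (f i) = 0 := by
  subst hX
  constructor
  · intro h z hz i
    by_cases hz0 : z = 0
    · subst hz0
      have := eval_scale (hf i) (0:ℂ) (0 : Fin (n+1) → ℂ)
      rw [zero_pow (by have := hd i; omega), zero_mul] at this
      rw [← ae_eval, ← this]
      congr 2
      funext c; simp
    · obtain ⟨a, ha⟩ := Projectivization.exists_smul_eq_mk_rep ℂ z hz0
      have h1 : (Projectivization.mk ℂ z hz0) ∈ lineSet W.1 := by
        change (Projectivization.mk ℂ z hz0).rep ∈ W.1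
        rw [← ha]
        exact W.1.smul_mem (a : ℂ) hz
      have h2 := h h1 i
      rw [← ha, ← ae_eval] at h2
      have h3 := eval_scale (hf i) (a : ℂ) z
      have h4 : (a : ℂ) ^ d i * aeval z (f i) = 0 := by
        rw [← h3, ← h2]; rfl
      rw [← ae_eval]
      exact (mul_eq_zero.1 h4).resolve_left (pow_ne_zero _ a.ne_zero)
  · intro h x hx i
    exact h _ hx i

/-- The points of the chart of the Fano variety of lines. -/
def chZ (f : Fin s → PR n) (j0 j1 : Fin (n+1)) : Set (Sg n → ℂ) :=
  {w | Frame (fun c => w (Sum.inl c)) (fun c => w (Sum.inr c)) j0 j1 ∧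
    ∀ i, phi (fun c => w (Sum.inl c)) (fun c => w (Sum.inr c)) (f i) = 0}

theorem mkLine_mem (hf : ∀ i, (f i).IsHomogeneous (d i)) {Xs : Set (Projectivization ℂ (Fin (n + 1) → ℂ))}
    (hX : Xs = {x | ∀ i, eval x.rep (f i) = 0}) (hd : ∀ i, 2 ≤ d i) (w : Sg n → ℂ) {j0 j1}
    (fr : Frame (fun c => w (Sum.inl c)) (fun c => w (Sum.inr c)) j0 j1) :
    mkLine w fr ∈ fanoLines Xs ↔ ∀ i, phi (fun c => w (Sum.inl c)) (fun c => w (Sum.inr c)) (f i) = 0 := by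
  rw [mem_fano hf hX hd]
  constructor
  · intro h i
    refine poly_zero_of_complex _ fun r => ?_
    rw [phi_eval, ae_eval]
    refine h _ (mem_mkLine.2 ⟨1, r, ?_⟩) i
    funext c; simp
  · intro h z hz i
    obtain ⟨a, b, rfl⟩ := mem_mkLine.1 hz
    have := comb_van (hf i) (hf i) 0 1 (by rw [h i]; simp) a b
    rw [← ae_eval]
    simpa only [zero_mul, zero_add, one_mul] using this

/-- The chart map. -/
def chΦ (hf : ∀ i, (f i).IsHomogeneous (d i)) {Xs : Set (Projectivization ℂ (Fin (n + 1) → ℂ))}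
    (hX : Xs = {x | ∀ i, eval x.rep (f i) = 0}) (hd : ∀ i, 2 ≤ d i) (j0 j1 : Fin (n+1))
    (w : chZ f j0 j1) : ↥(fanoLines Xs) :=
  ⟨mkLine w.1 w.2.1, (mkLine_mem hf hX hd w.1 w.2.1).2 w.2.2⟩

theorem chart (hf : ∀ i, (f i).IsHomogeneous (d i)) {Xs : Set (Projectivization ℂ (Fin (n + 1) → ℂ))}
    (hX : Xs = {x | ∀ i, eval x.rep (f i) = 0}) (hd : ∀ i, 2 ≤ d i) (j0 j1 : Fin (n+1)) :
    Chart (chZ f j0 j1) (chΦ hf hX hd j0 j1) := by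
  constructor
  · intro T hT
    obtain ⟨T0, hT0, rfl⟩ := isClosed_induced_iff.1 hT
    obtain ⟨S, hS⟩ := open_pull T0ᶜ hT0.isOpen_compl j0 j1
    refine ⟨S, fun p => ?_⟩
    have := hS p.1 p.2.1
    rw [Set.mem_compl_iff, not_iff_comm] at this
    change mkLine p.1 p.2.1 ∈ T0 ↔ _
    rw [← this]
    push Not
    rfl
  · intro h
    obtain ⟨T, hT, h1, h2⟩ := exists_loc j0 j1 h
    refine ⟨Subtype.val ⁻¹' T, hT.preimage continuous_subtype_val, fun p => h1 p.1 p.2.1, ?_⟩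
    intro y hy
    refine h2 y.1 ?_
    rintro ⟨w, fr, hw⟩
    refine hy ⟨⟨w, fr, ?_⟩, Subtype.ext hw⟩
    rw [← mkLine_mem hf hX hd w fr, hw]
    exact y.2

theorem main (H : SmoothData n s d f) {Xs : Set (Projectivization ℂ (Fin (n + 1) → ℂ))}
    (hX : Xs = {x | ∀ i, eval x.rep (f i) = 0}) (hs : 2 ≤ s) (hd : ∑ i, d i ≤ s + 5)
    (hn : ∑ i, d i ≤ n) (e : ℕ) (he : e + ∑ i, d i + s + 2 = 2 * n) :
    topologicalKrullDim ↥(fanoLines Xs) = (e : WithBot ℕ∞) := by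
  apply le_antisymm
  · rw [topologicalKrullDim]
    refine iSup_le fun l => ?_
    by_contra hcon
    have hlen : e + 1 ≤ l.length := by
      by_contra h
      exact hcon (by exact_mod_cast (by omega : l.length ≤ e))
    obtain ⟨y, hy⟩ := (l 0).isIrreducible.1
    obtain ⟨u, hu, v, hv, j0, j1, hp⟩ := exists_plu y.1
    obtain ⟨w, fr, hw⟩ := line_of_plu y.1 hu hv hp
    have hwZ : w ∈ chZ f j0 j1 := by
      refine ⟨fr, ?_⟩
      rw [← mkLine_mem H.homog hX H.two_le w fr, hw]
      exact y.2
    have hyw : chΦ H.homog hX H.two_le j0 j1 ⟨w, hwZ⟩ = y := Subtype.ext hw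
    obtain ⟨P, h1, h2, h3⟩ := (chart H.homog hX H.two_le j0 j1).upper l ⟨w, hwZ⟩ (by rw [hyw]; exact hy)
    obtain ⟨x, hx⟩ := chain_indep l.length P h1 h2
    haveI := h1 l.length le_rfl
    refine upper_alg H (by omega) hd hn (P l.length) j0 j1 ?_ ?_ ?_ ?_ ?_ x hx (by omega)
    · refine h3 _ le_rfl _ fun p => ?_
      have := p.2.1.U0
      simp [this]
    · refine h3 _ le_rfl _ fun p => ?_
      have := p.2.1.U1
      simp [this]
    · refine h3 _ le_rfl _ fun p => ?_
      have := p.2.1.V0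
      simp [this]
    · refine h3 _ le_rfl _ fun p => ?_
      have := p.2.1.V1
      simp [this]
    · intro i r
      refine h3 _ le_rfl _ fun p => ?_
      rw [aeval_onEq, ← phi_eval, p.2.2 i, Polynomial.eval_zero]
  · have hsum : 2 * s ≤ ∑ i, d i := by
      calc 2 * s = ∑ _i : Fin s, 2 := by simp [mul_comm]
        _ ≤ _ := Finset.sum_le_sum fun i _ => H.two_le i
    obtain ⟨U, V, j0, j1, fr, on⟩ := exists_line f H.two_le H.homog hn ⟨0, by omega⟩ ⟨1, by omega⟩
      (by simp) ⟨0, by omega⟩ ⟨1, by omega⟩ (by simp)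
    obtain ⟨Q, h1, h2, h3⟩ := lower_alg H.homog j0 j1 (Sum.elim U V) fr on e (by omega)
    exact (chart H.homog hX H.two_le j0 j1).lower Q h1 h2 h3

theorem deg_cases (d : Fin s → ℕ) (hdeg : (↑(List.ofFn d) : Multiset ℕ) = {2, 2, 2, 2} ∨
      (↑(List.ofFn d) : Multiset ℕ) = {2, 2, 4} ∨
      (↑(List.ofFn d) : Multiset ℕ) = {2, 3, 3} ∨
      (↑(List.ofFn d) : Multiset ℕ) = {2, 2, 2, 3} ∨
      (↑(List.ofFn d) : Multiset ℕ) = {2, 2, 2, 2, 2}) :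
    2 ≤ s ∧ ∑ i, d i ≤ s + 5 ∧ s + 2 ≤ ∑ i, d i := by
  have h1 : Multiset.sum (↑(List.ofFn d) : Multiset ℕ) = ∑ i, d i := by
    rw [Multiset.sum_coe, List.sum_ofFn]
  have h2 : Multiset.card (↑(List.ofFn d) : Multiset ℕ) = s := by simp
  rcases hdeg with h | h | h | h | h <;> rw [h] at h1 h2 <;> simp at h1 h2 <;> omega

end FanoAux

/-- **Corollary.**  Let `X ⊆ ℙ^n` be a smooth Fano complete intersection whose multidegree
`(d_1, …, d_s)` is, as a multiset, one of `(2,2,2,2)`, `(2,2,4)`, `(2,3,3)`, `(2,2,2,3)`,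
`(2,2,2,2,2)` (so `8 ≤ d ≤ 10` and `n ≥ d` where `d := Σ d_i`).  Then the Fano variety of
lines `F(X)` has dimension exactly `2n − d − s − 2`. -/
theorem dim_fanoLines_of_special_multidegree
    (n s : ℕ) (d : Fin s → ℕ)
    (f : Fin s → MvPolynomial (Fin (n + 1)) ℂ)
    (X : Set (Projectivization ℂ (Fin (n + 1) → ℂ)))
    (hX : IsSmoothCI n s d f X)
    (hFano : ∑ i, d i ≤ n)
    (hdeg : (↑(List.ofFn d) : Multiset ℕ) = {2, 2, 2, 2} ∨
      (↑(List.ofFn d) : Multiset ℕ) = {2, 2, 4} ∨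
      (↑(List.ofFn d) : Multiset ℕ) = {2, 3, 3} ∨
      (↑(List.ofFn d) : Multiset ℕ) = {2, 2, 2, 3} ∨
      (↑(List.ofFn d) : Multiset ℕ) = {2, 2, 2, 2, 2}) :
    topologicalKrullDim ↥(fanoLines X) =
      ((2 * n - ∑ i, d i - s - 2 : ℕ) : WithBot ℕ∞) := by
  obtain ⟨h1, h2, h3⟩ := FanoAux.deg_cases d hdeg
  exact FanoAux.main ⟨hX.two_le_deg, hX.homog, hX.smooth⟩ hX.locus h1 h2 hFano _ (by omega)

end
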